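/- For every ρ ∈ (0,1) there is a constant Q > 1, depending only on ρ, with the following property: for every positive integer N, every 0 < R < ∞, every Z ∈ B_N(ρR), and every (0,1)-form f of class C¹ on B_N(R) ⊆ ℂ^N (l¹ norm) which is ∂̄-closed and Lipschitz continuous on B_N(R), there exists a continuously (real Fréchet) differentiable function U on B_N(ρR) with ∂̄U = f there and |U(z)| ≤ ‖z − Z‖·Q^{1+#z}·(|f|₀ + R|f|₁) for all z ∈ B_N(ρR). -/

import Mathlib

open Set
open scoped ENNReal NNReal

noncomputable section

/-- `l¹`: the space of absolutely summable sequences of complex numbers. -/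
abbrev L1 : Type := lp (fun _ : ℕ => ℂ) 1

/-- `ℂ^N` equipped with the `l¹` norm. -/
abbrev EN (N : ℕ) : Type := PiLp 1 (fun _ : Fin N => ℂ)

/-- The `(0,1)`-part of the real Fréchet derivative of `u` at `z`, applied to `ξ`:
`∂̄u(z)(ξ) = (Du(z)(ξ) + i·Du(z)(iξ))/2`. -/
noncomputable def dbar {V : Type*} [NormedAddCommGroup V] [NormedSpace ℂ V]
    (u : V → ℂ) (z ξ : V) : ℂ :=
  (fderiv ℝ u z ξ + Complex.I * fderiv ℝ u z (Complex.I • ξ)) / 2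

/-- `f` is a `(0,1)`-form of class `C^m` on `Ω`: each `f z` is (continuous) conjugate-linear
and `(z,ξ) ↦ f z ξ` is `m` times continuously differentiable in the real sense on `Ω × V`. -/
def IsForm01 {V : Type*} [NormedAddCommGroup V] [NormedSpace ℂ V]
    (m : ℕ) (Ω : Set V) (f : V → V → ℂ) : Prop :=
  (∀ z ∈ Ω, ∀ ξ η : V, f z (ξ + η) = f z ξ + f z η) ∧
  (∀ z ∈ Ω, ∀ (a : ℂ) (ξ : V), f z (a • ξ) = (starRingEnd ℂ) a * f z ξ) ∧
  ContDiffOn ℝ m (fun p : V × V => f p.1 p.2) (Ω ×ˢ (univ : Set V))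

/-- A `(0,1)`-form `f` is `∂̄`-closed on `Ω`. -/
def DbarClosed {V : Type*} [NormedAddCommGroup V] [NormedSpace ℂ V]
    (Ω : Set V) (f : V → V → ℂ) : Prop :=
  ∀ z ∈ Ω, ∀ ξ η : V, dbar (fun w => f w ξ) z η = dbar (fun w => f w η) z ξ

/-- The set of values `‖f z ξ‖`, `z ∈ A`, `‖ξ‖ ≤ 1`; its sup is `|f|_{0,A}`. -/
def formSet0 {V : Type*} [NormedAddCommGroup V]
    (f : V → V → ℂ) (A : Set V) : Set ℝ :=
  {x | ∃ z ∈ A, ∃ ξ : V, ‖ξ‖ ≤ 1 ∧ x = ‖f z ξ‖}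

/-- The set of difference quotients `‖f z ξ - f w ξ‖/‖z-w‖`; its sup is `|f|_{1,A}`. -/
def formSet1 {V : Type*} [NormedAddCommGroup V]
    (f : V → V → ℂ) (A : Set V) : Set ℝ :=
  {x | ∃ z ∈ A, ∃ w ∈ A, z ≠ w ∧ ∃ ξ : V, ‖ξ‖ ≤ 1 ∧ x = ‖f z ξ - f w ξ‖ / ‖z - w‖}

/-- `|f|_{0,A}`. -/
noncomputable def formNorm0 {V : Type*} [NormedAddCommGroup V]
    (f : V → V → ℂ) (A : Set V) : ℝ := sSup (formSet0 f A)

/-- `|f|_{1,A}`. -/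
noncomputable def formNorm1 {V : Type*} [NormedAddCommGroup V]
    (f : V → V → ℂ) (A : Set V) : ℝ := sSup (formSet1 f A)

/-- `f` is Lipschitz continuous on `A`: `|f|_{0,A} < ∞` and `|f|_{1,A} < ∞`. -/
def LipschitzForm {V : Type*} [NormedAddCommGroup V]
    (f : V → V → ℂ) (A : Set V) : Prop :=
  BddAbove (formSet0 f A) ∧ BddAbove (formSet1 f A)

/-- `‖k‖ = ∑_ν k_ν` for a multiindex `k`. -/
def knormN (k : ℕ →₀ ℕ) : ℕ := k.sum fun _ m => m

/-- `k^k = ∏_ν k_ν^{k_ν}` (with `0^0 = 1`). -/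
noncomputable def kk (k : ℕ →₀ ℕ) : ℝ := ∏ ν ∈ k.support, (k ν : ℝ) ^ k ν

/-- `‖k‖^{‖k‖}` (with `0^0 = 1`). -/
noncomputable def nn (k : ℕ →₀ ℕ) : ℝ := ((knormN k : ℝ)) ^ knormN k

/-- The monomial `z^k = ∏_ν z_ν^{k_ν}` (with `0^0 = 1`). -/
noncomputable def monom (k : ℕ →₀ ℕ) (z : ℕ → ℂ) : ℂ := ∏ ν ∈ k.support, z ν ^ k ν

/-- The term of the series defining `Δ(q,z)` corresponding to the multiindex `k`:
`(‖k‖^{‖k‖}/k^k)·|q|^{#k}·|z^k|`. -/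
noncomputable def DeltaTerm (q : ℂ) (z : ℕ → ℂ) (k : ℕ →₀ ℕ) : ℝ :=
  (nn k / kk k) * ‖q‖ ^ k.support.card * ∏ ν ∈ k.support, ‖z ν‖ ^ k ν

/-- `Δ(q,z) = ∑_k (‖k‖^{‖k‖}/k^k)·|q|^{#k}·|z^k|`. -/
noncomputable def Delta (q : ℂ) (z : ℕ → ℂ) : ℝ := ∑' k, DeltaTerm q z k


open Set
open scoped ENNReal NNReal
noncomputable section
open MeasureTheory Filter Topology

lemma cd1_of_hasFDerivAt {𝕜 E : Type*} [RCLike 𝕜] [NormedAddCommGroup E] [NormedSpace 𝕜 E]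
    {Ω : Set E} (hΩ : IsOpen Ω) {u : E → ℂ} [NormedSpace 𝕜 ℂ] {u' : E → E →L[𝕜] ℂ}
    (h : ∀ z ∈ Ω, HasFDerivAt u (u' z) z) (hc : ContinuousOn u' Ω) : ContDiffOn 𝕜 1 u Ω := by
  have : (1 : WithTop ℕ∞) = 0 + 1 := by simp
  rw [this, contDiffOn_succ_iff_fderiv_of_isOpen hΩ]
  refine ⟨fun z hz => (h z hz).differentiableAt.differentiableWithinAt, by simp, ?_⟩
  rw [contDiffOn_zero]
  exact hc.congr fun z hz => (h z hz).fderiv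

lemma cont_param {E α G : Type*} [TopologicalSpace E] [T2Space E] [LocallyCompactSpace E]
    [FirstCountableTopology E]
    [TopologicalSpace α] [TopologicalSpace.PseudoMetrizableSpace α]
    [MeasurableSpace α] [OpensMeasurableSpace α] [T2Space α]
    [NormedAddCommGroup G] [NormedSpace ℝ G] {μ : Measure α} [IsFiniteMeasureOnCompacts μ]
    {Ω : Set E} (hΩ : IsOpen Ω) {K : Set α} (hK : IsCompact K) {F : E → α → G}
    (hF : ContinuousOn (Function.uncurry F) (Ω ×ˢ K)) :
    ContinuousOn (fun z => ∫ x in K, F z x ∂μ) Ω := by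
  intro z0 hz0
  obtain ⟨C, hC, hzC, hCΩ⟩ := exists_compact_subset hΩ hz0
  have hb : ∃ B, ∀ p ∈ C ×ˢ K, ‖Function.uncurry F p‖ ≤ B :=
    (hC.prod hK).exists_bound_of_continuousOn (hF.mono (prod_mono hCΩ subset_rfl))
  obtain ⟨B, hB⟩ := hb
  apply ContinuousAt.continuousWithinAt
  have hnhds : C ∈ 𝓝 z0 := mem_interior_iff_mem_nhds.1 hzC
  refine continuousAt_of_dominated (bound := fun _ => B) ?_ ?_ ?_ ?_
  · filter_upwards [hnhds] with z hz
    refine ContinuousOn.aestronglyMeasurable_of_isCompact ?_ hK hK.measurableSet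
    exact hF.comp (f := fun x => (z, x)) (by fun_prop) (fun x hx => ⟨hCΩ hz, hx⟩)
  · filter_upwards [hnhds] with z hz
    rw [ae_restrict_iff' hK.measurableSet]
    exact Eventually.of_forall fun x hx => hB (z, x) ⟨hz, hx⟩
  · have : IsFiniteMeasure (μ.restrict K) := ⟨by simpa using hK.measure_lt_top⟩
    exact integrable_const _
  · rw [ae_restrict_iff' hK.measurableSet]
    refine Eventually.of_forall fun x hx => ?_
    have h1 : ContinuousOn (fun z => F z x) Ω :=
      hF.comp (f := fun z => (z, x)) (by fun_prop) (fun z hz => ⟨hz, hx⟩)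
    exact h1.continuousAt (hΩ.mem_nhds hz0)

lemma hasFDerivAt_param {𝕜 E α : Type*} [RCLike 𝕜] [NormedAddCommGroup E] [NormedSpace 𝕜 E]
    [NormedSpace 𝕜 ℂ] [SMulCommClass ℝ 𝕜 ℂ]
    [ProperSpace E]
    [TopologicalSpace α] [TopologicalSpace.PseudoMetrizableSpace α]
    [MeasurableSpace α] [OpensMeasurableSpace α] [T2Space α]
    {μ : Measure α} [IsFiniteMeasureOnCompacts μ]
    {Ω : Set E} (hΩ : IsOpen Ω) {K : Set α} (hK : IsCompact K) {F : E → α → ℂ}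
    {F' : E → α → E →L[𝕜] ℂ}
    (hF : ∀ z ∈ Ω, ContinuousOn (F z) K)
    (hF' : ContinuousOn (Function.uncurry F') (Ω ×ˢ K))
    (hd : ∀ z ∈ Ω, ∀ x ∈ K, HasFDerivAt (fun w => F w x) (F' z x) z) (z0 : E) (hz0 : z0 ∈ Ω) :
    HasFDerivAt (fun z => ∫ x in K, F z x ∂μ) (∫ x in K, F' z0 x ∂μ) z0 := by
  obtain ⟨C, hC, hzC, hCΩ⟩ := exists_compact_subset hΩ hz0
  have hb : ∃ B, ∀ p ∈ C ×ˢ K, ‖Function.uncurry F' p‖ ≤ B :=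
    (hC.prod hK).exists_bound_of_continuousOn (hF'.mono (prod_mono hCΩ subset_rfl))
  obtain ⟨B, hB⟩ := hb
  have hnhds : C ∈ 𝓝 z0 := mem_interior_iff_mem_nhds.1 hzC
  refine hasFDerivAt_integral_of_dominated_of_fderiv_le (bound := fun _ => B) hnhds ?_ ?_ ?_ ?_ ?_ ?_
  · filter_upwards [hnhds] with z hz
    exact ContinuousOn.aestronglyMeasurable_of_isCompact (hF z (hCΩ hz)) hK hK.measurableSet
  · exact (hF z0 hz0).integrableOn_compact hK
  · refine ContinuousOn.aestronglyMeasurable_of_isCompact ?_ hK hK.measurableSet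
    exact hF'.comp (f := fun x => (z0, x)) (by fun_prop) (fun x hx => ⟨hz0, hx⟩)
  · rw [ae_restrict_iff' hK.measurableSet]
    exact Eventually.of_forall fun x hx z hz => hB (z, x) ⟨hz, hx⟩
  · have : IsFiniteMeasure (μ.restrict K) := ⟨by simpa using hK.measure_lt_top⟩
    exact integrable_const _
  · rw [ae_restrict_iff' hK.measurableSet]
    exact Eventually.of_forall fun x hx z hz => hd z (hCΩ hz) x hx

section dbarlemmas
variable {V W : Type*} [NormedAddCommGroup V] [NormedSpace ℂ V] [NormedAddCommGroup W]
  [NormedSpace ℂ W]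

lemma dbar_congr {u v : V → ℂ} {z : V} (h : u =ᶠ[𝓝 z] v) (ξ : V) : dbar u z ξ = dbar v z ξ := by
  unfold dbar; rw [h.fderiv_eq]

lemma dbar_congr_on {u v : V → ℂ} {Ω : Set V} (hΩ : IsOpen Ω) (h : ∀ z ∈ Ω, u z = v z) {z : V}
    (hz : z ∈ Ω) (ξ : V) : dbar u z ξ = dbar v z ξ :=
  dbar_congr (by filter_upwards [hΩ.mem_nhds hz] with w hw using h w hw) ξ

lemma dbar_add {u v : V → ℂ} {z : V} (hu : DifferentiableAt ℝ u z) (hv : DifferentiableAt ℝ v z)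
    (ξ : V) : dbar (fun w => u w + v w) z ξ = dbar u z ξ + dbar v z ξ := by
  unfold dbar
  rw [fderiv_fun_add hu hv]; simp; ring

lemma dbar_sub {u v : V → ℂ} {z : V} (hu : DifferentiableAt ℝ u z) (hv : DifferentiableAt ℝ v z)
    (ξ : V) : dbar (fun w => u w - v w) z ξ = dbar u z ξ - dbar v z ξ := by
  unfold dbar
  rw [fderiv_fun_sub hu hv]; simp; ring

lemma dbar_const (c : ℂ) (z ξ : V) : dbar (fun _ => c) z ξ = 0 := by
  unfold dbar; simp

lemma dbar_mul {u v : V → ℂ} {z : V} (hu : DifferentiableAt ℝ u z) (hv : DifferentiableAt ℝ v z)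
    (ξ : V) : dbar (fun w => u w * v w) z ξ = dbar u z ξ * v z + u z * dbar v z ξ := by
  unfold dbar
  rw [fderiv_fun_mul hu hv]; simp; ring

lemma dbar_const_mul {v : V → ℂ} {z : V} (c : ℂ) (hv : DifferentiableAt ℝ v z)
    (ξ : V) : dbar (fun w => c * v w) z ξ = c * dbar v z ξ := by
  rw [dbar_mul (differentiableAt_const c) hv, dbar_const]; ring

lemma dbar_sum {ι : Type*} (s : Finset ι) {u : ι → V → ℂ} {z : V}
    (hu : ∀ i ∈ s, DifferentiableAt ℝ (u i) z) (ξ : V) :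
    dbar (fun w => ∑ i ∈ s, u i w) z ξ = ∑ i ∈ s, dbar (u i) z ξ := by
  unfold dbar
  rw [fderiv_fun_sum hu]
  rw [← Finset.sum_div, Finset.sum_add_distrib]
  simp [Finset.mul_sum]

lemma dbar_vadd (u : V → ℂ) (z ξ η : V) : dbar u z (ξ + η) = dbar u z ξ + dbar u z η := by
  unfold dbar; simp; ring

lemma fderiv_csmul (u : V → ℂ) (z ξ : V) (a : ℂ) :
    fderiv ℝ u z (a • ξ) = a.re * fderiv ℝ u z ξ + a.im * fderiv ℝ u z (Complex.I • ξ) := by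
  have : a • ξ = a.re • ξ + a.im • (Complex.I • ξ) := by
    conv_lhs => rw [← Complex.re_add_im a]
    rw [add_smul, mul_smul]; simp
  rw [this]; simp

lemma dbar_smul (u : V → ℂ) (z ξ : V) (a : ℂ) :
    dbar u z (a • ξ) = (starRingEnd ℂ) a * dbar u z ξ := by
  unfold dbar
  rw [← mul_smul, fderiv_csmul, fderiv_csmul u z ξ (Complex.I * a)]
  have h2 : (starRingEnd ℂ) a = a.re - a.im * Complex.I := by
    apply Complex.ext <;> simp
  rw [h2]
  simp
  ring_nf
  simp; ring

lemma dbar_comp {u : W → ℂ} {L : V → W} {L' : V →L[ℂ] W} {z : V} (hu : DifferentiableAt ℝ u (L z))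
    (hL : HasFDerivAt L (L'.restrictScalars ℝ) z)
    (ξ : V) : dbar (fun w => u (L w)) z ξ = dbar u (L z) (L' ξ) := by
  unfold dbar
  have : fderiv ℝ (fun w => u (L w)) z = (fderiv ℝ u (L z)).comp (L'.restrictScalars ℝ) :=
    (hu.hasFDerivAt.comp z hL).fderiv
  rw [this]; simp

lemma dbar_zero_of_diff {u : V → ℂ} {z : V} (h : DifferentiableAt ℂ u z) (ξ : V) :
    dbar u z ξ = 0 := by
  unfold dbar
  rw [h.fderiv_restrictScalars ℝ]
  simp [← mul_assoc]

lemma clin_of_dbar_zero {u : V → ℂ} {z : V} (hd : DifferentiableAt ℝ u z)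
    (h : ∀ ξ, dbar u z ξ = 0) : DifferentiableAt ℂ u z := by
  rw [differentiableAt_iff_restrictScalars ℝ hd]
  have hI : ∀ ξ, fderiv ℝ u z (Complex.I • ξ) = Complex.I * fderiv ℝ u z ξ := by
    intro ξ
    have := h ξ
    unfold dbar at this
    have h2 : fderiv ℝ u z ξ + Complex.I * fderiv ℝ u z (Complex.I • ξ) = 0 := by
      simpa using this
    linear_combination (-Complex.I) * h2 + fderiv ℝ u z (Complex.I • ξ) * Complex.I_mul_I
  refine ⟨⟨⟨⟨fderiv ℝ u z, by simp⟩, ?_⟩, (fderiv ℝ u z).cont⟩, ?_⟩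
  · intro a ξ
    change fderiv ℝ u z (a • ξ) = a * fderiv ℝ u z ξ
    rw [fderiv_csmul, hI]
    conv_rhs => rw [← Complex.re_add_im a]
    ring
  · ext ξ; rfl

lemma cd1_complex_of {u : V → ℂ} {Ω : Set V} (hΩ : IsOpen Ω) (hu : ContDiffOn ℝ 1 u Ω)
    (h : ∀ z ∈ Ω, ∀ ξ, dbar u z ξ = 0) : ContDiffOn ℂ 1 u Ω := by
  have hd : ∀ z ∈ Ω, DifferentiableAt ℂ u z := fun z hz =>
    clin_of_dbar_zero ((hu.contDiffAt (hΩ.mem_nhds hz)).differentiableAt (by norm_num)) (h z hz)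
  refine cd1_of_hasFDerivAt hΩ (fun z hz => (hd z hz).hasFDerivAt) ?_
  have hc := hu.continuousOn_fderiv_of_isOpen hΩ le_rfl
  have hiso := (ContinuousLinearMap.restrictScalarsIsometry ℂ V ℂ ℝ ℝ).isometry
  rw [hiso.isEmbedding.continuousOn_iff]
  refine hc.congr fun z hz => ?_
  exact ((hd z hz).fderiv_restrictScalars ℝ).symm

end dbarlemmas

open Set
open scoped ENNReal NNReal
noncomputable section
open MeasureTheory Filter Topology

def rectK (ϱ : ℝ) : Set (ℝ × ℝ) := Icc (0:ℝ) ϱ ×ˢ Icc (-Real.pi) Real.pi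

def pol (p : ℝ × ℝ) : ℂ := (p.1 : ℂ) * Complex.exp (Complex.I * p.2)

lemma continuous_pol : Continuous pol := by unfold pol; fun_prop

lemma isCompact_rectK (ϱ : ℝ) : IsCompact (rectK ϱ) := isCompact_Icc.prod isCompact_Icc

lemma norm_pol_le {ϱ : ℝ} {p : ℝ × ℝ} (hp : p ∈ rectK ϱ) : ‖pol p‖ ≤ ϱ := by
  obtain ⟨h1, h2⟩ := hp
  unfold pol
  rw [norm_mul, mul_comm Complex.I, Complex.norm_exp_ofReal_mul_I]
  simp [abs_of_nonneg h1.1, h1.2]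

lemma vol_rectK {ϱ : ℝ} (h : 0 ≤ ϱ) : (volume (rectK ϱ)).toReal = ϱ * (2 * Real.pi) := by
  unfold rectK
  rw [Measure.volume_eq_prod, Measure.prod_prod]
  simp [ENNReal.toReal_mul, h, Real.pi_pos.le]
  ring_nf
  simp

section
variable {V : Type*} [NormedAddCommGroup V] [NormedSpace ℂ V]

def TT (e : V) (ϱ : ℝ) (F : V → ℂ) (z : V) : ℂ :=
  (Real.pi : ℂ)⁻¹ * ∫ p in rectK ϱ, Complex.exp (-(Complex.I * p.2)) * F (z - pol p • e)

def InvE (e : V) (Ω : Set V) : Prop := ∀ z ∈ Ω, ∀ ζ : ℂ, z - ζ • e ∈ Ω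

lemma TT_norm_le {e : V} {ϱ : ℝ} (hϱ : 0 ≤ ϱ) {F : V → ℂ} {z : V} {B : ℝ}
    (h : ∀ ζ : ℂ, ‖ζ‖ ≤ ϱ → ‖F (z - ζ • e)‖ ≤ B) : ‖TT e ϱ F z‖ ≤ 2 * ϱ * B := by
  unfold TT
  have h1 : ‖∫ p in rectK ϱ, Complex.exp (-(Complex.I * p.2)) * F (z - pol p • e)‖
      ≤ B * (volume (rectK ϱ)).toReal := by
    refine norm_setIntegral_le_of_norm_le_const (isCompact_rectK ϱ).measure_lt_top ?_
    intro p hp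
    rw [norm_mul]
    have : ‖Complex.exp (-(Complex.I * p.2))‖ = 1 := by
      rw [Complex.norm_exp]; simp
    rw [this, one_mul]
    exact h _ (norm_pol_le hp)
  rw [vol_rectK hϱ] at h1
  rw [norm_mul, norm_inv]
  have hp := Real.pi_pos
  have : ‖(Real.pi : ℂ)‖ = Real.pi := by simp [hp.le]
  rw [this]
  calc Real.pi⁻¹ * _ ≤ Real.pi⁻¹ * (B * (ϱ * (2 * Real.pi))) := by gcongr
    _ = 2 * ϱ * B := by field_simp

lemma TT_congr {e : V} {ϱ : ℝ} {F G : V → ℂ} {z : V}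
    (h : ∀ ζ : ℂ, ‖ζ‖ ≤ ϱ → F (z - ζ • e) = G (z - ζ • e)) : TT e ϱ F z = TT e ϱ G z := by
  unfold TT
  congr 1
  refine setIntegral_congr_fun (isCompact_rectK ϱ).measurableSet fun p hp => ?_
  simp only [h _ (norm_pol_le hp)]

lemma TT_zero {e : V} {ϱ : ℝ} {z : V} : TT e ϱ (fun _ => 0) z = 0 := by simp [TT]

lemma TT_integrand_cont {e : V} {Ω : Set V} (hinv : InvE e Ω) {F : V → ℂ}
    (hF : ContinuousOn F Ω) {z : V} (hz : z ∈ Ω) :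
    Continuous (fun p : ℝ × ℝ => Complex.exp (-(Complex.I * p.2)) * F (z - pol p • e)) := by
  have h1 : Continuous (fun p : ℝ × ℝ => F (z - pol p • e)) := by
    rw [← continuousOn_univ]
    refine hF.comp ?_ (fun p _ => hinv z hz _)
    have := continuous_pol
    fun_prop
  exact Continuous.mul (by fun_prop) h1

lemma TT_integrable {e : V} {Ω : Set V} (hinv : InvE e Ω) {F : V → ℂ}
    (hF : ContinuousOn F Ω) {z : V} (hz : z ∈ Ω) (ϱ : ℝ) :
    IntegrableOn (fun p : ℝ × ℝ => Complex.exp (-(Complex.I * p.2)) * F (z - pol p • e)) (rectK ϱ) :=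
  (TT_integrand_cont hinv hF hz).continuousOn.integrableOn_compact (isCompact_rectK ϱ)

lemma TT_add {e : V} {Ω : Set V} (hinv : InvE e Ω) {F G : V → ℂ} {ϱ : ℝ}
    (hF : ContinuousOn F Ω) (hG : ContinuousOn G Ω) {z : V} (hz : z ∈ Ω) :
    TT e ϱ (fun w => F w + G w) z = TT e ϱ F z + TT e ϱ G z := by
  unfold TT
  rw [← mul_add, ← integral_add (TT_integrable hinv hF hz ϱ) (TT_integrable hinv hG hz ϱ)]
  simp only [mul_add]

lemma TT_const_mul {e : V} {F : V → ℂ} {ϱ : ℝ} (c : ℂ) {z : V} :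
    TT e ϱ (fun w => c * F w) z = c * TT e ϱ F z := by
  unfold TT
  rw [mul_left_comm]
  congr 1
  rw [← integral_const_mul]
  exact congrArg _ (funext fun p => by ring)

lemma TT_sub {e : V} {Ω : Set V} (hinv : InvE e Ω) {F G : V → ℂ} {ϱ : ℝ}
    (hF : ContinuousOn F Ω) (hG : ContinuousOn G Ω) {z : V} (hz : z ∈ Ω) :
    TT e ϱ (fun w => F w - G w) z = TT e ϱ F z - TT e ϱ G z := by
  have := TT_add (ϱ := ϱ) hinv hF (G := fun w => (-1) * G w) (by fun_prop) hz
  rw [TT_const_mul] at this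
  simp only [sub_eq_add_neg]
  simpa using this


lemma TT_hasFDerivAt [ProperSpace V] {e : V} {Ω : Set V} (hΩ : IsOpen Ω) (hinv : InvE e Ω) {F : V → ℂ} {ϱ : ℝ}
    (hF : ContDiffOn ℝ 1 F Ω) {z : V} (hz : z ∈ Ω) :
    HasFDerivAt (TT e ϱ F) ((Real.pi : ℂ)⁻¹ • ∫ p in rectK ϱ,
      Complex.exp (-(Complex.I * p.2)) • fderiv ℝ F (z - pol p • e)) z := by
  have hc := hF.continuousOn_fderiv_of_isOpen hΩ le_rfl
  have hpol := continuous_pol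
  refine HasFDerivAt.const_mul ?_ _
  refine hasFDerivAt_param hΩ (isCompact_rectK ϱ)
    (F := fun z p => Complex.exp (-(Complex.I * p.2)) * F (z - pol p • e))
    (F' := fun z p => Complex.exp (-(Complex.I * p.2)) • fderiv ℝ F (z - pol p • e)) ?_ ?_ ?_ z hz
  · intro z hz
    exact (TT_integrand_cont hinv hF.continuousOn hz).continuousOn
  · refine ContinuousOn.smul (f := fun q : V × (ℝ × ℝ) => Complex.exp (-(Complex.I * q.2.2)))
      (g := fun q : V × (ℝ × ℝ) => fderiv ℝ F (q.1 - pol q.2 • e)) (by fun_prop) ?_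
    exact hc.comp (f := fun q : V × (ℝ × ℝ) => q.1 - pol q.2 • e) (by fun_prop)
      (fun q hq => hinv _ hq.1 _)
  · intro z hz p hp
    refine HasFDerivAt.const_mul ?_ _
    have h1 : HasFDerivAt F (fderiv ℝ F (z - pol p • e)) (z - pol p • e) :=
      ((hF.contDiffAt (hΩ.mem_nhds (hinv z hz _))).differentiableAt (by norm_num)).hasFDerivAt
    exact h1.comp (f := fun w => w - pol p • e) z ((hasFDerivAt_id z).sub_const (pol p • e))

lemma TT_fderiv [ProperSpace V] {e : V} {Ω : Set V} (hΩ : IsOpen Ω) (hinv : InvE e Ω) {F : V → ℂ} {ϱ : ℝ}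
    (hF : ContDiffOn ℝ 1 F Ω) {z : V} (hz : z ∈ Ω) (ξ : V) :
    fderiv ℝ (TT e ϱ F) z ξ = TT e ϱ (fun w => fderiv ℝ F w ξ) z := by
  rw [(TT_hasFDerivAt hΩ hinv hF hz).fderiv]
  have hc := hF.continuousOn_fderiv_of_isOpen hΩ le_rfl
  have hpol := continuous_pol
  unfold TT
  rw [smul_apply, ContinuousLinearMap.integral_apply]
  · rfl
  · refine ContinuousOn.integrableOn_compact (isCompact_rectK ϱ) ?_
    refine ContinuousOn.smul (f := fun q : (ℝ × ℝ) => Complex.exp (-(Complex.I * q.2)))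
      (g := fun q : (ℝ × ℝ) => fderiv ℝ F (z - pol q • e)) (by fun_prop) ?_
    exact hc.comp (f := fun q : (ℝ × ℝ) => z - pol q • e) (by fun_prop)
      (fun q hq => hinv _ hz _)

lemma TT_contDiffOn [ProperSpace V] {e : V} {Ω : Set V} (hΩ : IsOpen Ω) (hinv : InvE e Ω) {F : V → ℂ} {ϱ : ℝ}
    (hF : ContDiffOn ℝ 1 F Ω) : ContDiffOn ℝ 1 (TT e ϱ F) Ω := by
  refine cd1_of_hasFDerivAt hΩ (fun z hz => TT_hasFDerivAt hΩ hinv hF hz) ?_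
  have hc := hF.continuousOn_fderiv_of_isOpen hΩ le_rfl
  have hpol := continuous_pol
  have h1 := cont_param (μ := volume) hΩ (isCompact_rectK ϱ)
    (F := fun z p => Complex.exp (-(Complex.I * p.2)) • fderiv ℝ F (z - pol p • e)) (by
      refine ContinuousOn.smul (f := fun q : V × (ℝ × ℝ) => Complex.exp (-(Complex.I * q.2.2)))
        (g := fun q : V × (ℝ × ℝ) => fderiv ℝ F (q.1 - pol q.2 • e)) (by fun_prop) ?_
      exact hc.comp (f := fun q : V × (ℝ × ℝ) => q.1 - pol q.2 • e) (by fun_prop)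
        (fun q hq => hinv _ hq.1 _))
  exact h1.const_smul (Real.pi : ℂ)⁻¹

lemma dbar_continuousOn {Ω : Set V} (hΩ : IsOpen Ω) {F : V → ℂ}
    (hF : ContDiffOn ℝ 1 F Ω) (ξ : V) : ContinuousOn (fun w => dbar F w ξ) Ω := by
  have hc := hF.continuousOn_fderiv_of_isOpen hΩ le_rfl
  unfold dbar
  fun_prop

lemma TT_dbar [ProperSpace V] {e : V} {Ω : Set V} (hΩ : IsOpen Ω) (hinv : InvE e Ω) {F : V → ℂ} {ϱ : ℝ}
    (hF : ContDiffOn ℝ 1 F Ω) {z : V} (hz : z ∈ Ω) (ξ : V) :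
    dbar (TT e ϱ F) z ξ = TT e ϱ (fun w => dbar F w ξ) z := by
  have hc := hF.continuousOn_fderiv_of_isOpen hΩ le_rfl
  have h1 : ∀ ξ, ContinuousOn (fun w => fderiv ℝ F w ξ) Ω := fun ξ => by fun_prop
  have : (fun w => dbar F w ξ) = fun w => (1/2 : ℂ) * fderiv ℝ F w ξ +
      (Complex.I / 2) * fderiv ℝ F w (Complex.I • ξ) := by
    funext w; unfold dbar; ring
  rw [this, TT_add hinv (by have := h1 ξ; fun_prop) (by have := h1 (Complex.I • ξ); fun_prop) hz,
    TT_const_mul, TT_const_mul]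
  unfold dbar
  rw [TT_fderiv hΩ hinv hF hz, TT_fderiv hΩ hinv hF hz]; ring

lemma pompeiu {e : V} {Ω : Set V} (hΩ : IsOpen Ω) (hinv : InvE e Ω) {F : V → ℂ} {ϱ : ℝ}
    (hϱ : 0 ≤ ϱ) (hF : ContDiffOn ℝ 1 F Ω) {z : V} (hz : z ∈ Ω)
    (h0 : ∀ ζ : ℂ, ‖ζ‖ = ϱ → F (z - ζ • e) = 0) :
    TT e ϱ (fun w => dbar F w e) z = F z := by
  have hc := hF.continuousOn_fderiv_of_isOpen hΩ le_rfl
  have hpol := continuous_pol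
  let E : ℝ → ℂ := fun θ => Complex.exp (Complex.I * θ)
  have hE : Continuous E := by fun_prop
  let a : ℝ × ℝ → ℂ := fun p => fderiv ℝ F (z - pol p • e) (E p.2 • e)
  let b : ℝ × ℝ → ℂ := fun p => fderiv ℝ F (z - pol p • e) ((Complex.I * E p.2) • e)
  have hcc : Continuous (fun p : ℝ × ℝ => fderiv ℝ F (z - pol p • e)) := by
    rw [← continuousOn_univ]
    exact hc.comp (by fun_prop) (fun q hq => hinv _ hz _)
  have ha : Continuous a := by fun_prop
  have hb : Continuous b := by fun_prop
  have hint : ∀ p : ℝ × ℝ, Complex.exp (-(Complex.I * p.2)) * dbar F (z - pol p • e) e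
      = (1/2 : ℂ) * a p + (Complex.I/2) * b p := by
    intro p
    have : Complex.exp (-(Complex.I * p.2)) = (starRingEnd ℂ) (E p.2) := by
      simp only [E]; rw [← Complex.exp_conj]; simp
    rw [this, ← dbar_smul]
    unfold dbar; simp only [a, b, mul_smul]; ring
  have hFd : ∀ ζ : ℂ, HasFDerivAt F (fderiv ℝ F (z - ζ • e)) (z - ζ • e) := fun ζ =>
    ((hF.contDiffAt (hΩ.mem_nhds (hinv z hz _))).differentiableAt (by norm_num)).hasFDerivAt
  have hA : ∀ θ : ℝ, ∫ r in Icc 0 ϱ, a (r, θ) = F z := by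
    intro θ
    rw [integral_Icc_eq_integral_Ioc, ← intervalIntegral.integral_of_le hϱ]
    have hder : ∀ r ∈ uIcc 0 ϱ, HasDerivAt (fun r : ℝ => - F (z - pol (r, θ) • e)) (a (r, θ)) r := by
      intro r _
      have h1 : HasDerivAt (fun r : ℝ => z - pol (r, θ) • e) (-(E θ • e)) r := by
        refine HasDerivAt.const_sub _ ?_
        refine HasDerivAt.smul_const ?_ _
        have := (Complex.ofRealCLM.hasDerivAt (x := r)).mul_const (E θ)
        simpa [pol, E] using this
      have h2 := ((hFd (pol (r, θ))).comp_hasDerivAt r h1).neg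
      refine HasDerivAt.congr_deriv (f := fun r : ℝ => - F (z - pol (r, θ) • e)) h2 ?_
      simp [a]
    rw [intervalIntegral.integral_eq_sub_of_hasDerivAt hder
      ((by fun_prop : Continuous fun r => a (r, θ)).intervalIntegrable _ _)]
    rw [h0 (pol (ϱ, θ))]
    · simp [pol]
    · unfold pol
      rw [norm_mul, mul_comm Complex.I, Complex.norm_exp_ofReal_mul_I]
      simp [abs_of_nonneg hϱ]
  have hB : ∀ r ∈ Ioc 0 ϱ, ∫ θ in Icc (-Real.pi) Real.pi, b (r, θ) = 0 := by
    intro r hr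
    have hpp : -Real.pi ≤ Real.pi := by linarith [Real.pi_pos]
    rw [integral_Icc_eq_integral_Ioc, ← intervalIntegral.integral_of_le hpp]
    have hder : ∀ θ ∈ uIcc (-Real.pi) Real.pi,
        HasDerivAt (fun θ : ℝ => - F (z - pol (r, θ) • e)) ((r : ℂ) * b (r, θ)) θ := by
      intro θ _
      have h1 : HasDerivAt (fun θ : ℝ => z - pol (r, θ) • e)
          (-((r * (Complex.I * E θ)) • e)) θ := by
        refine HasDerivAt.const_sub _ ?_
        refine HasDerivAt.smul_const ?_ _
        simp only [pol]
        refine HasDerivAt.const_mul _ ?_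
        have h3 := (Complex.ofRealCLM.hasDerivAt (x := θ)).const_mul (Complex.I)
        have := h3.cexp
        simpa [E, mul_comm] using this
      have h2 := ((hFd (pol (r, θ))).comp_hasDerivAt θ h1).neg
      refine HasDerivAt.congr_deriv (f := fun θ : ℝ => - F (z - pol (r, θ) • e)) h2 ?_
      simp only [b, mul_smul, map_neg, neg_neg]
      have : (r : ℂ) • Complex.I • E θ • e = r • (Complex.I • E θ • e) := by simp
      rw [this, map_smul]; simp
    have h4 := intervalIntegral.integral_eq_sub_of_hasDerivAt hder
      ((by fun_prop : Continuous fun θ => (r : ℂ) * b (r, θ)).intervalIntegrable _ _)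
    rw [intervalIntegral.integral_const_mul] at h4
    have h5 : pol (r, Real.pi) = pol (r, -Real.pi) := by
      simp only [pol]
      congr 1
      rw [mul_comm, Complex.exp_pi_mul_I, mul_comm]
      push_cast
      rw [neg_mul, Complex.exp_neg, Complex.exp_pi_mul_I]; norm_num
    rw [h5, sub_self] at h4
    have hr0 : (r : ℂ) ≠ 0 := by exact_mod_cast hr.1.ne'
    simpa [hr0] using h4
  unfold TT
  simp only [hint]
  have hK : ∀ g : ℝ × ℝ → ℂ, Continuous g → IntegrableOn g (rectK ϱ) := fun g hg =>
    hg.continuousOn.integrableOn_compact (isCompact_rectK ϱ)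
  have hpi : (Real.pi : ℂ) ≠ 0 := by exact_mod_cast Real.pi_pos.ne'
  rw [integral_add ((hK a ha).const_mul _) ((hK b hb).const_mul _), integral_const_mul,
    integral_const_mul]
  have hIa : ∫ p in rectK ϱ, a p = 2 * Real.pi * F z := by
    have h1 := hK a ha
    unfold rectK at h1 ⊢
    unfold IntegrableOn at h1
    rw [Measure.volume_eq_prod, ← Measure.prod_restrict] at h1 ⊢
    rw [integral_prod_symm _ h1]
    simp only [hA]
    simp
    left
    rw [max_eq_left (by linarith [Real.pi_pos])]; push_cast; ring
  have hIb : ∫ p in rectK ϱ, b p = 0 := by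
    have h1 := hK b hb
    unfold rectK at h1 ⊢
    unfold IntegrableOn at h1
    rw [Measure.volume_eq_prod, ← Measure.prod_restrict] at h1 ⊢
    rw [integral_prod _ h1, integral_Icc_eq_integral_Ioc]
    rw [setIntegral_congr_fun measurableSet_Ioc hB]; simp
  rw [hIa, hIb]
  field_simp
  ring
end

open Set
open scoped ENNReal NNReal
noncomputable section
open MeasureTheory Filter Topology

lemma exists_cutoff (a b : ℝ) (ha : 0 < a) (hab : a < b) : ∃ (χ : ℂ → ℂ) (C : ℝ), 1 ≤ C ∧
    ContDiff ℝ 2 χ ∧ (∀ ζ, ‖ζ‖ ≤ a → χ ζ = 1) ∧ (∀ ζ, b ≤ ‖ζ‖ → χ ζ = 0) ∧ (∀ ζ, ‖χ ζ‖ ≤ 1) ∧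
    (∀ ζ, ‖fderiv ℝ χ ζ‖ ≤ C) ∧ (∀ x y, ‖χ x - χ y‖ ≤ C * ‖x - y‖) := by
  let B : ContDiffBump (0 : ℂ) := ⟨a, b, ha, hab⟩
  let χ : ℂ → ℂ := fun ζ => ((B ζ : ℝ) : ℂ)
  have hχ : ContDiff ℝ 2 χ := Complex.ofRealCLM.contDiff.comp B.contDiff
  have hsupp : HasCompactSupport χ := B.hasCompactSupport.comp_left (g := fun x : ℝ => (x : ℂ)) (by simp)
  have hc : Continuous (fderiv ℝ χ) := hχ.continuous_fderiv (by norm_num)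
  obtain ⟨C, hC⟩ := hc.bounded_above_of_compact_support (hsupp.fderiv ℝ)
  have hd : ∀ ζ, ‖fderiv ℝ χ ζ‖ ≤ max C 1 := fun ζ => (hC ζ).trans (le_max_left _ _)
  refine ⟨χ, max C 1, le_max_right _ _, hχ, ?_, ?_, ?_, hd, ?_⟩
  · intro ζ hζ
    have : B ζ = 1 := B.one_of_mem_closedBall (by simpa using hζ)
    simp [χ, this]
  · intro ζ hζ
    have : B ζ = 0 := B.zero_of_le_dist (by simpa using hζ)
    simp [χ, this]
  · intro ζ
    simp only [χ, Complex.norm_real, Real.norm_eq_abs, abs_of_nonneg (B.nonneg)]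
    exact B.le_one
  · intro x y
    exact convex_univ.norm_image_sub_le_of_norm_fderiv_le (𝕜 := ℝ)
      (fun z _ => hχ.differentiable (by norm_num) z) (fun z _ => hd z) (mem_univ y) (mem_univ x)

lemma oneD_unit : ∃ C : ℝ, 1 ≤ C ∧ ∀ (u g : ℂ → ℂ) (S A L : ℝ), 0 ≤ S → 0 ≤ A → 0 ≤ L →
    ContDiffOn ℝ 1 u (Metric.ball 0 1) → ContDiffOn ℝ 1 g (Metric.ball 0 1) →
    (∀ ζ ∈ Metric.ball (0:ℂ) 1, dbar u ζ 1 = g ζ) →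
    (∀ ζ ∈ Metric.ball (0:ℂ) 1, ‖g ζ‖ ≤ A) → (∀ ζ ∈ Metric.ball (0:ℂ) 1, ‖u ζ‖ ≤ S) →
    (∀ x ∈ Metric.ball (0:ℂ) 1, ∀ y ∈ Metric.ball (0:ℂ) 1, ‖g x - g y‖ ≤ L * ‖x - y‖) →
    ∀ y : ℂ, ‖y‖ ≤ 1/4 → ‖u y - u 0‖ ≤ C * ‖y‖ * (S + A + L) := by
  obtain ⟨χ, C, hC1, hχ, hχ1, hχ0, hχn, -, hχL⟩ := exists_cutoff (1/2) (3/4) (by norm_num) (by norm_num)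
  refine ⟨4 * C + 20, by linarith, ?_⟩
  intro u g S A L hS hA hL hu hg hug hgA huS hgL y hy
  let G : ℂ → ℂ := fun ζ => χ ζ * g ζ
  have hχ' : ContDiff ℝ 1 χ := hχ.of_le (by norm_num)
  have hG0 : ∀ ζ : ℂ, 3/4 ≤ ‖ζ‖ → G ζ = 0 := fun ζ h => by simp [G, hχ0 ζ h]
  have hG : ContDiffOn ℝ 1 G univ := by
    intro ζ _
    apply ContDiffAt.contDiffWithinAt
    by_cases h : ‖ζ‖ < 1
    · exact hχ'.contDiffAt.mul (hg.contDiffAt (Metric.isOpen_ball.mem_nhds (by simpa using h)))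
    · have : G =ᶠ[𝓝 ζ] fun _ => 0 := by
        have ho : IsOpen {w : ℂ | 3/4 < ‖w‖} := isOpen_lt continuous_const continuous_norm
        filter_upwards [ho.mem_nhds (show (3/4 : ℝ) < ‖ζ‖ by linarith)] with w hw
        exact hG0 w (le_of_lt hw)
      exact contDiffAt_const.congr_of_eventuallyEq this
  have hGA : ∀ ζ, ‖G ζ‖ ≤ A := by
    intro ζ
    by_cases h : ‖ζ‖ < 1
    · simp only [G, norm_mul]
      have := hgA ζ (by simpa using h)
      nlinarith [hχn ζ, norm_nonneg (g ζ), norm_nonneg (χ ζ)]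
    · rw [hG0 ζ (by linarith)]; simpa using hA
  have hGL1 : ∀ x y : ℂ, ‖x‖ < 1 → ‖G x - G y‖ ≤ (L + C * A) * ‖x - y‖ := by
    intro x y hx
    have hgx := hgA x (by simpa using hx)
    by_cases h : ‖y‖ < 1
    · have e : G x - G y = χ y * (g x - g y) + (χ x - χ y) * g x := by simp only [G]; ring
      rw [e]
      refine (norm_add_le _ _).trans ?_
      rw [norm_mul, norm_mul]
      have h1 := hgL x (by simpa using hx) y (by simpa using h)
      have h2 := hχL x y
      have h3 : ‖χ y‖ * ‖g x - g y‖ ≤ 1 * (L * ‖x - y‖) :=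
        mul_le_mul (hχn y) h1 (norm_nonneg _) (by norm_num)
      have h4 : ‖χ x - χ y‖ * ‖g x‖ ≤ (C * ‖x - y‖) * A :=
        mul_le_mul h2 hgx (norm_nonneg _) (by positivity)
      linarith
    · have e : G x - G y = (χ x - χ y) * g x := by
        simp only [G]; rw [hχ0 y (by linarith)]; ring
      rw [e, norm_mul]
      have h4 : ‖χ x - χ y‖ * ‖g x‖ ≤ (C * ‖x - y‖) * A :=
        mul_le_mul (hχL x y) hgx (norm_nonneg _) (by positivity)
      have : 0 ≤ L * ‖x - y‖ := by positivity
      linarith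
  have hGL : ∀ x y : ℂ, ‖G x - G y‖ ≤ (L + C * A) * ‖x - y‖ := by
    intro x y
    by_cases hx : ‖x‖ < 1
    · exact hGL1 x y hx
    by_cases hy : ‖y‖ < 1
    · rw [norm_sub_rev, norm_sub_rev x y]; exact hGL1 y x hy
    rw [hG0 x (by linarith), hG0 y (by linarith)]
    simp; positivity
  let w := TT (1:ℂ) 2 G
  have hinv : InvE (1:ℂ) (univ : Set ℂ) := fun _ _ _ => mem_univ _
  have hw : ContDiffOn ℝ 1 w univ := TT_contDiffOn isOpen_univ hinv hG
  have hwd : ∀ ζ : ℂ, ‖ζ‖ < 1 → dbar w ζ 1 = G ζ := by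
    intro ζ hζ
    rw [TT_dbar isOpen_univ hinv hG (mem_univ _)]
    refine pompeiu isOpen_univ hinv (by norm_num) hG (mem_univ _) ?_
    intro η hη
    apply hG0
    have := norm_sub_norm_le η ζ
    rw [norm_sub_rev] at this
    simp; linarith
  have hwA : ∀ ζ, ‖w ζ‖ ≤ 4 * A := by
    intro ζ
    have := TT_norm_le (e := (1:ℂ)) (z := ζ) (by norm_num : (0:ℝ) ≤ 2) (fun η _ => hGA (ζ - η • 1))
    linarith
  have hwL : ‖w y - w 0‖ ≤ 4 * ((L + C * A) * ‖y‖) := by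
    have e : w y - w 0 = TT (1:ℂ) 2 (fun z => G (z + y) - G z) 0 := by
      rw [TT_sub hinv (F := fun z => G (z + y)) (G := G) (hG.continuousOn.comp (by fun_prop) (fun _ _ => mem_univ _)) hG.continuousOn (mem_univ _)]
      congr 1
      simp only [w, TT]
      congr 1
      exact congrArg _ (funext fun p => by ring_nf)
    rw [e]
    have := TT_norm_le (e := (1:ℂ)) (z := (0:ℂ)) (by norm_num : (0:ℝ) ≤ 2)
      (F := fun z => G (z + y) - G z) (B := (L + C * A) * ‖y‖) (fun η _ => by
        have := hGL (0 - η • 1 + y) (0 - η • 1)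
        simpa using this)
    linarith
  let h : ℂ → ℂ := fun ζ => u ζ - w ζ
  have hud : ∀ ζ : ℂ, ‖ζ‖ < 1 → DifferentiableAt ℝ u ζ := fun ζ hζ =>
    (hu.contDiffAt (Metric.isOpen_ball.mem_nhds (by simpa using hζ))).differentiableAt (by norm_num)
  have hwdd : ∀ ζ : ℂ, DifferentiableAt ℝ w ζ := fun ζ =>
    (hw.contDiffAt univ_mem).differentiableAt (by norm_num)
  have hhd : DifferentiableOn ℂ h (Metric.ball 0 (1/2)) := by
    intro ζ hζ
    have hζ' : ‖ζ‖ < 1/2 := by simpa using hζ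
    apply DifferentiableAt.differentiableWithinAt
    refine clin_of_dbar_zero ((hud ζ (by linarith)).sub (hwdd ζ)) ?_
    have h1 : dbar h ζ 1 = 0 := by
      simp only [h]
      rw [dbar_sub (hud ζ (by linarith)) (hwdd ζ), hug ζ (by simp; linarith), hwd ζ (by linarith)]
      simp only [G]; rw [hχ1 ζ (by linarith)]; ring
    intro ξ
    have := dbar_smul h ζ 1 ξ
    rw [h1] at this
    simpa using this
  have hhb : ∀ ζ : ℂ, ‖ζ‖ < 1 → ‖h ζ‖ ≤ S + 4 * A := fun ζ hζ =>
    (norm_sub_le _ _).trans (add_le_add (huS ζ (by simpa using hζ)) (hwA ζ))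
  have hfin : ‖h y - h 0‖ ≤ 4 * (S + 4 * A) * ‖y‖ := by
    have h1 := Complex.dist_le_div_mul_dist_of_mapsTo_ball (c := (0:ℂ)) (R₁ := 1/2)
      (R₂ := 2 * (S + 4 * A)) (f := h) (z := y) hhd ?_ (by simp; linarith)
    · rw [dist_eq_norm, dist_zero_right] at h1
      refine h1.trans (le_of_eq ?_)
      ring
    · intro ζ hζ
      have hζ' : ‖ζ‖ < 1/2 := by simpa using hζ
      rw [Metric.mem_closedBall, dist_eq_norm]
      have := norm_sub_le (h ζ) (h 0)
      have := hhb ζ (by linarith)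
      have := hhb 0 (by simp)
      linarith
  have e : u y - u 0 = (h y - h 0) + (w y - w 0) := by simp only [h]; ring
  rw [e]
  refine (norm_add_le _ _).trans ?_
  refine (add_le_add hfin hwL).trans ?_
  have hy0 := norm_nonneg y
  have : 4 * (S + 4 * A) * ‖y‖ + 4 * ((L + C * A) * ‖y‖) = (4 * S + (16 + 4 * C) * A + 4 * L) * ‖y‖ := by ring
  rw [this]
  have : (4 * C + 20) * ‖y‖ * (S + A + L) = ((4*C+20) * S + (4*C+20)*A + (4*C+20)*L) * ‖y‖ := by ring
  rw [this]
  refine mul_le_mul_of_nonneg_right ?_ hy0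
  nlinarith

lemma oneD : ∃ C : ℝ, 1 ≤ C ∧ ∀ (r : ℝ) (u g : ℂ → ℂ) (S A L : ℝ), 0 < r → 0 ≤ S → 0 ≤ A → 0 ≤ L →
    ContDiffOn ℝ 1 u (Metric.ball 0 r) → ContDiffOn ℝ 1 g (Metric.ball 0 r) →
    (∀ ζ : ℂ, ‖ζ‖ < r → dbar u ζ 1 = g ζ) →
    (∀ ζ : ℂ, ‖ζ‖ < r → ‖g ζ‖ ≤ A) → (∀ ζ : ℂ, ‖ζ‖ < r → ‖u ζ‖ ≤ S) →
    (∀ x y : ℂ, ‖x‖ < r → ‖y‖ < r → ‖g x - g y‖ ≤ L * ‖x - y‖) →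
    ∀ y : ℂ, ‖y‖ ≤ r/4 → ‖u y - u 0‖ ≤ C * ‖y‖ * (S / r + A + r * L) := by
  obtain ⟨C, hC1, H⟩ := oneD_unit
  refine ⟨C, hC1, ?_⟩
  intro r u g S A L hr hS hA hL hu hg hug hgA huS hgL y hy
  have hball : ∀ ζ : ℂ, ‖ζ‖ < 1 → ‖(r:ℂ) * ζ‖ < r := fun ζ hζ => by
    rw [norm_mul, Complex.norm_real, Real.norm_of_nonneg hr.le]; nlinarith
  have hm : MapsTo (fun ζ : ℂ => (r:ℂ) * ζ) (Metric.ball 0 1) (Metric.ball 0 r) := fun ζ hζ => by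
    have := hball ζ (by simpa using hζ)
    simpa using this
  have hcd : ContDiffOn ℝ 1 (fun ζ : ℂ => (r:ℂ) * ζ) (Metric.ball 0 1) := by fun_prop
  have hrn : ‖(r:ℂ)‖ = r := by rw [Complex.norm_real, Real.norm_of_nonneg hr.le]
  have h1 := H (fun ζ => u (r * ζ)) (fun ζ => r * g (r * ζ)) S (r * A) (r * (L * r)) hS (by positivity)
    (by positivity) (hu.comp hcd hm) (contDiffOn_const.mul (hg.comp hcd hm)) ?_ ?_ ?_ ?_ (y / r) ?_
  · have e : (r:ℂ) * (y / r) = y := by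
      have : (r:ℂ) ≠ 0 := by exact_mod_cast hr.ne'
      field_simp
    simp only [e, mul_zero] at h1
    refine h1.trans (le_of_eq ?_)
    rw [norm_div, hrn]; field_simp
  · intro ζ hζ
    have hζ' : ‖(r:ℂ) * ζ‖ < r := hball ζ (by simpa using hζ)
    have hd : DifferentiableAt ℝ u (r * ζ) :=
      (hu.contDiffAt (Metric.isOpen_ball.mem_nhds (by simpa using hζ'))).differentiableAt (by norm_num)
    have hL : HasFDerivAt (fun ζ : ℂ => (r:ℂ) * ζ) (((r:ℂ) • ContinuousLinearMap.id ℂ ℂ).restrictScalars ℝ) ζ := by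
      apply HasFDerivAt.restrictScalars
      exact (hasFDerivAt_id ζ).const_mul (r:ℂ)
    rw [dbar_comp hd hL]
    have := dbar_smul u (r * ζ) 1 (r:ℂ)
    rw [hug _ hζ'] at this
    simpa using this
  · intro ζ hζ
    rw [norm_mul, hrn]
    exact mul_le_mul_of_nonneg_left (hgA _ (hball ζ (by simpa using hζ))) hr.le
  · intro ζ hζ
    exact huS _ (hball ζ (by simpa using hζ))
  · intro x hx y hy
    rw [← mul_sub, norm_mul, hrn, mul_assoc r, mul_assoc L]
    refine mul_le_mul_of_nonneg_left ?_ hr.le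
    have := hgL _ _ (hball x (by simpa using hx)) (hball y (by simpa using hy))
    rwa [← mul_sub, norm_mul, hrn] at this
  · rw [norm_div, hrn, div_le_iff₀ hr]; linarith

open Set
open scoped ENNReal NNReal
noncomputable section
set_option linter.unusedSectionVars false
set_option linter.unusedSimpArgs false
open MeasureTheory Filter Topology

section
variable {ι : Type*} [Fintype ι] [DecidableEq ι]

def PD (s : ι → ℝ) : Set (ι → ℂ) := {z | ∀ j, ‖z j‖ < s j}

def PW (s : ι → ℝ) (k : ι) : Set (ι → ℂ) := {z | ∀ j, j ≠ k → ‖z j‖ < s j}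

abbrev ee (j : ι) : ι → ℂ := Pi.single j 1

lemma isOpen_PD (s : ι → ℝ) : IsOpen (PD s) := by
  unfold PD
  simp only [ofPred_forall]
  exact isOpen_iInter_of_finite fun j => isOpen_lt (by fun_prop) continuous_const

lemma isOpen_PW (s : ι → ℝ) (k : ι) : IsOpen (PW s k) := by
  unfold PW
  simp only [ofPred_forall]
  exact isOpen_iInter_of_finite fun j => isOpen_iInter_of_finite fun _ =>
    isOpen_lt (by fun_prop) continuous_const

lemma invE_PW (s : ι → ℝ) (k : ι) : InvE (ee k) (PW s k) := by
  intro z hz ζ j hj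
  simpa [ee, Pi.single_apply, hj] using hz j hj

lemma PD_of_PW {s : ι → ℝ} {k : ι} {z : ι → ℂ} (h : z ∈ PW s k) (hk : ‖z k‖ < s k) : z ∈ PD s := by
  intro j
  by_cases hj : j = k
  · rw [hj]; exact hk
  · exact h j hj

def LK (k : ι) (t : ℝ) : (ι → ℂ) →L[ℂ] ℂ := ((t : ℂ)⁻¹) • ContinuousLinearMap.proj k

lemma LK_apply (k : ι) (t : ℝ) (z : ι → ℂ) : LK k t z = (t : ℂ)⁻¹ * z k := by
  simp [LK]

lemma norm_LK (k : ι) {t : ℝ} (ht : 0 < t) (z : ι → ℂ) : ‖LK k t z‖ = ‖z k‖ / t := by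
  rw [LK_apply, norm_mul, norm_inv, Complex.norm_real, Real.norm_of_nonneg ht.le]; ring

lemma LK_hasFDerivAt (k : ι) (t : ℝ) (z : ι → ℂ) :
    HasFDerivAt (fun w => LK k t w) ((LK k t).restrictScalars ℝ) z :=
  (LK k t).hasFDerivAt.restrictScalars ℝ

lemma LK_contDiff (k : ι) (t : ℝ) {n} : ContDiff ℝ n (fun w => LK k t w) :=
  ((LK k t).restrictScalars ℝ).contDiff

lemma dbar_LK {φ : ℂ → ℂ} (hφ : ContDiff ℝ 1 φ) (k : ι) (t : ℝ) (z ξ : ι → ℂ) :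
    dbar (fun w => φ (LK k t w)) z ξ = (starRingEnd ℂ) (LK k t ξ) * dbar φ (LK k t z) 1 := by
  rw [dbar_comp (hφ.differentiable (by norm_num) _) (LK_hasFDerivAt k t z), ← dbar_smul]
  simp

lemma dbar_LK_ne {φ : ℂ → ℂ} (hφ : ContDiff ℝ 1 φ) {k j : ι} (hj : j ≠ k) (t : ℝ) (z : ι → ℂ) :
    dbar (fun w => φ (LK k t w)) z (ee j) = 0 := by
  rw [dbar_LK hφ, LK_apply]; simp [ee, Pi.single_apply, hj.symm]

section ext
variable {s : ι → ℝ} {k : ι} (hs : 0 < s k) {φ : ℂ → ℂ} (hφ : ContDiff ℝ 1 φ) {b : ℝ} (hb : b < 1)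
  (hφ0 : ∀ ζ, b ≤ ‖ζ‖ → φ ζ = 0)
include hs hb hφ0

lemma ext_zero (f : (ι → ℂ) → ℂ) {z : ι → ℂ} (hz : s k ≤ ‖z k‖) :
    (fun w => φ (LK k (s k) w) * f w) =ᶠ[𝓝 z] fun _ => 0 := by
  have ho : IsOpen {w : ι → ℂ | b < ‖LK k (s k) w‖} :=
    isOpen_lt continuous_const (LK k (s k)).continuous.norm
  have : z ∈ {w : ι → ℂ | b < ‖LK k (s k) w‖} := by
    simp only [mem_ofPred_eq, norm_LK k hs]
    exact lt_of_lt_of_le hb ((one_le_div hs).2 hz)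
  filter_upwards [ho.mem_nhds this] with w hw
  rw [hφ0 _ (le_of_lt hw), zero_mul]

include hφ
lemma ext_contDiff {f : (ι → ℂ) → ℂ} (hf : ContDiffOn ℝ 1 f (PD s)) :
    ContDiffOn ℝ 1 (fun w => φ (LK k (s k) w) * f w) (PW s k) := by
  intro z hz
  apply ContDiffAt.contDiffWithinAt
  by_cases h : ‖z k‖ < s k
  · have h1 := hf.contDiffAt ((isOpen_PD s).mem_nhds (PD_of_PW hz h))
    exact (hφ.comp (LK_contDiff k (s k))).contDiffAt.mul h1
  · exact contDiffAt_const.congr_of_eventuallyEq (ext_zero hs hb hφ0 f (not_lt.1 h))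

lemma ext_dbar {f : (ι → ℂ) → ℂ} (hf : ContDiffOn ℝ 1 f (PD s)) {z : ι → ℂ} (hz : z ∈ PD s)
    (ξ : ι → ℂ) :
    dbar (fun w => φ (LK k (s k) w) * f w) z ξ =
      dbar (fun w => φ (LK k (s k) w)) z ξ * f z + φ (LK k (s k) z) * dbar f z ξ := by
  have h1 := (hf.contDiffAt ((isOpen_PD s).mem_nhds hz)).differentiableAt (by norm_num)
  have h2 : DifferentiableAt ℝ (fun w => φ (LK k (s k) w)) z :=
    (hφ.comp (LK_contDiff k (s k))).contDiffAt.differentiableAt (by norm_num)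
  exact dbar_mul h2 h1 ξ

lemma ext_dbar_zero (f : (ι → ℂ) → ℂ) {z : ι → ℂ} (hz : s k ≤ ‖z k‖)
    (ξ : ι → ℂ) :
    dbar (fun w => φ (LK k (s k) w) * f w) z ξ = 0 := by
  rw [dbar_congr (ext_zero hs hb hφ0 f hz), dbar_const]

lemma ext_pompeiu {f : (ι → ℂ) → ℂ} (hf : ContDiffOn ℝ 1 f (PD s)) {z : ι → ℂ} (hz : z ∈ PD s) :
    TT (ee k) (2 * s k) (fun w => dbar (fun w => φ (LK k (s k) w) * f w) w (ee k)) z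
      = φ (LK k (s k) z) * f z := by
  refine pompeiu (isOpen_PW s k) (invE_PW s k) (by positivity)
    (ext_contDiff hs hφ hb hφ0 hf) (fun j _ => hz j) ?_
  intro ζ hζ
  refine (ext_zero hs hb hφ0 f ?_).self_of_nhds
  have := norm_sub_norm_le ζ (z k)
  rw [norm_sub_rev] at this
  have := hz k
  simp; linarith

end ext

structure FormOn (s : ι → ℝ) (M : ℝ) (f : ι → (ι → ℂ) → ℂ) : Prop where
  cd : ∀ j, ContDiffOn ℝ 1 (f j) (PD s)
  closed : ∀ z ∈ PD s, ∀ i j, dbar (f i) z (ee j) = dbar (f j) z (ee i)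
  bd : ∀ z ∈ PD s, ∀ j, ‖f j z‖ ≤ M

lemma one_step (lam : ℝ) (hlam : 1 < lam) : ∃ C : ℝ, 1 ≤ C ∧ ∀ {ι : Type} [Fintype ι] [DecidableEq ι]
    (s : ι → ℝ) (k : ι) (M : ℝ) (f : ι → (ι → ℂ) → ℂ), 0 < s k → s k ≤ 1 → 0 ≤ M → FormOn s M f →
    ∃ (u : (ι → ℂ) → ℂ) (f' : ι → (ι → ℂ) → ℂ),
      ContDiffOn ℝ 1 u (PD (Function.update s k (s k / lam))) ∧
      FormOn (Function.update s k (s k / lam)) (C * M) f' ∧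
      (∀ z ∈ PD (Function.update s k (s k / lam)), ∀ j, dbar u z (ee j) = f j z - f' j z) ∧
      (∀ z ∈ PD (Function.update s k (s k / lam)), ‖u z‖ ≤ C * M) ∧
      (∀ z ∈ PD (Function.update s k (s k / lam)), f' k z = 0) ∧
      (∀ j, (∀ z ∈ PD s, f j z = 0) → ∀ z ∈ PD (Function.update s k (s k / lam)), f' j z = 0) := by
  have hl0 : 0 < lam := by linarith
  have hl1 : 1 / lam < 1 := (div_lt_one hl0).2 hlam
  obtain ⟨χ, C, hC1, hχ, hχ1, hχ0, hχn, hχd, -⟩ :=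
    exists_cutoff (1/lam) ((1+1/lam)/2) (by positivity) (by linarith)
  refine ⟨4 * C, by linarith, ?_⟩
  intro ι _ _ s k M f hs hs1 hM hf
  let ψ : ℂ → ℂ := fun ζ => dbar χ ζ 1
  have hχc : ContDiff ℝ 1 χ := hχ.of_le (by norm_num)
  have hψc : ContDiff ℝ 1 ψ := by
    have := hχ.fderiv_right (m := 1) (by norm_num)
    simp only [ψ, dbar]
    fun_prop
  have hψn : ∀ ζ, ‖ψ ζ‖ ≤ C := by
    intro ζ
    simp only [ψ, dbar]
    have h1 := (fderiv ℝ χ ζ).le_opNorm 1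
    have h2 := (fderiv ℝ χ ζ).le_opNorm Complex.I
    have h3 := hχd ζ
    rw [norm_div]
    have h4 := norm_add_le (fderiv ℝ χ ζ 1) (Complex.I * fderiv ℝ χ ζ (Complex.I • 1))
    simp at h1 h2 h4 ⊢
    linarith
  let b := (1 + (1+1/lam)/2)/2
  have hb : b < 1 := by simp only [b]; linarith
  have hχb : ∀ ζ, b ≤ ‖ζ‖ → χ ζ = 0 := fun ζ h => hχ0 ζ (by simp only [b] at h; linarith)
  have hψb : ∀ ζ, b ≤ ‖ζ‖ → ψ ζ = 0 := fun ζ h => by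
    have ho : IsOpen {w : ℂ | (1+1/lam)/2 < ‖w‖} := isOpen_lt continuous_const continuous_norm
    have : χ =ᶠ[𝓝 ζ] fun _ => 0 := by
      filter_upwards [ho.mem_nhds (show (1+1/lam)/2 < ‖ζ‖ by simp only [b] at h; linarith)] with w hw
      exact hχ0 w (le_of_lt hw)
    simp only [ψ]; rw [dbar_congr this, dbar_const]
  have hψa : ∀ ζ, ‖ζ‖ < 1/lam → ψ ζ = 0 := fun ζ h => by
    have ho : IsOpen {w : ℂ | ‖w‖ < 1/lam} := isOpen_lt continuous_norm continuous_const
    have : χ =ᶠ[𝓝 ζ] fun _ => 1 := by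
      filter_upwards [ho.mem_nhds h] with w hw
      exact hχ1 w (le_of_lt hw)
    simp only [ψ]; rw [dbar_congr this, dbar_const]
  set s' := Function.update s k (s k / lam) with hs'
  have hsub : PD s' ⊆ PD s := by
    intro z hz j
    have := hz j
    by_cases hj : j = k
    · subst hj
      simp only [hs', Function.update_self] at this
      exact this.trans (div_lt_self hs hlam)
    · simpa [hs', hj] using this
  have hsW : PD s ⊆ PW s k := fun z hz j _ => hz j
  have hLs : ∀ z ∈ PD s', ‖LK k (s k) z‖ < 1 / lam := by
    intro z hz
    have := hz k
    simp only [hs', Function.update_self] at this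
    rw [norm_LK k hs, div_lt_div_iff₀ hs hl0]
    rw [lt_div_iff₀ hl0] at this; linarith
  let G : ι → (ι → ℂ) → ℂ := fun j w => χ (LK k (s k) w) * f j w
  let c : ℂ := (starRingEnd ℂ) (LK k (s k) (ee k))
  have hc : ‖c‖ = 1 / s k := by
    simp only [c, RCLike.norm_conj, norm_LK k hs]; simp [ee]
  let H : ι → (ι → ℂ) → ℂ := fun j w => ψ (LK k (s k) w) * (c * f j w)
  have hcf : ∀ j, ContDiffOn ℝ 1 (fun w => c * f j w) (PD s) := fun j => contDiffOn_const.mul (hf.cd j)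
  have hGc : ∀ j, ContDiffOn ℝ 1 (G j) (PW s k) := fun j => ext_contDiff hs hχc hb hχb (hf.cd j)
  have hHc : ∀ j, ContDiffOn ℝ 1 (H j) (PW s k) := fun j => ext_contDiff hs hψc hb hψb (hcf j)
  have hWo := isOpen_PW s k
  have hWi := invE_PW s k
  have hsub' : PD s' ⊆ PW s k := hsub.trans hsW
  have hfd : ∀ j, ∀ z ∈ PD s, DifferentiableAt ℝ (f j) z := fun j z hz =>
    ((hf.cd j).contDiffAt ((isOpen_PD s).mem_nhds hz)).differentiableAt (by norm_num)
  -- key identity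
  have key : ∀ j, j ≠ k → ∀ w ∈ PW s k, dbar (G k) w (ee j) = dbar (G j) w (ee k) - H j w := by
    intro j hj w hw
    by_cases h : ‖w k‖ < s k
    · have hw' := PD_of_PW hw h
      simp only [G, H]
      rw [ext_dbar hs hχc hb hχb (hf.cd k) hw', ext_dbar hs hχc hb hχb (hf.cd j) hw',
        dbar_LK_ne hχc hj, dbar_LK hχc, hf.closed w hw' k j]
      simp only [c, ψ]; ring
    · have h' := not_lt.1 h
      simp only [G, H]
      rw [ext_dbar_zero hs hχc hb hχb _ h', ext_dbar_zero hs hχc hb hχb _ h',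
        hψb _ (by rw [norm_LK k hs]; exact hb.le.trans ((one_le_div hs).2 h'))]
      ring
  have hGd : ∀ j, ∀ z ∈ PD s, TT (ee k) (2 * s k) (fun w => dbar (G j) w (ee k)) z = G j z :=
    fun j z hz => ext_pompeiu hs hχc hb hχb (hf.cd j) hz
  have hHd : ∀ j, ∀ z ∈ PD s, TT (ee k) (2 * s k) (fun w => dbar (H j) w (ee k)) z = H j z :=
    fun j z hz => ext_pompeiu hs hψc hb hψb (hcf j) hz
  have hG1 : ∀ j, ∀ z ∈ PD s', G j z = f j z := fun j z hz => by
    simp only [G]; rw [hχ1 _ (hLs z hz).le, one_mul]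
  have hH0 : ∀ j, ∀ z ∈ PD s', H j z = 0 := fun j z hz => by
    simp only [H]; rw [hψa _ (hLs z hz), zero_mul]
  have hHsymm : ∀ i j, i ≠ k → j ≠ k → ∀ w ∈ PW s k, dbar (H i) w (ee j) = dbar (H j) w (ee i) := by
    intro i j hi hj w hw
    by_cases h : ‖w k‖ < s k
    · have hw' := PD_of_PW hw h
      simp only [H]
      rw [ext_dbar hs hψc hb hψb (hcf i) hw', ext_dbar hs hψc hb hψb (hcf j) hw',
        dbar_LK_ne hψc hj, dbar_LK_ne hψc hi, dbar_const_mul _ (hfd i w hw'),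
        dbar_const_mul _ (hfd j w hw'), hf.closed w hw' i j]
      simp
    · have h' := not_lt.1 h
      simp only [H]
      rw [ext_dbar_zero hs hψc hb hψb _ h', ext_dbar_zero hs hψc hb hψb _ h']
  have hbdG : ∀ j, ∀ w ∈ PW s k, ‖G j w‖ ≤ M := by
    intro j w hw
    by_cases h : ‖w k‖ < s k
    · have := hf.bd w (PD_of_PW hw h) j
      simp only [G, norm_mul]
      nlinarith [hχn (LK k (s k) w), norm_nonneg (χ (LK k (s k) w)), norm_nonneg (f j w)]
    · rw [show G j w = 0 from (ext_zero hs hb hχb (f j) (not_lt.1 h)).self_of_nhds]; simpa using hM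
  have hbdH : ∀ j, ∀ w ∈ PW s k, ‖H j w‖ ≤ C / s k * M := by
    intro j w hw
    by_cases h : ‖w k‖ < s k
    · have h1 := hf.bd w (PD_of_PW hw h) j
      simp only [H, norm_mul, hc]
      calc _ ≤ C * (1 / s k * M) := by
            refine mul_le_mul (hψn _) ?_ (by positivity) (by linarith)
            exact mul_le_mul_of_nonneg_left h1 (by positivity)
        _ = _ := by ring
    · rw [show H j w = 0 from (ext_zero hs hb hψb (fun w => c * f j w) (not_lt.1 h)).self_of_nhds]
      simp; positivity
  let f' : ι → (ι → ℂ) → ℂ := fun j => if j = k then fun _ => 0 else TT (ee k) (2 * s k) (H j)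
  have hf'k : f' k = fun _ => 0 := by simp [f']
  have hf'j : ∀ j, j ≠ k → f' j = TT (ee k) (2 * s k) (H j) := fun j hj => by simp [f', hj]
  have hk0 : ∀ j, j ≠ k → ∀ z ∈ PD s', dbar (f' j) z (ee k) = 0 := by
    intro j hj z hz
    rw [hf'j j hj, TT_dbar hWo hWi (hHc j) (hsub' hz), hHd j z (hsub hz), hH0 j z hz]
  refine ⟨TT (ee k) (2 * s k) (G k), f', ?_, ⟨?_, ?_, ?_⟩, ?_, ?_, ?_, ?_⟩
  · exact (TT_contDiffOn hWo hWi (hGc k)).mono hsub'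
  · intro j
    by_cases hj : j = k
    · rw [hj, hf'k]; exact contDiffOn_const
    · rw [hf'j j hj]; exact (TT_contDiffOn hWo hWi (hHc j)).mono hsub'
  · intro z hz i j
    by_cases hi : i = k
    · by_cases hj : j = k
      · rw [hi, hj]
      · rw [hi, hk0 j hj z hz, hf'k, dbar_const]
    · by_cases hj : j = k
      · rw [hj, hk0 i hi z hz, hf'k, dbar_const]
      · rw [hf'j i hi, hf'j j hj, TT_dbar hWo hWi (hHc i) (hsub' hz),
          TT_dbar hWo hWi (hHc j) (hsub' hz)]
        exact TT_congr fun ζ _ => hHsymm i j hi hj _ (hWi z (hsub' hz) ζ)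
  · intro z hz j
    by_cases hj : j = k
    · rw [hj, hf'k]; simp; positivity
    · rw [hf'j j hj]
      have := TT_norm_le (e := ee k) (z := z) (F := H j) (by positivity : 0 ≤ 2 * s k)
        (fun ζ _ => hbdH j _ (hWi z (hsub' hz) ζ))
      refine this.trans (le_of_eq ?_)
      field_simp
      ring
  · intro z hz j
    rw [TT_dbar hWo hWi (hGc k) (hsub' hz)]
    by_cases hj : j = k
    · rw [hj, hGd k z (hsub hz), hG1 k z hz, hf'k]; simp
    · rw [hf'j j hj, TT_congr (G := fun w => dbar (G j) w (ee k) - H j w)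
        (fun ζ _ => key j hj _ (hWi z (hsub' hz) ζ)),
        TT_sub hWi (dbar_continuousOn hWo (hGc j) _) (hHc j).continuousOn (hsub' hz),
        hGd j z (hsub hz), hG1 j z hz]
  · intro z hz
    have := TT_norm_le (e := ee k) (z := z) (F := G k) (by positivity : 0 ≤ 2 * s k)
        (fun ζ _ => hbdG k _ (hWi z (hsub' hz) ζ))
    refine this.trans ?_
    have : 2 * (2 * s k) ≤ 4 * C := by nlinarith
    exact mul_le_mul_of_nonneg_right this hM
  · intro z hz; rw [hf'k]
  · intro j hj0 z hz
    by_cases hj : j = k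
    · rw [hj, hf'k]
    · rw [hf'j j hj]
      rw [TT_congr (G := fun _ => 0), TT_zero]
      intro ζ _
      have hw := hWi z (hsub' hz) ζ
      by_cases h : ‖(z - ζ • ee k) k‖ < s k
      · simp only [H]; rw [hj0 _ (PD_of_PW hw h)]; simp
      · exact (ext_zero hs hb hψb (fun w => c * f j w) (not_lt.1 h)).self_of_nhds

lemma polydisc_solve (lam : ℝ) (hlam : 1 < lam) : ∃ C : ℝ, 1 ≤ C ∧
    ∀ {ι : Type} [Fintype ι] [DecidableEq ι]
    (s : ι → ℝ), (∀ j, 0 < s j) → (∀ j, s j ≤ 1) → ∀ (K : Finset ι) (M : ℝ) (f : ι → (ι → ℂ) → ℂ),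
    0 ≤ M → FormOn (fun j => if j ∈ K then s j else s j / lam) M f →
    (∀ j, j ∉ K → ∀ z ∈ PD (fun j => if j ∈ K then s j else s j / lam), f j z = 0) →
    ∃ u : (ι → ℂ) → ℂ, ContDiffOn ℝ 1 u (PD fun j => s j / lam) ∧
      (∀ z ∈ PD fun j => s j / lam, ∀ j, dbar u z (ee j) = f j z) ∧
      (∀ z ∈ PD fun j => s j / lam, ‖u z‖ ≤ C ^ K.card * M) := by
  obtain ⟨C, hC1, H⟩ := one_step lam hlam
  refine ⟨2 * C, by linarith, ?_⟩
  intro ι _ _ s hs0 hs1 K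
  induction K using Finset.induction_on with
  | empty =>
    intro M f hM hf h0
    refine ⟨fun _ => 0, contDiffOn_const, ?_, ?_⟩
    · intro z hz j
      rw [dbar_const, h0 j (by simp) z (by simpa using hz)]
    · intro z hz; simpa using hM
  | insert k K hk ih =>
    intro M f hM hf h0
    set t : ι → ℝ := fun j => if j ∈ insert k K then s j else s j / lam with ht
    have htk : t k = s k := by simp [ht]
    have ht' : Function.update t k (t k / lam) = fun j => if j ∈ K then s j else s j / lam := by
      funext j
      by_cases hj : j = k
      · subst hj; simp [hk, htk]
      · simp [hj, ht]
    obtain ⟨u1, f', hu1, hf', hd1, hn1, hk0, hj0⟩ := H t k M f (by rw [htk]; exact hs0 k)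
      (by rw [htk]; exact hs1 k) hM hf
    rw [ht'] at hu1 hf' hd1 hn1 hk0 hj0
    obtain ⟨u2, hu2, hd2, hn2⟩ := ih (C * M) f' (by positivity) hf' (by
      intro j hj z hz
      by_cases hjk : j = k
      · rw [hjk]; exact hk0 z hz
      · exact hj0 j (h0 j (by simp [hjk, hj])) z hz)
    have hsub : PD (fun j => s j / lam) ⊆ PD (fun j => if j ∈ K then s j else s j / lam) := by
      intro z hz j
      have h1 := hz j
      have h2 : s j / lam < s j := div_lt_self (hs0 j) hlam
      simp only at h1 ⊢
      split_ifs <;> linarith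
    refine ⟨fun z => u1 z + u2 z, (hu1.mono hsub).add hu2, ?_, ?_⟩
    · intro z hz j
      rw [dbar_add ((hu1.contDiffAt ((isOpen_PD _).mem_nhds (hsub hz))).differentiableAt (by norm_num))
        ((hu2.contDiffAt ((isOpen_PD _).mem_nhds hz)).differentiableAt (by norm_num)),
        hd1 z (hsub hz), hd2 z hz]
      ring
    · intro z hz
      refine (norm_add_le _ _).trans ((add_le_add (hn1 z (hsub hz)) (hn2 z hz)).trans ?_)
      rw [Finset.card_insert_of_notMem hk, pow_succ]
      have : 1 ≤ (2 * C) ^ K.card := one_le_pow₀ (by linarith)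
      have h3 : C * M ≤ (2 * C) ^ K.card * (C * M) := le_mul_of_one_le_left (by positivity) this
      nlinarith
end

open Set
open scoped ENNReal NNReal
noncomputable section
set_option linter.unusedSectionVars false
set_option linter.unusedSimpArgs false
open MeasureTheory Filter Topology

/-- monomials -/
def mon {n : ℕ} (k : Fin n → ℕ) (z : Fin n → ℂ) : ℂ := ∏ j, z j ^ k j

def monR {n : ℕ} (k : Fin n → ℕ) (z : Fin n → ℝ) : ℝ := ∏ j, z j ^ k j

lemma mon_cons {n : ℕ} (m : ℕ) (k : Fin n → ℕ) (w : ℂ) (z : Fin n → ℂ) :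
    mon (Fin.cons m k : Fin (n+1) → ℕ) (Fin.cons w z : Fin (n+1) → ℂ) = w ^ m * mon k z := by
  simp [mon, Fin.prod_univ_succ]

lemma monR_cons {n : ℕ} (m : ℕ) (k : Fin n → ℕ) (w : ℝ) (z : Fin n → ℝ) :
    monR (Fin.cons m k : Fin (n+1) → ℕ) (Fin.cons w z : Fin (n+1) → ℝ) = w ^ m * monR k z := by
  simp [monR, Fin.prod_univ_succ]

lemma norm_mon {n : ℕ} (k : Fin n → ℕ) (z : Fin n → ℂ) : ‖mon k z‖ = monR k (fun j => ‖z j‖) := by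
  simp [mon, monR]

lemma monR_nonneg {n : ℕ} (k : Fin n → ℕ) {z : Fin n → ℝ} (h : ∀ j, 0 ≤ z j) : 0 ≤ monR k z :=
  Finset.prod_nonneg fun j _ => pow_nonneg (h j) _

lemma monR_pos {n : ℕ} (k : Fin n → ℕ) {z : Fin n → ℝ} (h : ∀ j, 0 < z j) : 0 < monR k z :=
  Finset.prod_pos fun j _ => pow_pos (h j) _

lemma monR_mono {n : ℕ} (k : Fin n → ℕ) {z w : Fin n → ℝ} (h : ∀ j, 0 ≤ z j) (h2 : ∀ j, z j ≤ w j) :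
    monR k z ≤ monR k w :=
  Finset.prod_le_prod (fun j _ => pow_nonneg (h j) _) fun j _ => pow_le_pow_left₀ (h j) (h2 j) _

lemma monR_div {n : ℕ} (k : Fin n → ℕ) (z w : Fin n → ℝ) :
    monR k (fun j => z j / w j) = monR k z / monR k w := by
  simp [monR, div_pow, Finset.prod_div_distrib]

lemma hasSum_cons {n : ℕ} {G : Type*} [AddCommMonoid G] [TopologicalSpace G]
    {f : (Fin (n+1) → ℕ) → G} {a : G} :
    HasSum f a ↔ HasSum (fun p : ℕ × (Fin n → ℕ) => f (Fin.cons p.1 p.2)) a := by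
  rw [← (Fin.consEquiv (fun _ => ℕ)).hasSum_iff]; rfl

lemma hasSum_geom {n : ℕ} (t : Fin n → ℝ) (h0 : ∀ j, 0 ≤ t j) (h1 : ∀ j, t j < 1) :
    HasSum (fun k => monR k t) (∏ j, (1 - t j)⁻¹) := by
  induction n with
  | zero =>
    have := hasSum_unique (fun k : Fin 0 → ℕ => monR k t)
    simpa [monR] using this
  | succ n ih =>
    obtain ⟨a, t', rfl⟩ : ∃ a t', t = Fin.cons a t' := ⟨t 0, Fin.tail t, (Fin.cons_self_tail t).symm⟩
    rw [hasSum_cons]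
    have i1 := ih t' (fun j => by simpa using h0 j.succ) (fun j => by simpa using h1 j.succ)
    have a0 : 0 ≤ a := by simpa using h0 0
    have a1 : a < 1 := by simpa using h1 0
    have i2 := hasSum_geometric_of_lt_one a0 a1
    simp only [monR_cons, Fin.prod_univ_succ, Fin.cons_zero, Fin.cons_succ]
    have t0 : ∀ j, 0 ≤ t' j := fun j => by simpa using h0 j.succ
    have hsm : Summable (fun p : ℕ × (Fin n → ℕ) => a ^ p.1 * monR p.2 t') :=
      Summable.mul_of_nonneg (f := fun m : ℕ => a ^ m) (g := fun k => monR k t') i2.summable i1.summable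
        (fun m => pow_nonneg a0 m) (fun k => monR_nonneg k t0)
    exact HasSum.mul (f := fun m : ℕ => a ^ m) (g := fun k => monR k t') i2 i1 hsm

lemma pser_uniq1 {S : ℕ → ℂ} {ε : ℝ} (hε : 0 < ε)
    (h : ∀ w : ℂ, ‖w‖ < ε → HasSum (fun m => S m * w ^ m) 0) : S = 0 := by
  have h1 : HasFPowerSeriesAt (0 : ℂ → ℂ) (FormalMultilinearSeries.ofScalars ℂ S) 0 := by
    rw [hasFPowerSeriesAt_iff]
    filter_upwards [Metric.ball_mem_nhds (0:ℂ) hε] with z hz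
    have := h z (by simpa using hz)
    simp only [FormalMultilinearSeries.coeff_ofScalars, smul_eq_mul]
    simpa [mul_comm] using this
  have h2 := h1.eq_zero
  ext m
  have := congrArg (fun p => p.coeff m) h2
  have h0 : (0 : FormalMultilinearSeries ℂ ℂ ℂ).coeff m = 0 := rfl
  simp only [FormalMultilinearSeries.coeff_ofScalars, h0] at this
  exact this

lemma pser_uniq {n : ℕ} {c : (Fin n → ℕ) → ℂ} {ε : ℝ} (hε : 0 < ε)
    (h : ∀ z : Fin n → ℂ, (∀ j, ‖z j‖ < ε) → HasSum (fun k => c k * mon k z) 0) : c = 0 := by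
  induction n with
  | zero =>
    have h0 := h 0 (fun j => j.elim0)
    have := (hasSum_unique (fun k : Fin 0 → ℕ => c k * mon k 0)).unique h0
    ext k
    rw [Subsingleton.elim k (@default (Fin 0 → ℕ) Unique.instInhabited)]
    simp only [mon, Finset.univ_eq_empty, Finset.prod_empty, mul_one] at this
    exact this
  | succ n ih =>
    have key : ∀ m, (fun k' => c (Fin.cons m k')) = 0 := by
      intro m
      apply ih
      intro z hz
      have hh : ∀ w : ℂ, ‖w‖ < ε → HasSum (fun p : ℕ × (Fin n → ℕ) =>
          c (Fin.cons p.1 p.2) * (w ^ p.1 * mon p.2 z)) 0 := by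
        intro w hw
        have := h (Fin.cons w z) (fun j => by refine Fin.cases ?_ (fun i => ?_) j <;> simp [hw, hz])
        rw [hasSum_cons] at this
        simpa only [mon_cons] using this
      have hs : ∀ m, Summable (fun k' => c (Fin.cons m k') * mon k' z) := by
        intro m
        have h2 := (hh (ε/2 : ℝ) (by simp [abs_of_pos hε]; linarith)).summable.prod_factor m
        have h3 := h2.mul_left ((((ε/2 : ℝ) : ℂ) ^ m)⁻¹)
        refine h3.congr fun k' => ?_
        have : (((ε/2 : ℝ) : ℂ) ^ m) ≠ 0 := pow_ne_zero _ (by exact_mod_cast (by positivity))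
        field_simp
      have hz : (fun m => ∑' k', c (Fin.cons m k') * mon k' z) = 0 := by
        apply pser_uniq1 hε
        intro w hw
        refine (hh w hw).prod_fiberwise fun m => ?_
        have := (hs m).hasSum.mul_right (w ^ m)
        refine this.congr_fun ?_
        intro k'; ring
      have := (hs m).hasSum
      rw [congrFun hz m] at this
      exact this
    ext k
    have := congrFun (key (k 0)) (Fin.tail k)
    simpa [Fin.cons_self_tail] using this

/-- slice coefficient -/
def scoef {n : ℕ} (g : (Fin (n+1) → ℂ) → ℂ) (m : ℕ) (z : Fin n → ℂ) : ℂ :=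
  (m.factorial : ℂ)⁻¹ * iteratedDeriv m (fun w => g (Fin.cons w z)) 0

def incl (n : ℕ) : (Fin n → ℂ) →L[ℂ] (Fin (n+1) → ℂ) :=
  ContinuousLinearMap.pi (fun j => Fin.cases (motive := fun _ => (Fin n → ℂ) →L[ℂ] ℂ) 0 (fun i => ContinuousLinearMap.proj i) j)

lemma cons_eq {n : ℕ} (w : ℂ) (z : Fin n → ℂ) :
    (Fin.cons w z : Fin (n+1) → ℂ) = Pi.single 0 w + incl n z := by
  ext j; refine Fin.cases ?_ (fun i => ?_) j <;> simp [incl]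

lemma cons_mem {n : ℕ} {s : Fin (n+1) → ℝ} {w : ℂ} {z : Fin n → ℂ} (hw : ‖w‖ < s 0)
    (hz : z ∈ PD (Fin.tail s)) : (Fin.cons w z : Fin (n+1) → ℂ) ∈ PD s := by
  intro j; refine Fin.cases ?_ (fun i => ?_) j
  · simpa using hw
  · simp only [Fin.cons_succ]; exact hz i

lemma slice_diff {n : ℕ} {s : Fin (n+1) → ℝ} {g : (Fin (n+1) → ℂ) → ℂ}
    (hg : ContDiffOn ℂ 1 g (PD s)) {z : Fin n → ℂ} (hz : z ∈ PD (Fin.tail s)) :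
    DifferentiableOn ℂ (fun w => g (Fin.cons w z)) (Metric.ball 0 (s 0)) := by
  have h1 := hg.differentiableOn (by simp)
  refine h1.comp (f := fun w : ℂ => (Fin.cons w z : Fin (n+1) → ℂ)) ?_ ?_
  · intro w _
    apply DifferentiableAt.differentiableWithinAt
    rw [differentiableAt_pi]
    intro j; refine Fin.cases ?_ (fun i => ?_) j <;> simp
  · intro w hw
    exact cons_mem (by simpa using hw) hz

lemma scoef_bound {n : ℕ} {s : Fin (n+1) → ℝ} (hs : ∀ j, 0 < s j) {g : (Fin (n+1) → ℂ) → ℂ} {B : ℝ}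
    (hg : ContDiffOn ℂ 1 g (PD s)) (hB : ∀ z ∈ PD s, ‖g z‖ ≤ B) (m : ℕ) {z : Fin n → ℂ}
    (hz : z ∈ PD (Fin.tail s)) : ‖scoef g m z‖ ≤ B / s 0 ^ m := by
  have key : ∀ r, 0 < r → r < s 0 → ‖scoef g m z‖ * r ^ m ≤ B := by
    intro r hr hrs
    have h1 := Complex.norm_iteratedDeriv_le_of_forall_mem_sphere_norm_le (c := 0) (C := B) (f := fun w => g (Fin.cons w z)) m hr ?_ ?_
    · have hm : (0:ℝ) < m.factorial := by positivity
      have h2 : (0:ℝ) < r ^ m := by positivity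
      rw [le_div_iff₀ h2] at h1
      simp only [scoef, norm_mul, norm_inv, Complex.norm_natCast]
      rw [mul_assoc, inv_mul_le_iff₀ hm]
      exact h1
    · apply DifferentiableOn.diffContOnCl
      refine (slice_diff hg hz).mono ?_
      rw [closure_ball _ hr.ne']
      exact Metric.closedBall_subset_ball hrs
    · intro w hw
      exact hB _ (cons_mem (by simpa using (by simpa using hw : ‖w‖ = r).trans_lt hrs) hz)
  rw [le_div_iff₀ (pow_pos (hs 0) m)]
  have hc : Tendsto (fun r : ℝ => ‖scoef g m z‖ * r ^ m) (𝓝[<] (s 0)) (𝓝 (‖scoef g m z‖ * s 0 ^ m)) :=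
    (Continuous.tendsto (by fun_prop) _).mono_left nhdsWithin_le_nhds
  refine le_of_tendsto hc ?_
  filter_upwards [Ioo_mem_nhdsLT (hs 0)] with r hr
  exact key r hr.1 hr.2

lemma scoef_contDiffOn {n : ℕ} {s : Fin (n+1) → ℝ} (hs : ∀ j, 0 < s j) {g : (Fin (n+1) → ℂ) → ℂ}
    (hg : ContDiffOn ℂ 1 g (PD s)) (m : ℕ) : ContDiffOn ℂ 1 (scoef g m) (PD (Fin.tail s)) := by
  set r := s 0 / 2
  have hr : 0 < r := half_pos (hs 0)
  have hrs : r < s 0 := half_lt_self (hs 0)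
  set a : ℝ → ℂ := fun θ => deriv (circleMap 0 r) θ * (1 / (circleMap 0 r θ) ^ (m+1)) with ha
  have hac : Continuous a := by
    simp only [ha, deriv_circleMap]
    refine Continuous.mul (by fun_prop) ?_
    refine continuous_const.div (by fun_prop) fun θ => pow_ne_zero _ ?_
    exact circleMap_ne_center hr.ne'
  set K : Set ℝ := Icc 0 (2 * Real.pi)
  set F : (Fin n → ℂ) → ℝ → ℂ := fun z θ => a θ * g (Fin.cons (circleMap 0 r θ) z) with hF
  set F' : (Fin n → ℂ) → ℝ → (Fin n → ℂ) →L[ℂ] ℂ := fun z θ =>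
    a θ • (fderiv ℂ g (Fin.cons (circleMap 0 r θ) z)).comp (incl n) with hF'
  have hnorm : ∀ θ, ‖circleMap 0 r θ‖ < s 0 := fun θ => by simp [abs_of_pos hr, hrs]
  have hcons : Continuous (fun p : (Fin n → ℂ) × ℝ => (Fin.cons (circleMap 0 r p.2) p.1 : Fin (n+1) → ℂ)) := by
    simp only [cons_eq]
    have : Continuous (fun θ : ℝ => (Pi.single 0 (circleMap 0 r θ) : Fin (n+1) → ℂ)) :=
      (continuous_single (A := fun _ : Fin (n+1) => ℂ) 0).comp (by fun_prop)
    exact (this.comp continuous_snd).add ((incl n).continuous.comp continuous_fst)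
  have hmaps : MapsTo (fun p : (Fin n → ℂ) × ℝ => (Fin.cons (circleMap 0 r p.2) p.1 : Fin (n+1) → ℂ))
      (PD (Fin.tail s) ×ˢ K) (PD s) := fun p hp => cons_mem (hnorm _) hp.1
  have hFc : ContinuousOn (Function.uncurry F) (PD (Fin.tail s) ×ˢ K) := by
    refine ContinuousOn.mul (hac.comp continuous_snd).continuousOn ?_
    exact hg.continuousOn.comp hcons.continuousOn hmaps
  have hFc' : ContinuousOn (Function.uncurry F') (PD (Fin.tail s) ×ˢ K) := by
    refine ContinuousOn.smul (hac.comp continuous_snd).continuousOn ?_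
    refine ContinuousOn.clm_comp ?_ continuousOn_const
    exact (hg.continuousOn_fderiv_of_isOpen (isOpen_PD s) (by simp)).comp hcons.continuousOn hmaps
  have hd : ∀ z ∈ PD (Fin.tail s), ∀ θ ∈ K, HasFDerivAt (fun w => F w θ) (F' z θ) z := by
    intro z hz θ hθ
    have h1 : HasFDerivAt g (fderiv ℂ g (Fin.cons (circleMap 0 r θ) z)) (Fin.cons (circleMap 0 r θ) z) :=
      ((hg.differentiableOn (by simp)).differentiableAt
        ((isOpen_PD s).mem_nhds (cons_mem (hnorm _) hz))).hasFDerivAt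
    have h2 : HasFDerivAt (fun w : Fin n → ℂ => (Fin.cons (circleMap 0 r θ) w : Fin (n+1) → ℂ)) (incl n) z := by
      simp only [cons_eq]
      exact (incl n).hasFDerivAt.const_add _
    exact (HasFDerivAt.comp z h1 h2).const_mul (a θ)
  have hI : ContDiffOn ℂ 1 (fun z => ∫ θ in K, F z θ) (PD (Fin.tail s)) :=
    cd1_of_hasFDerivAt (isOpen_PD _) (fun z hz => hasFDerivAt_param (isOpen_PD _) isCompact_Icc
      (fun z hz => hFc.comp (f := fun x => (z, x)) (by fun_prop) (fun x hx => ⟨hz, hx⟩)) hFc' hd z hz)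
      (cont_param (isOpen_PD _) isCompact_Icc hFc')
  have hI2 := contDiffOn_const (c := (2 * Real.pi * Complex.I)⁻¹) |>.mul hI
  refine hI2.congr fun z hz => ?_
  have h1 := DiffContOnCl.circleIntegral_one_div_sub_center_pow_smul (c := 0)
    (f := fun w => g (Fin.cons w z)) hr m ?_
  · rw [circleIntegral, intervalIntegral.integral_of_le (by positivity),
      ← integral_Icc_eq_integral_Ioc] at h1
    have h2 : ∫ θ in K, F z θ = 2 * Real.pi * Complex.I / m.factorial * iteratedDeriv m (fun w => g (Fin.cons w z)) 0 := by
      rw [← smul_eq_mul, ← h1]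
      simp [hF, ha, K, mul_assoc]
    rw [h2, scoef]
    have : (2 * Real.pi * Complex.I : ℂ) ≠ 0 := Complex.two_pi_I_ne_zero
    field_simp
  · apply DifferentiableOn.diffContOnCl
    refine (slice_diff hg hz).mono ?_
    rw [closure_ball _ hr.ne']
    exact Metric.closedBall_subset_ball hrs

lemma pser_exists {n : ℕ} {s : Fin n → ℝ} (hs : ∀ j, 0 < s j) {g : (Fin n → ℂ) → ℂ} {B : ℝ}
    (hg : ContDiffOn ℂ 1 g (PD s)) (hB : ∀ z ∈ PD s, ‖g z‖ ≤ B) :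
    ∃ c : (Fin n → ℕ) → ℂ, (∀ k, ‖c k‖ * monR k s ≤ B) ∧
      ∀ z ∈ PD s, HasSum (fun k => c k * mon k z) (g z) := by
  induction n generalizing B with
  | zero =>
    refine ⟨fun _ => g 0, fun k => ?_, fun z hz => ?_⟩
    · simpa [monR] using hB 0 (fun j => j.elim0)
    · have := hasSum_unique (fun k : Fin 0 → ℕ => g 0 * mon k z)
      rw [Subsingleton.elim z 0] at this ⊢
      simpa [mon] using this
  | succ n ih =>
    have hex := fun m => ih (s := Fin.tail s) (fun j => hs j.succ) (scoef_contDiffOn hs hg m)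
      (B := B / s 0 ^ m) (fun z hz => scoef_bound hs hg hB m hz)
    choose d hd1 hd2 using hex
    refine ⟨fun k => d (k 0) (Fin.tail k), fun k => ?_, fun z hz => ?_⟩
    · have := hd1 (k 0) (Fin.tail k)
      rw [le_div_iff₀ (pow_pos (hs 0) _)] at this
      rw [← Fin.cons_self_tail k, ← Fin.cons_self_tail s, monR_cons]
      simp only [Fin.cons_zero, Fin.tail_cons]
      linarith
    · obtain ⟨w, z', rfl⟩ : ∃ a t', z = Fin.cons a t' := ⟨z 0, Fin.tail z, (Fin.cons_self_tail z).symm⟩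
      have hw : ‖w‖ < s 0 := by simpa using hz 0
      have hz' : z' ∈ PD (Fin.tail s) := fun j => by have := hz j.succ; simp only [Fin.cons_succ] at this; exact this
      have hB0 : 0 ≤ B := (norm_nonneg _).trans (hB _ hz)
      rw [hasSum_cons]
      simp only [mon_cons, Fin.cons_zero, Fin.tail_cons]
      have hsum : Summable (fun p : ℕ × (Fin n → ℕ) => d p.1 p.2 * (w ^ p.1 * mon p.2 z')) := by
        have g1 := summable_geometric_of_lt_one (r := ‖w‖ / s 0) (by have := hs 0; positivity)
          ((div_lt_one (hs 0)).2 hw)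
        have ht0 : ∀ j, 0 ≤ ‖z' j‖ / Fin.tail s j := fun j => div_nonneg (norm_nonneg _) (hs j.succ).le
        have g2 := (hasSum_geom (fun j => ‖z' j‖ / Fin.tail s j) ht0
          (fun j => (div_lt_one (hs j.succ)).2 (hz' j))).summable
        have g3 := ((g1.mul_of_nonneg g2 (fun m => pow_nonneg (by have := hs 0; positivity) m)
          (fun k => monR_nonneg k ht0))).mul_left B
        refine Summable.of_norm_bounded g3 ?_
        rintro ⟨m, k⟩
        have h1 := hd1 m k
        have p1 : 0 < s 0 ^ m := pow_pos (hs 0) _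
        have p2 : 0 < monR k (Fin.tail s) := monR_pos k (fun j => hs j.succ)
        simp only [norm_mul, norm_pow, norm_mon, monR_div, div_pow]
        have h2 : ‖d m k‖ ≤ B / s 0 ^ m / monR k (Fin.tail s) := by rwa [le_div_iff₀ p2]
        calc _ ≤ B / s 0 ^ m / monR k (Fin.tail s) * (‖w‖ ^ m * monR k fun j => ‖z' j‖) := by
              refine mul_le_mul_of_nonneg_right h2 ?_
              exact mul_nonneg (by positivity) (monR_nonneg k fun j => norm_nonneg _)
          _ = _ := by field_simp
      have hfib : ∀ m, HasSum (fun k' => d m k' * (w ^ m * mon k' z')) (scoef g m z' * w ^ m) := by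
        intro m
        have := (hd2 m z' hz').mul_right (w ^ m)
        refine this.congr_fun ?_
        intro k'; ring
      have h1 := hsum.hasSum.prod_fiberwise hfib
      have h2 := Complex.hasSum_taylorSeries_on_ball (slice_diff hg hz') (z := w) (by simpa using hw)
      have h3 : HasSum (fun m => scoef g m z' * w ^ m) (g (Fin.cons w z')) := by
        refine h2.congr_fun ?_
        intro m; simp [scoef]; ring
      rw [← h1.unique h3]
      exact hsum.hasSum

open Set
open scoped ENNReal NNReal
noncomputable section
set_option linter.unusedSectionVars false
set_option linter.unusedSimpArgs false
open MeasureTheory Filter Topology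

lemma fderiv_bound {V : Type*} [NormedAddCommGroup V] [NormedSpace ℂ V] {g : V → ℂ} {z : V}
    {δ B : ℝ} (hδ : 0 < δ) (hg : Differentiable ℂ g) (hB : ∀ w, ‖w - z‖ ≤ δ → ‖g w‖ ≤ B) :
    ‖fderiv ℂ g z‖ ≤ B / δ := by
  have hB0 : 0 ≤ B := (norm_nonneg _).trans (hB z (by simpa using hδ.le))
  refine ContinuousLinearMap.opNorm_le_bound' _ (by positivity) fun ξ hξ => ?_
  have hξ' : 0 < ‖ξ‖ := lt_of_le_of_ne (norm_nonneg _) (Ne.symm hξ)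
  have hline : HasDerivAt (fun ζ : ℂ => z + ζ • ξ) ξ 0 := by
    simpa using ((hasDerivAt_id (0:ℂ)).smul_const ξ).const_add z
  have hd : HasDerivAt (fun ζ : ℂ => g (z + ζ • ξ)) (fderiv ℂ g z ξ) 0 := by
    have h1 : HasFDerivAt g (fderiv ℂ g z) (z + (0:ℂ) • ξ) := by simpa using (hg z).hasFDerivAt
    exact h1.comp_hasDerivAt (0:ℂ) hline
  have h2 := Complex.norm_deriv_le_of_forall_mem_sphere_norm_le (c := 0) (R := δ / ‖ξ‖) (C := B)
    (f := fun ζ : ℂ => g (z + ζ • ξ)) (by positivity)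
    (Differentiable.diffContOnCl (hg.comp (by fun_prop))) ?_
  · rw [hd.deriv] at h2
    calc _ ≤ _ := h2
      _ = _ := by field_simp
  · intro ζ hζ
    apply hB
    have : ‖ζ‖ = δ / ‖ξ‖ := by simpa using hζ
    simp [norm_smul, this]
    rw [div_mul_cancel₀ _ hξ]

lemma convex_PD {n : ℕ} (s : Fin n → ℝ) : Convex ℝ (PD s) := by
  have : PD s = Set.pi univ (fun j => Metric.ball (0:ℂ) (s j)) := by
    ext z; simp [PD]
  rw [this]
  exact convex_pi fun j _ => convex_ball _ _

lemma mon_differentiable {n : ℕ} (k : Fin n → ℕ) : ContDiff ℂ 1 (mon k) := by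
  unfold mon; fun_prop

lemma series_holo {n : ℕ} {D : (Fin n → ℕ) → ℂ} {t t' : Fin n → ℝ}
    (hs : Summable fun k => ‖D k‖ * monR k t) {δ : ℝ} (hδ : 0 < δ) (ht' : ∀ j, 0 < t' j)
    (htt : ∀ j, t' j + δ ≤ t j) : ContDiffOn ℂ 1 (fun z => ∑' k, D k * mon k z) (PD t') := by
  have hsm : Summable fun k => ‖D k‖ * monR k t / δ := hs.div_const δ
  have hcd : ∀ k, ContDiff ℂ 1 (fun z => D k * mon k z) := fun k =>
    contDiff_const.mul (mon_differentiable k)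
  have hb : ∀ k, ∀ z ∈ PD t', ‖fderiv ℂ (fun z => D k * mon k z) z‖ ≤ ‖D k‖ * monR k t / δ := by
    intro k z hz
    refine fderiv_bound hδ ((hcd k).differentiable (by simp)) fun w hw => ?_
    rw [norm_mul, norm_mon]
    refine mul_le_mul_of_nonneg_left (monR_mono k (fun j => norm_nonneg _) fun j => ?_) (norm_nonneg _)
    have h1 : ‖w j - z j‖ ≤ δ := (norm_le_pi_norm (w - z) j).trans hw
    have h2 := hz j
    have h3 : ‖w j‖ ≤ ‖w j - z j‖ + ‖z j‖ := by simpa using norm_add_le (w j - z j) (z j)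
    have := htt j
    linarith
  have h0 : (0 : Fin n → ℂ) ∈ PD t' := fun j => by simpa using ht' j
  refine cd1_of_hasFDerivAt (isOpen_PD _) (u' := fun z => ∑' k, fderiv ℂ (fun z => D k * mon k z) z) ?_ ?_
  · intro z hz
    refine hasFDerivAt_tsum_of_isPreconnected hsm (isOpen_PD t') (convex_PD t').isPreconnected
      (fun k x _ => ((hcd k).differentiable (by simp) x).hasFDerivAt) hb h0 ?_ hz
    refine Summable.of_norm_bounded hs fun k => ?_
    rw [norm_mul, norm_mon]
    refine mul_le_mul_of_nonneg_left (monR_mono k (fun j => norm_nonneg _) fun j => ?_) (norm_nonneg _)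
    have := htt j; have := ht' j
    simp; linarith
  · exact continuousOn_tsum (fun k => ((hcd k).continuous_fderiv (by simp)).continuousOn) hsm hb

lemma monR_amgm {n : ℕ} (k : Fin n → ℕ) {r p : Fin n → ℝ} (hr : ∀ j, 0 < r j) (hp : ∀ j, 0 < p j)
    (h : monR k r ≤ monR k p) {a : ℝ} (ha0 : 0 ≤ a) (ha1 : a ≤ 1) :
    monR k r ≤ monR k (fun j => a * r j + (1 - a) * p j) := by
  have h1 : monR k r ^ a * monR k p ^ (1 - a) ≤ monR k (fun j => a * r j + (1 - a) * p j) := by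
    have e : ∀ (x : Fin n → ℝ) (b : ℝ), (∀ j, 0 < x j) → monR k x ^ b = ∏ j, (x j ^ b) ^ k j := by
      intro x b hx
      unfold monR
      rw [← Real.finsetProd_rpow _ _ (fun j _ => pow_nonneg (hx j).le _)]
      refine Finset.prod_congr rfl fun j _ => ?_
      rw [← Real.rpow_natCast, ← Real.rpow_mul (hx j).le, ← Real.rpow_natCast (x j ^ b),
        ← Real.rpow_mul (hx j).le, mul_comm]
    rw [e r a hr, e p (1-a) hp, ← Finset.prod_mul_distrib]
    unfold monR
    refine Finset.prod_le_prod (fun j _ => by have := hr j; have := hp j; positivity) fun j _ => ?_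
    rw [← mul_pow]
    have := hr j; have := hp j
    refine pow_le_pow_left₀ (by positivity) ?_ _
    exact Real.geom_mean_le_arith_mean2_weighted ha0 (by linarith) (hr j).le (hp j).le (by ring)
  have hpos := monR_pos k hr
  calc monR k r = monR k r ^ a * monR k r ^ (1 - a) := by
        rw [← Real.rpow_add hpos]; simp
    _ ≤ monR k r ^ a * monR k p ^ (1 - a) := by
        refine mul_le_mul_of_nonneg_left ?_ (by positivity)
        exact Real.rpow_le_rpow hpos.le h (by linarith)
    _ ≤ _ := h1

def SigR {n : ℕ} (η R' : ℝ) : Set (Fin n → ℝ) := {r | (∀ j, η ≤ r j) ∧ ∑ j, r j ≤ R'}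

lemma SigR_compact {n : ℕ} (η R' : ℝ) : IsCompact (SigR η R' : Set (Fin n → ℝ)) := by
  apply Metric.isCompact_of_isClosed_isBounded
  · have : (SigR η R' : Set (Fin n → ℝ)) = (⋂ j, {r | η ≤ r j}) ∩ {r | ∑ j, r j ≤ R'} := by
      ext; simp [SigR]
    rw [this]
    exact (isClosed_iInter fun j => isClosed_le continuous_const (by fun_prop)).inter
      (isClosed_le (by fun_prop) continuous_const)
  · refine (Metric.isBounded_Icc (fun _ => η) (fun _ : Fin n => R' - n * η + η)).subset ?_
    rintro r ⟨h1, h2⟩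
    refine ⟨fun j => h1 j, fun j => ?_⟩
    have : ∑ i, (r i - η) ≤ R' - n * η := by
      rw [Finset.sum_sub_distrib]; simp; linarith
    have h3 := Finset.single_le_sum (f := fun i => r i - η) (fun i _ => sub_nonneg.2 (h1 i)) (Finset.mem_univ j)
    linarith

lemma SigR_comb {n : ℕ} {η R' : ℝ} {r p : Fin n → ℝ} (hr : r ∈ SigR η R') (hp : p ∈ SigR η R')
    {a : ℝ} (ha0 : 0 ≤ a) (ha1 : a ≤ 1) : (fun j => a * r j + (1 - a) * p j) ∈ (SigR η R' : Set (Fin n → ℝ)) := by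
  refine ⟨fun j => ?_, ?_⟩
  · have := hr.1 j; have := hp.1 j
    nlinarith
  · rw [Finset.sum_add_distrib, ← Finset.mul_sum, ← Finset.mul_sum]
    have := hr.2; have := hp.2
    nlinarith

lemma monR_scale {n : ℕ} (k : Fin n → ℕ) (r : Fin n → ℝ) (q : ℝ) :
    monR k (fun j => r j / q) = monR k r * monR k (fun _ => 1 / q) := by
  unfold monR
  rw [← Finset.prod_mul_distrib]
  refine Finset.prod_congr rfl fun j _ => ?_
  rw [← mul_pow]; congr 1; ring

/-- chain estimate -/
lemma chain_bound {n : ℕ} {η R' : ℝ} (hη : 0 < η) (k : Fin n → ℕ)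
    (d : (Fin n → ℝ) → (Fin n → ℝ) → ℂ) {B q : ℝ} (hq : 1 < q) {L : ℕ} (hL : (1 / q) ^ L ≤ 1 - 1 / q)
    (hco : ∀ r s t, r ∈ SigR η R' → s ∈ SigR η R' → t ∈ SigR η R' → d r s + d s t = d r t)
    (hd : ∀ r s, r ∈ SigR η R' → s ∈ SigR η R' → ‖d r s‖ * monR k (fun j => min (r j) (s j)) ≤ B)
    {r p : Fin n → ℝ} (hr : r ∈ SigR η R') (hp : p ∈ SigR η R') (hrp : monR k r ≤ monR k p) :
    ‖d r p‖ * monR k (fun j => r j / q) ≤ (L + 1) * B := by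
  have hq0 : 0 < q := by linarith
  have hi0 : 0 < 1 / q := by positivity
  have hi1 : 1 / q < 1 := by rw [div_lt_one hq0]; exact hq
  have pos : ∀ {r : Fin n → ℝ}, r ∈ SigR η R' → ∀ j, 0 < r j := fun h j => hη.trans_le (h.1 j)
  set x : ℕ → Fin n → ℝ := fun i j => (1/q)^i * r j + (1 - (1/q)^i) * p j with hx
  have hp0 : ∀ i : ℕ, 0 ≤ (1/q)^i := fun i => by positivity
  have hp1 : ∀ i : ℕ, (1/q)^i ≤ 1 := fun i => pow_le_one₀ hi0.le hi1.le
  have hxS : ∀ i, x i ∈ (SigR η R' : Set (Fin n → ℝ)) := fun i => SigR_comb hr hp (hp0 i) (hp1 i)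
  have hxm : ∀ i, monR k r ≤ monR k (x i) := fun i => monR_amgm k (pos hr) (pos hp) hrp (hp0 i) (hp1 i)
  have hx0 : x 0 = r := by ext j; simp [hx]
  -- general step
  have gen : ∀ a b c : Fin n → ℝ, a ∈ SigR η R' → b ∈ SigR η R' → c ∈ SigR η R' → monR k r ≤ monR k c →
      (∀ j, c j / q ≤ min (a j) (b j)) → ‖d a b‖ * monR k (fun j => r j / q) ≤ B := by
    intro a b c ha hb hc hrc hcm
    refine le_trans (mul_le_mul_of_nonneg_left ?_ (norm_nonneg _)) (hd a b ha hb)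
    calc _ ≤ monR k (fun j => c j / q) := by
          rw [monR_scale, monR_scale k c]
          exact mul_le_mul_of_nonneg_right hrc (monR_nonneg k fun _ => hi0.le)
      _ ≤ _ := monR_mono k (fun j => (div_pos (pos hc j) hq0).le) hcm
  have hstep : ∀ i, ‖d (x i) (x (i+1))‖ * monR k (fun j => r j / q) ≤ B := by
    intro i
    refine gen _ _ (x i) (hxS _) (hxS _) (hxS _) (hxm i) fun j => le_min ?_ ?_
    · exact div_le_self (pos (hxS i) j).le hq.le
    · simp only [hx]
      have h1 := pos hp j
      have e : (1/q)^(i+1) * r j + (1 - (1/q)^(i+1)) * p j - ((1/q)^i * r j + (1 - (1/q)^i) * p j) / q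
        = (1 - 1/q) * p j := by rw [pow_succ]; ring
      have : 0 ≤ (1 - 1/q) * p j := mul_nonneg (by linarith) h1.le
      linarith
  have hlast : ‖d (x L) p‖ * monR k (fun j => r j / q) ≤ B := by
    refine gen _ _ p (hxS _) hp hp hrp fun j => le_min ?_ ?_
    · simp only [hx]
      have h1 := pos hp j
      have h2 := pos hr j
      have h3 : 0 ≤ (1/q)^L * r j := mul_nonneg (hp0 L) h2.le
      have : 1/q * p j ≤ (1 - (1/q)^L) * p j := mul_le_mul_of_nonneg_right (by linarith) h1.le
      have e : p j / q = 1/q * p j := by ring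
      linarith
    · exact div_le_self (pos hp j).le hq.le
  have hm0 : 0 ≤ monR k (fun j => r j / q) := monR_nonneg k fun j => (div_pos (pos hr j) hq0).le
  have hind : ∀ i : ℕ, ‖d r (x i)‖ * monR k (fun j => r j / q) ≤ i * B := by
    intro i
    induction i with
    | zero =>
      have := hco r r r hr hr hr
      have : d r r = 0 := by simpa using this
      simp [hx0, this]
    | succ i ih =>
      rw [← hco r (x i) (x (i+1)) hr (hxS _) (hxS _)]
      calc _ ≤ (‖d r (x i)‖ + ‖d (x i) (x (i+1))‖) * monR k (fun j => r j / q) :=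
            mul_le_mul_of_nonneg_right (norm_add_le _ _) hm0
        _ ≤ _ := by have := hstep i; push_cast; linarith
  rw [← hco r (x L) p hr (hxS _) hp]
  calc _ ≤ (‖d r (x L)‖ + ‖d (x L) p‖) * monR k (fun j => r j / q) :=
        mul_le_mul_of_nonneg_right (norm_add_le _ _) hm0
    _ ≤ _ := by have := hind L; linarith

open Set
open scoped ENNReal NNReal
noncomputable section
set_option linter.unusedSectionVars false
set_option linter.unusedSimpArgs false
open MeasureTheory Filter Topology

def n1 {N : ℕ} (z : Fin N → ℂ) : ℝ := ∑ i, ‖z i‖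

def nz {N : ℕ} (z : Fin N → ℂ) : ℕ := (Finset.univ.filter fun i => z i ≠ 0).card

lemma n1_continuous {N : ℕ} : Continuous (n1 : (Fin N → ℂ) → ℝ) := by unfold n1; fun_prop

lemma isOpen_n1 {N : ℕ} (r : ℝ) : IsOpen {z : Fin N → ℂ | n1 z < r} :=
  isOpen_lt n1_continuous continuous_const

lemma dbar_eq_sum {N : ℕ} (u : (Fin N → ℂ) → ℂ) (z ξ : Fin N → ℂ) :
    dbar u z ξ = ∑ j, (starRingEnd ℂ) (ξ j) * dbar u z (ee j) := by
  have h : ξ = ∑ j, ξ j • ee j := by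
    ext i; simp [ee, Finset.sum_apply, Pi.single_apply]
  have h2 := map_sum (AddMonoidHom.mk' (dbar u z) (dbar_vadd u z)) (fun j => ξ j • ee j) Finset.univ
  simp only [AddMonoidHom.mk'_apply] at h2
  conv_lhs => rw [h]
  rw [h2]
  exact Finset.sum_congr rfl fun j _ => dbar_smul u z _ _

lemma monR_mul {n : ℕ} (k : Fin n → ℕ) (z w : Fin n → ℝ) :
    monR k (fun j => z j * w j) = monR k z * monR k w := by
  simp [monR, mul_pow, Finset.prod_mul_distrib]

lemma glue {N : ℕ} {η R' q M' : ℝ} {L : ℕ} (hη : 0 < η) (hq : 1 < q) (hL : (1 / q) ^ L ≤ 1 - 1 / q)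
    (hM : 0 ≤ M') (f : Fin N → (Fin N → ℂ) → ℂ) (u : (Fin N → ℝ) → (Fin N → ℂ) → ℂ)
    (hu1 : ∀ r ∈ SigR η R', ContDiffOn ℝ 1 (u r) (PD r))
    (hu2 : ∀ r ∈ SigR η R', ∀ z ∈ PD r, ∀ j, dbar (u r) z (ee j) = f j z)
    (hu3 : ∀ r ∈ SigR η R', ∀ z ∈ PD r, ‖u r z‖ ≤ M') {ρ1 : ℝ} (hρ1 : 0 < ρ1)
    (hρ : q ^ 3 * ρ1 + N * η ≤ R') :
    ∃ v : (Fin N → ℂ) → ℂ, ContDiffOn ℝ 1 v {z | n1 z < ρ1} ∧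
      (∀ z, n1 z < ρ1 → ∀ j, dbar v z (ee j) = f j z) ∧
      ∀ z, n1 z < ρ1 → ‖v z‖ ≤ M' + (L + 1) * (2 * M') * (q / (q - 1)) ^ nz z := by
  have hq0 : 0 < q := by linarith
  have pos : ∀ {r : Fin N → ℝ}, r ∈ SigR η R' → ∀ j, 0 < r j := fun h j => hη.trans_le (h.1 j)
  have hud : ∀ r ∈ SigR η R', ∀ z ∈ PD r, DifferentiableAt ℝ (u r) z := fun r hr z hz =>
    ((hu1 r hr).differentiableOn (by simp)).differentiableAt ((isOpen_PD r).mem_nhds hz)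
  have hmin : ∀ {r s : Fin N → ℝ} {z}, z ∈ PD (fun j => min (r j) (s j)) → z ∈ PD r ∧ z ∈ PD s :=
    fun h => ⟨fun j => (lt_min_iff.1 (h j)).1, fun j => (lt_min_iff.1 (h j)).2⟩
  have hex : ∀ r s : Fin N → ℝ, ∃ c : (Fin N → ℕ) → ℂ, r ∈ SigR η R' → s ∈ SigR η R' →
      (∀ k, ‖c k‖ * monR k (fun j => min (r j) (s j)) ≤ 2 * M') ∧
      ∀ z ∈ PD (fun j => min (r j) (s j)), HasSum (fun k => c k * mon k z) (u r z - u s z) := by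
    intro r s
    by_cases h : r ∈ SigR η R' ∧ s ∈ SigR η R'
    · obtain ⟨hr, hs⟩ := h
      have h1 : ContDiffOn ℝ 1 (fun z => u r z - u s z) (PD (fun j => min (r j) (s j))) :=
        ((hu1 r hr).mono fun z hz => (hmin hz).1).sub ((hu1 s hs).mono fun z hz => (hmin hz).2)
      have h2 : ContDiffOn ℂ 1 (fun z => u r z - u s z) (PD (fun j => min (r j) (s j))) := by
        refine cd1_complex_of (isOpen_PD _) h1 fun z hz ξ => ?_
        rw [dbar_sub (hud r hr z (hmin hz).1) (hud s hs z (hmin hz).2), dbar_eq_sum (u r), dbar_eq_sum (u s)]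
        simp only [hu2 r hr z (hmin hz).1, hu2 s hs z (hmin hz).2, sub_self]
      obtain ⟨c, hc⟩ := pser_exists (fun j => lt_min (pos hr j) (pos hs j)) h2 (B := 2 * M') (fun z hz => by
        have := hu3 r hr z (hmin hz).1
        have := hu3 s hs z (hmin hz).2
        exact (norm_sub_le _ _).trans (by linarith))
      exact ⟨c, fun _ _ => hc⟩
    · exact ⟨0, fun hr hs => absurd ⟨hr, hs⟩ h⟩
  choose D hD using hex
  have hco : ∀ k, ∀ r s t, r ∈ SigR η R' → s ∈ SigR η R' → t ∈ SigR η R' → D r s k + D s t k = D r t k := by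
    intro k r s t hr hs ht
    have : (fun k => D r s k + D s t k - D r t k) = 0 := by
      refine pser_uniq hη fun z hz => ?_
      have m : ∀ {r s : Fin N → ℝ}, r ∈ SigR η R' → s ∈ SigR η R' → z ∈ PD (fun j => min (r j) (s j)) :=
        fun hr hs j => (hz j).trans_le (le_min (hr.1 j) (hs.1 j))
      have := (((hD r s hr hs).2 z (m hr hs)).add ((hD s t hs ht).2 z (m hs ht))).sub
        ((hD r t hr ht).2 z (m hr ht))
      have e1 : u r z - u s z + (u s z - u t z) - (u r z - u t z) = 0 := by ring
      rw [e1] at this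
      refine this.congr_fun fun k => ?_
      ring
    have := congrFun this k
    exact sub_eq_zero.1 this
  have hne : (SigR η R' : Set (Fin N → ℝ)).Nonempty := by
    refine ⟨fun _ => η, fun _ => le_rfl, ?_⟩
    have : 0 < q ^ 3 * ρ1 := by positivity
    simp; linarith
  have hpex : ∀ k : Fin N → ℕ, ∃ p ∈ SigR η R', ∀ r ∈ SigR η R', monR k r ≤ monR k p := by
    intro k
    obtain ⟨p, hp, h⟩ := (SigR_compact η R').exists_isMaxOn hne
      (f := monR k) (by unfold monR; fun_prop)
    exact ⟨p, hp, fun r hr => h hr⟩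
  choose p hpS hpm using hpex
  set B := (L + 1) * (2 * M') with hB
  have hB0 : 0 ≤ B := by positivity
  set E : (Fin N → ℝ) → (Fin N → ℕ) → ℂ := fun r k => D r (p k) k with hE
  have hEb : ∀ r ∈ SigR η R', ∀ k, ‖E r k‖ * monR k (fun j => r j / q) ≤ B := fun r hr k =>
    chain_bound hη k (fun r s => D r s k) hq hL (hco k)
      (fun r s hr hs => (hD r s hr hs).1 k) hr (hpS k) (hpm k r hr)
  set h : (Fin N → ℝ) → (Fin N → ℂ) → ℂ := fun r z => ∑' k, E r k * mon k z with hh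
  have hi0 : 0 < 1 / q := by positivity
  have hi1 : 1 / q < 1 := by rw [div_lt_one hq0]; exact hq
  have hgs : Summable fun k : Fin N → ℕ => B * monR k (fun _ => 1 / q) :=
    (hasSum_geom (fun _ => 1/q) (fun _ => hi0.le) (fun _ => hi1)).summable.mul_left B
  have hsum : ∀ r ∈ SigR η R', Summable fun k => ‖E r k‖ * monR k (fun j => r j / q / q) := by
    intro r hr
    refine Summable.of_nonneg_of_le (fun k => ?_) (fun k => ?_) hgs
    · exact mul_nonneg (norm_nonneg _) (monR_nonneg k fun j => by have := pos hr j; positivity)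
    · rw [monR_scale k (fun j => r j / q), ← mul_assoc]
      exact mul_le_mul_of_nonneg_right (hEb r hr k) (monR_nonneg k fun _ => hi0.le)
  have hq3 : ∀ x : ℝ, x / q ^ 3 = x / q / q / q := fun x => by field_simp
  have hhol : ∀ r ∈ SigR η R', ContDiffOn ℂ 1 (h r) (PD fun j => r j / q ^ 3) := by
    intro r hr
    refine series_holo (hsum r hr) (δ := η / q / q * (1 - 1 / q)) ?_ (fun j => by have := pos hr j; positivity) ?_
    · have : 0 < 1 - 1 / q := by linarith
      positivity
    · intro j
      have h1 : η / q / q * (1 - 1/q) ≤ r j / q / q * (1 - 1 / q) := by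
        refine mul_le_mul_of_nonneg_right ?_ (by linarith)
        have := hr.1 j
        gcongr
      have e : r j / q ^ 3 + r j / q / q * (1 - 1 / q) = r j / q / q := by rw [hq3]; ring
      linarith
  have hPDsub : ∀ r : Fin N → ℝ, r ∈ SigR η R' → ∀ z ∈ PD (fun j => r j / q ^ 3), z ∈ PD r := by
    intro r hr z hz j
    exact (hz j).trans_le (div_le_self (pos hr j).le (one_le_pow₀ hq.le))
  have hsumz : ∀ r ∈ SigR η R', ∀ z ∈ PD (fun j => r j / q ^ 3), Summable fun k => E r k * mon k z := by
    intro r hr z hz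
    refine Summable.of_norm_bounded (hsum r hr) fun k => ?_
    rw [norm_mul, norm_mon]
    refine mul_le_mul_of_nonneg_left (monR_mono k (fun j => norm_nonneg _) fun j => ?_) (norm_nonneg _)
    refine (hz j).le.trans ?_
    simp only [hq3]
    exact div_le_self (by have := pos hr j; positivity) hq.le
  have hcons : ∀ r ∈ SigR η R', ∀ s ∈ SigR η R', ∀ z ∈ PD (fun j => r j / q ^ 3), z ∈ PD (fun j => s j / q ^ 3) →
      u r z - h r z = u s z - h s z := by
    intro r hr s hs z hzr hzs
    have h1 := (hsumz r hr z hzr).hasSum.sub (hsumz s hs z hzs).hasSum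
    have h2 := (hD r s hr hs).2 z (fun j => lt_min (hPDsub r hr z hzr j) (hPDsub s hs z hzs j))
    have h3 : (fun k => E r k * mon k z - E s k * mon k z) = fun k => D r s k * mon k z := by
      ext k
      have := hco k r s (p k) hr hs (hpS k)
      simp only [hE]
      rw [← this]; ring
    rw [h3] at h1
    have h4 : u r z - u s z = h r z - h s z := h2.unique h1
    linear_combination h4
  set Rz : (Fin N → ℂ) → Fin N → ℝ := fun z j => q ^ 3 * ‖z j‖ + η with hRz
  have hRS : ∀ z, n1 z < ρ1 → Rz z ∈ SigR η R' := by
    intro z hz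
    refine ⟨fun j => by simp only [hRz]; have : 0 ≤ q ^ 3 * ‖z j‖ := by positivity
                        linarith, ?_⟩
    simp only [hRz, Finset.sum_add_distrib, ← Finset.mul_sum]
    simp only [Finset.sum_const, Finset.card_univ, Fintype.card_fin, nsmul_eq_mul]
    have : q ^ 3 * n1 z ≤ q ^ 3 * ρ1 := mul_le_mul_of_nonneg_left hz.le (by positivity)
    unfold n1 at this
    linarith
  have hzR : ∀ z : Fin N → ℂ, z ∈ PD (fun j => Rz z j / q ^ 3) := by
    intro z j
    have : 0 < q ^ 3 := by positivity
    simp only [hRz]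
    rw [lt_div_iff₀ this]
    linarith
  have hev : ∀ z, n1 z < ρ1 → (fun w => u (Rz w) w - h (Rz w) w) =ᶠ[𝓝 z]
      fun w => u (Rz z) w - h (Rz z) w := by
    intro z hz
    filter_upwards [(isOpen_n1 ρ1).mem_nhds hz, (isOpen_PD _).mem_nhds (hzR z)] with w hw1 hw2
    exact hcons _ (hRS w hw1) _ (hRS z hz) w (hzR w) hw2
  have hda : ∀ z, n1 z < ρ1 → DifferentiableAt ℂ (h (Rz z)) z := fun z hz =>
    ((hhol _ (hRS z hz)).differentiableOn (by simp)).differentiableAt ((isOpen_PD _).mem_nhds (hzR z))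
  refine ⟨fun w => u (Rz w) w - h (Rz w) w, ?_, ?_, ?_⟩
  · intro z hz
    apply ContDiffAt.contDiffWithinAt
    refine ContDiffAt.congr_of_eventuallyEq ?_ (hev z hz)
    have hr := hRS z hz
    refine ContDiffAt.sub ((hu1 _ hr).contDiffAt ((isOpen_PD _).mem_nhds (hPDsub _ hr z (hzR z)))) ?_
    exact ((hhol _ hr).contDiffAt ((isOpen_PD _).mem_nhds (hzR z))).restrict_scalars ℝ
  · intro z hz j
    have hr := hRS z hz
    rw [dbar_congr (hev z hz), dbar_sub (hud _ hr z (hPDsub _ hr z (hzR z))) ((hda z hz).restrictScalars ℝ),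
      dbar_zero_of_diff (hda z hz), hu2 _ hr z (hPDsub _ hr z (hzR z)), sub_zero]
  · intro z hz
    have hr := hRS z hz
    refine (norm_sub_le _ _).trans (add_le_add (hu3 _ hr z (hPDsub _ hr z (hzR z))) ?_)
    set t : Fin N → ℝ := fun j => if z j = 0 then 0 else 1 / q with ht
    have ht0 : ∀ j, 0 ≤ t j := fun j => by simp only [ht]; split_ifs <;> positivity
    have ht1 : ∀ j, t j < 1 := fun j => by simp only [ht]; split_ifs <;> linarith
    have hg := (hasSum_geom t ht0 ht1).mul_left B
    have hprod : ∏ j, (1 - t j)⁻¹ = (q / (q - 1)) ^ nz z := by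
      have : ∀ j, (1 - t j)⁻¹ = if z j ≠ 0 then q / (q - 1) else 1 := by
        intro j
        by_cases hj : z j = 0
        · simp [ht, hj]
        · have : q - 1 ≠ 0 := by linarith
          simp only [ht, hj, if_false, ne_eq, not_false_iff, if_true]
          field_simp
      simp only [this]
      rw [Finset.prod_ite]
      simp [nz, div_pow]
    rw [hprod] at hg
    refine tsum_of_norm_bounded hg fun k => ?_
    rw [norm_mul, norm_mon]
    calc _ ≤ ‖E (Rz z) k‖ * (monR k (fun j => Rz z j / q) * monR k t) := by
          refine mul_le_mul_of_nonneg_left ?_ (norm_nonneg _)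
          rw [← monR_mul]
          refine monR_mono k (fun j => norm_nonneg _) fun j => ?_
          by_cases hj : z j = 0
          · simp [ht, hj]
          · simp only [ht, hj, if_false]
            refine (hzR z j).le.trans ?_
            simp only [hq3]
            have := pos hr j
            have e : Rz z j / q * (1 / q) = Rz z j / q / q := by ring
            rw [e]
            exact div_le_self (by positivity) hq.le
      _ ≤ _ := by
          rw [← mul_assoc]
          exact mul_le_mul_of_nonneg_right (hEb _ hr k) (monR_nonneg k ht0)

lemma exists_q {ρ1 : ℝ} (h0 : 0 < ρ1) (h1 : ρ1 < 1) : ∃ q : ℝ, 1 < q ∧ q ^ 4 * ρ1 < 1 := by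
  have hc : Tendsto (fun q : ℝ => q ^ 4 * ρ1) (𝓝[>] 1) (𝓝 (1 ^ 4 * ρ1)) :=
    (Continuous.tendsto (by fun_prop) _).mono_left nhdsWithin_le_nhds
  have h2 : ∀ᶠ q in 𝓝[>] (1:ℝ), q ^ 4 * ρ1 < 1 := hc.eventually (gt_mem_nhds (by simpa using h1))
  obtain ⟨q, hq, hq2⟩ := (h2.and self_mem_nhdsWithin).exists
  exact ⟨q, hq2, hq⟩

structure FormB {N : ℕ} (M : ℝ) (f : Fin N → (Fin N → ℂ) → ℂ) : Prop where
  cd : ∀ j, ContDiffOn ℝ 1 (f j) {z | n1 z < 1}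
  closed : ∀ z, n1 z < 1 → ∀ i j, dbar (f i) z (ee j) = dbar (f j) z (ee i)
  bd : ∀ z, n1 z < 1 → ∀ j, ‖f j z‖ ≤ M

lemma thmB (ρ1 : ℝ) (h0 : 0 < ρ1) (h1 : ρ1 < 1) : ∃ C : ℝ, 1 ≤ C ∧ ∀ (N : ℕ) (K : Finset (Fin N)) (M : ℝ)
    (f : Fin N → (Fin N → ℂ) → ℂ), 0 ≤ M → FormB M f → (∀ j, j ∉ K → ∀ z, n1 z < 1 → f j z = 0) →
    ∃ v : (Fin N → ℂ) → ℂ, ContDiffOn ℝ 1 v {z | n1 z < ρ1} ∧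
      (∀ z, n1 z < ρ1 → ∀ j, dbar v z (ee j) = f j z) ∧
      ∀ z, n1 z < ρ1 → ‖v z‖ ≤ C ^ (1 + K.card + nz z) * M := by
  obtain ⟨q, hq, hqρ⟩ := exists_q h0 h1
  have hq0 : 0 < q := by linarith
  obtain ⟨Cp, hCp, H⟩ := polydisc_solve q hq
  have hi0 : 0 < 1 / q := by positivity
  have hi1 : 1 / q < 1 := by rw [div_lt_one hq0]; exact hq
  obtain ⟨L, hL⟩ := exists_pow_lt_of_lt_one (show 0 < 1 - 1 / q by linarith) hi1
  have hqq : 1 ≤ q / (q - 1) := by rw [le_div_iff₀ (by linarith)]; linarith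
  set a : ℝ := 2 * L + 3 with ha
  have ha1 : 1 ≤ a := by have : (0:ℝ) ≤ L := by positivity
                         linarith
  set C := a * Cp * (q / (q - 1)) with hC
  have hCC : Cp ≤ C := by
    rw [hC]
    calc Cp = 1 * Cp * 1 := by ring
      _ ≤ _ := by gcongr
  have hCa : a ≤ C := by
    rw [hC]
    calc a = a * 1 * 1 := by ring
      _ ≤ _ := by gcongr
  have hCq : q / (q - 1) ≤ C := by
    rw [hC]
    calc q / (q - 1) = 1 * 1 * (q / (q - 1)) := by ring
      _ ≤ _ := by gcongr
  refine ⟨C, ha1.trans hCa, ?_⟩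
  intro N K M f hM hf hK
  obtain ⟨R', hR1, hR2⟩ := exists_between (show q ^ 3 * ρ1 < 1 / q by
    rw [lt_div_iff₀ hq0]; calc _ = q ^ 4 * ρ1 := by ring
      _ < 1 := hqρ)
  set η := (R' - q ^ 3 * ρ1) / (N + 1) with hη
  have hη0 : 0 < η := div_pos (by linarith) (by positivity)
  have hsol : ∀ r : Fin N → ℝ, ∃ u : (Fin N → ℂ) → ℂ, r ∈ SigR η R' → ContDiffOn ℝ 1 u (PD r) ∧
      (∀ z ∈ PD r, ∀ j, dbar u z (ee j) = f j z) ∧ ∀ z ∈ PD r, ‖u z‖ ≤ Cp ^ K.card * M := by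
    intro r
    by_cases hr : r ∈ SigR η R'
    · have pos : ∀ j, 0 < r j := fun j => hη0.trans_le (hr.1 j)
      have hsub : ∀ z ∈ PD (fun j => if j ∈ K then q * r j else q * r j / q), n1 z < 1 := by
        intro z hz
        have : n1 z ≤ ∑ j, q * r j := by
          refine Finset.sum_le_sum fun j _ => (hz j).le.trans ?_
          beta_reduce
          split_ifs
          · exact le_rfl
          · exact div_le_self (mul_pos hq0 (pos j)).le hq.le
        rw [← Finset.mul_sum] at this
        have h3 : q * ∑ j, r j ≤ q * R' := mul_le_mul_of_nonneg_left hr.2 hq0.le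
        have h4 : q * R' < 1 := by rw [lt_div_iff₀ hq0] at hR2; linarith
        linarith
      have e : (fun j => q * r j / q) = r := by ext j; field_simp
      have := H (fun j => q * r j) (fun j => mul_pos hq0 (pos j)) (fun j => by
        have h3 : r j ≤ R' := (Finset.single_le_sum (fun i _ => (pos i).le) (Finset.mem_univ j)).trans hr.2
        have h4 : q * R' < 1 := by rw [lt_div_iff₀ hq0] at hR2; linarith
        have := mul_le_mul_of_nonneg_left h3 hq0.le
        linarith) K M f hM ⟨fun j => (hf.cd j).mono hsub, fun z hz => hf.closed z (hsub z hz),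
          fun z hz => hf.bd z (hsub z hz)⟩ (fun j hj z hz => hK j hj z (hsub z hz))
      rw [e] at this
      obtain ⟨u, hu⟩ := this
      exact ⟨u, fun _ => hu⟩
    · exact ⟨0, fun h => absurd h hr⟩
  choose u hu using hsol
  have hM' : 0 ≤ Cp ^ K.card * M := by positivity
  obtain ⟨v, hv1, hv2, hv3⟩ := glue (N := N) hη0 hq hL.le hM' f u (fun r hr => (hu r hr).1) (fun r hr => (hu r hr).2.1)
    (fun r hr => (hu r hr).2.2) h0 (R' := R') (by
      have e : ((N:ℝ) + 1) * η = R' - q ^ 3 * ρ1 := by rw [hη]; field_simp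
      linarith)
  refine ⟨v, hv1, hv2, fun z hz => (hv3 z hz).trans ?_⟩
  have hp : 1 ≤ (q / (q - 1)) ^ nz z := one_le_pow₀ hqq
  calc Cp ^ K.card * M + (L + 1) * (2 * (Cp ^ K.card * M)) * (q / (q - 1)) ^ nz z
      ≤ Cp ^ K.card * M * (q / (q - 1)) ^ nz z + (L + 1) * (2 * (Cp ^ K.card * M)) * (q / (q - 1)) ^ nz z := by
        have := le_mul_of_one_le_right hM' hp
        linarith
    _ = a * Cp ^ K.card * (q / (q - 1)) ^ nz z * M := by rw [ha]; ring
    _ ≤ C * C ^ K.card * C ^ nz z * M := by gcongr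
    _ = _ := by rw [pow_add, pow_add, pow_one]

open Set
open scoped ENNReal NNReal
noncomputable section
set_option linter.unusedSectionVars false
set_option linter.unusedSimpArgs false
open MeasureTheory Filter Topology

lemma moebius {ι : Type*} [DecidableEq ι] (S : Finset ι) : ∀ F : Finset ι → ℂ,
    ∑ T ∈ S.powerset, ∑ T' ∈ T.powerset, (-1 : ℂ) ^ (T.card + T'.card) * F T' = F S := by
  induction S using Finset.induction_on with
  | empty => intro F; simp
  | insert a S ha ih =>
    intro F
    rw [Finset.sum_powerset_insert ha]
    have h1 : ∀ T ∈ S.powerset, ∑ T' ∈ (insert a T).powerset, (-1 : ℂ) ^ ((insert a T).card + T'.card) * F T'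
        = -(∑ T' ∈ T.powerset, (-1 : ℂ) ^ (T.card + T'.card) * F T')
          + ∑ T' ∈ T.powerset, (-1 : ℂ) ^ (T.card + T'.card) * F (insert a T') := by
      intro T hT
      have haT : a ∉ T := fun h => ha (Finset.mem_powerset.1 hT h)
      rw [Finset.sum_powerset_insert haT, ← Finset.sum_neg_distrib]
      congr 1
      · refine Finset.sum_congr rfl fun T' _ => ?_
        rw [Finset.card_insert_of_notMem haT, show T.card + 1 + T'.card = T.card + T'.card + 1 by ring, pow_succ]
        ring
      · refine Finset.sum_congr rfl fun T' hT' => ?_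
        have : a ∉ T' := fun h => haT (Finset.mem_powerset.1 hT' h)
        rw [Finset.card_insert_of_notMem haT, Finset.card_insert_of_notMem this,
          show T.card + 1 + (T'.card + 1) = T.card + T'.card + 2 by ring, pow_add]
        norm_num
    rw [Finset.sum_congr rfl h1, Finset.sum_add_distrib, Finset.sum_neg_distrib, ih F,
      ih (fun T => F (insert a T))]
    ring

lemma moebius_cancel {ι : Type*} [DecidableEq ι] {T : Finset ι} {a : ι} (ha : a ∈ T) (F : Finset ι → ℂ)
    (hF : ∀ T', F (insert a T') = F T') :
    ∑ T' ∈ T.powerset, (-1 : ℂ) ^ (T.card + T'.card) * F T' = 0 := by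
  obtain ⟨T0, hT0, rfl⟩ : ∃ T0, a ∉ T0 ∧ insert a T0 = T :=
    ⟨T.erase a, Finset.notMem_erase a T, Finset.insert_erase ha⟩
  rw [Finset.sum_powerset_insert hT0, ← Finset.sum_add_distrib]
  refine Finset.sum_eq_zero fun T' hT' => ?_
  have : a ∉ T' := fun h => hT0 (Finset.mem_powerset.1 hT' h)
  rw [hF, Finset.card_insert_of_notMem this, ← add_assoc, pow_succ]
  ring

def pj {N : ℕ} (T : Finset (Fin N)) : (Fin N → ℂ) →L[ℂ] (Fin N → ℂ) :=
  ContinuousLinearMap.pi (fun j => if j ∈ T then ContinuousLinearMap.proj j else 0)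

lemma pj_apply {N : ℕ} (T : Finset (Fin N)) (z : Fin N → ℂ) (j : Fin N) :
    pj T z j = if j ∈ T then z j else 0 := by
  simp only [pj, ContinuousLinearMap.coe_pi']
  split_ifs <;> simp

lemma pj_univ {N : ℕ} (z : Fin N → ℂ) : pj Finset.univ z = z := by
  ext j; simp [pj_apply]

lemma pj_ee {N : ℕ} (T : Finset (Fin N)) (j : Fin N) : pj T (ee j) = if j ∈ T then ee j else 0 := by
  ext i
  rw [pj_apply]
  by_cases h : i = j
  · subst h; split_ifs <;> simp
  · split_ifs <;> simp [ee, Pi.single_apply, h]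

lemma pj_pj {N : ℕ} {T T' : Finset (Fin N)} (h : T' ⊆ T) (z : Fin N → ℂ) : pj T (pj T' z) = pj T' z := by
  ext i
  rw [pj_apply, pj_apply]
  split_ifs with h1 h2 h3
  · rfl
  · rfl
  · exact absurd (h h3) h1
  · rfl

lemma n1_pj {N : ℕ} (T : Finset (Fin N)) (z : Fin N → ℂ) : n1 (pj T z) ≤ n1 z := by
  refine Finset.sum_le_sum fun i _ => ?_
  rw [pj_apply]; split_ifs <;> simp

lemma nz_pj {N : ℕ} (T : Finset (Fin N)) (z : Fin N → ℂ) : nz (pj T z) ≤ nz z := by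
  refine Finset.card_le_card fun i => ?_
  simp only [Finset.mem_filter, Finset.mem_univ, true_and, pj_apply]
  split_ifs <;> simp

lemma pj_hasFDerivAt {N : ℕ} (T : Finset (Fin N)) (z : Fin N → ℂ) :
    HasFDerivAt (fun w => pj T w) ((pj T).restrictScalars ℝ) z :=
  ((pj T).restrictScalars ℝ).hasFDerivAt

lemma dbar_zero_vec {V : Type*} [NormedAddCommGroup V] [NormedSpace ℂ V] (u : V → ℂ) (z : V) :
    dbar u z 0 = 0 := by simp [dbar]

lemma dbar_pj {N : ℕ} (T : Finset (Fin N)) {u : (Fin N → ℂ) → ℂ} {z : Fin N → ℂ}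
    (hu : DifferentiableAt ℝ u (pj T z)) (j : Fin N) :
    dbar (fun w => u (pj T w)) z (ee j) = if j ∈ T then dbar u (pj T z) (ee j) else 0 := by
  rw [dbar_comp hu (pj_hasFDerivAt T z), pj_ee]
  split_ifs
  · rfl
  · exact dbar_zero_vec _ _

lemma cd_pj {N : ℕ} (T : Finset (Fin N)) {u : (Fin N → ℂ) → ℂ} {r : ℝ}
    (hu : ContDiffOn ℝ 1 u {z | n1 z < r}) : ContDiffOn ℝ 1 (fun w => u (pj T w)) {z | n1 z < r} :=
  hu.comp (f := fun w => pj T w) (((pj T).restrictScalars ℝ).contDiff.contDiffOn)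
    fun z hz => (n1_pj T z).trans_lt hz

lemma da_of_cd {N : ℕ} {u : (Fin N → ℂ) → ℂ} {r : ℝ}
    (hu : ContDiffOn ℝ 1 u {z | n1 z < r}) {z : Fin N → ℂ} (hz : n1 z < r) : DifferentiableAt ℝ u z :=
  (hu.differentiableOn (by simp)).differentiableAt ((isOpen_n1 r).mem_nhds hz)

lemma thmC (ρ1 : ℝ) (h0 : 0 < ρ1) (h1 : ρ1 < 1) : ∃ Q : ℝ, 1 ≤ Q ∧ ∀ (N : ℕ) (M : ℝ)
    (f : Fin N → (Fin N → ℂ) → ℂ), 0 ≤ M → FormB M f →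
    ∃ U : (Fin N → ℂ) → ℂ, ContDiffOn ℝ 1 U {z | n1 z < ρ1} ∧
      (∀ z, n1 z < ρ1 → ∀ j, dbar U z (ee j) = f j z) ∧
      ∀ z, n1 z < ρ1 → ‖U z‖ ≤ Q ^ (1 + nz z) * M := by
  obtain ⟨C, hC, H⟩ := thmB ρ1 h0 h1
  refine ⟨4 * C ^ 2, by nlinarith, fun N M f hM hf => ?_⟩
  set fT : Finset (Fin N) → Fin N → (Fin N → ℂ) → ℂ := fun T j z => if j ∈ T then f j (pj T z) else 0 with hfT
  have hfin : ∀ T j, j ∈ T → fT T j = fun z => f j (pj T z) := fun T j h => by ext z; simp [hfT, h]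
  have hfout : ∀ T j, j ∉ T → fT T j = fun z => 0 := fun T j h => by ext z; simp [hfT, h]
  have hform : ∀ T, FormB M (fT T) := by
    intro T
    refine ⟨fun j => ?_, fun z hz i j => ?_, fun z hz j => ?_⟩
    · by_cases h : j ∈ T
      · rw [hfin T j h]; exact cd_pj T (hf.cd j)
      · rw [hfout T j h]; exact contDiffOn_const
    · have hz' : n1 (pj T z) < 1 := (n1_pj T z).trans_lt hz
      by_cases hi : i ∈ T <;> by_cases hj : j ∈ T
      · rw [hfin T i hi, hfin T j hj, dbar_pj T (da_of_cd (hf.cd i) hz'), dbar_pj T (da_of_cd (hf.cd j) hz'),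
          if_pos hi, if_pos hj]
        exact hf.closed _ hz' i j
      · rw [hfin T i hi, hfout T j hj, dbar_pj T (da_of_cd (hf.cd i) hz'), if_neg hj, dbar_const]
      · rw [hfout T i hi, hfin T j hj, dbar_pj T (da_of_cd (hf.cd j) hz'), if_neg hi, dbar_const]
      · rw [hfout T i hi, hfout T j hj, dbar_const, dbar_const]
    · by_cases h : j ∈ T
      · rw [hfin T j h]; exact hf.bd _ ((n1_pj T z).trans_lt hz) j
      · rw [hfout T j h]; simpa using hM
  have hv := fun T => H N T M (fT T) hM (hform T) (fun j hj z _ => by rw [hfout T j hj])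
  choose v hv1 hv2 hv3 using hv
  have hda : ∀ T T' z, n1 z < ρ1 → DifferentiableAt ℝ (fun w => v T (pj T' w)) z := fun T T' z hz =>
    da_of_cd (cd_pj T' (hv1 T)) hz
  have hdb : ∀ T T', T' ⊆ T → ∀ z, n1 z < ρ1 → ∀ j,
      dbar (fun w => v T (pj T' w)) z (ee j) = if j ∈ T' then f j (pj T' z) else 0 := by
    intro T T' hT z hz j
    have hz' : n1 (pj T' z) < ρ1 := (n1_pj T' z).trans_lt hz
    rw [dbar_pj T' (da_of_cd (hv1 T) hz')]
    split_ifs with h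
    · rw [hv2 T _ hz' j]
      simp [hfT, hT h, pj_pj hT]
    · rfl
  refine ⟨fun z => ∑ T ∈ (Finset.univ : Finset (Fin N)).powerset, ∑ T' ∈ T.powerset,
    (-1 : ℂ) ^ (T.card + T'.card) * v T (pj T' z), ?_, ?_, ?_⟩
  · refine ContDiffOn.sum fun T _ => ContDiffOn.sum fun T' _ => ?_
    exact contDiffOn_const.mul (cd_pj T' (hv1 T))
  · intro z hz j
    rw [dbar_sum _ (fun T _ => DifferentiableAt.fun_sum fun T' _ => (hda T T' z hz).const_mul _)]
    have : ∀ T ∈ (Finset.univ : Finset (Fin N)).powerset, dbar (fun z => ∑ T' ∈ T.powerset,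
        (-1 : ℂ) ^ (T.card + T'.card) * v T (pj T' z)) z (ee j) =
        ∑ T' ∈ T.powerset, (-1 : ℂ) ^ (T.card + T'.card) * (if j ∈ T' then f j (pj T' z) else 0) := by
      intro T _
      rw [dbar_sum _ (fun T' _ => (hda T T' z hz).const_mul _)]
      refine Finset.sum_congr rfl fun T' hT' => ?_
      rw [dbar_const_mul _ (hda T T' z hz), hdb T T' (Finset.mem_powerset.1 hT') z hz j]
    rw [Finset.sum_congr rfl this, moebius _ (fun T' => if j ∈ T' then f j (pj T' z) else 0)]
    simp [pj_univ]
  · intro z hz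
    set S : Finset (Fin N) := Finset.univ.filter fun i => z i ≠ 0 with hS
    have hcard : S.card = nz z := rfl
    have hred : ∑ T ∈ (Finset.univ : Finset (Fin N)).powerset, ∑ T' ∈ T.powerset,
        (-1 : ℂ) ^ (T.card + T'.card) * v T (pj T' z) = ∑ T ∈ S.powerset, ∑ T' ∈ T.powerset,
        (-1 : ℂ) ^ (T.card + T'.card) * v T (pj T' z) := by
      symm
      refine Finset.sum_subset (Finset.powerset_mono.2 (Finset.subset_univ S)) fun T _ hT => ?_
      obtain ⟨a, haT, haS⟩ := Finset.not_subset.1 (fun h => hT (Finset.mem_powerset.2 h))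
      have hza : z a = 0 := by by_contra h; exact haS (by simp [hS, h])
      refine moebius_cancel haT (fun T' => v T (pj T' z)) fun T' => ?_
      have : pj (insert a T') z = pj T' z := by
        ext i
        rw [pj_apply, pj_apply]
        by_cases hi : i = a
        · subst hi; simp [hza]
        · simp [Finset.mem_insert, hi]
      simp only [this]
    beta_reduce
    rw [hred]
    have hb : ∀ T ∈ S.powerset, ‖∑ T' ∈ T.powerset, (-1 : ℂ) ^ (T.card + T'.card) * v T (pj T' z)‖
        ≤ 2 ^ nz z * (C ^ (1 + 2 * nz z) * M) := by
      intro T hT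
      have hTc : T.card ≤ nz z := by rw [← hcard]; exact Finset.card_le_card (Finset.mem_powerset.1 hT)
      have : ∀ T' ∈ T.powerset, ‖(-1 : ℂ) ^ (T.card + T'.card) * v T (pj T' z)‖ ≤ C ^ (1 + 2 * nz z) * M := by
        intro T' _
        rw [norm_mul, norm_pow, norm_neg, norm_one, one_pow, one_mul]
        refine (hv3 T _ ((n1_pj T' z).trans_lt hz)).trans ?_
        refine mul_le_mul_of_nonneg_right (pow_le_pow_right₀ hC ?_) hM
        have := nz_pj T' z
        omega
      refine (norm_sum_le_of_le _ this).trans ?_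
      rw [Finset.sum_const, Finset.card_powerset, nsmul_eq_mul]
      push_cast
      refine mul_le_mul_of_nonneg_right (pow_le_pow_right₀ (by norm_num) hTc) (by positivity)
    refine (norm_sum_le_of_le _ hb).trans ?_
    rw [Finset.sum_const, Finset.card_powerset, nsmul_eq_mul, hcard]
    push_cast
    have e : (2:ℝ) ^ nz z * (2 ^ nz z * (C ^ (1 + 2 * nz z) * M)) = C * ((4 * C ^ 2) ^ nz z * M) := by
      rw [mul_pow, ← pow_mul, show (4:ℝ) = 2 * 2 by norm_num, mul_pow, pow_add, pow_one]; ring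
    rw [e, pow_add, pow_one, mul_assoc]
    refine mul_le_mul_of_nonneg_right (by nlinarith) (by positivity)

open Set
open scoped ENNReal NNReal
noncomputable section
set_option linter.unusedSectionVars false
set_option linter.unusedSimpArgs false
open MeasureTheory Filter Topology

structure SolD {N : ℕ} (ρ A : ℝ) (f : Fin N → (Fin N → ℂ) → ℂ) (U : (Fin N → ℂ) → ℂ) : Prop where
  cdU : ContDiffOn ℝ 1 U {z | n1 z < ρ}
  cdf : ∀ j, ContDiffOn ℝ 1 (f j) {z | n1 z < ρ}
  db : ∀ z, n1 z < ρ → ∀ j, dbar U z (ee j) = f j z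
  bd : ∀ z, n1 z < ρ → ∀ j, ‖f j z‖ ≤ A
  lip : ∀ z w, n1 z < ρ → n1 w < ρ → ∀ j, ‖f j z - f j w‖ ≤ A * n1 (z - w)

lemma n1_nonneg {N : ℕ} (z : Fin N → ℂ) : 0 ≤ n1 z := Finset.sum_nonneg fun _ _ => norm_nonneg _

lemma n1_add_le {N : ℕ} (z w : Fin N → ℂ) : n1 (z + w) ≤ n1 z + n1 w := by
  unfold n1
  rw [← Finset.sum_add_distrib]
  exact Finset.sum_le_sum fun i _ => norm_add_le _ _

lemma n1_smul {N : ℕ} (a : ℂ) (z : Fin N → ℂ) : n1 (a • z) = ‖a‖ * n1 z := by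
  unfold n1
  rw [Finset.mul_sum]
  exact Finset.sum_congr rfl fun i _ => by simp

lemma n1_ee {N : ℕ} (i : Fin N) : n1 (ee i) = 1 := by
  unfold n1
  rw [Finset.sum_eq_single i]
  · simp
  · intro b _ hb; simp [hb]
  · simp

lemma n1_slice {N : ℕ} {r ρ : ℝ} {p ξ : Fin N → ℂ} (hξ : n1 ξ ≤ 1) (hp : n1 p + r ≤ ρ) {ζ : ℂ}
    (hζ : ‖ζ‖ < r) : n1 (p + ζ • ξ) < ρ := by
  have h1 := n1_add_le p (ζ • ξ)
  rw [n1_smul] at h1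
  have : ‖ζ‖ * n1 ξ ≤ ‖ζ‖ := mul_le_of_le_one_right (norm_nonneg _) hξ
  linarith

theorem sliceD : ∃ C : ℝ, 1 ≤ C ∧ ∀ (N : ℕ) (ρ A : ℝ) (f : Fin N → (Fin N → ℂ) → ℂ)
    (U : (Fin N → ℂ) → ℂ), 0 ≤ A → SolD ρ A f U → ∀ (p ξ : Fin N → ℂ) (r S : ℝ), 0 < r → 0 ≤ S →
    n1 ξ ≤ 1 → n1 p + r ≤ ρ → (∀ ζ : ℂ, ‖ζ‖ < r → ‖U (p + ζ • ξ)‖ ≤ S) → ∀ y : ℂ, ‖y‖ ≤ r / 4 →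
    ‖U (p + y • ξ) - U p‖ ≤ C * ‖y‖ * (S / r + A + r * A) := by
  obtain ⟨C, hC, H⟩ := oneD
  refine ⟨C, hC, fun N ρ A f U hA h p ξ r S hr hS hξ hp hb y hy => ?_⟩
  have hL : ∀ ζ : ℂ, HasFDerivAt (fun ζ : ℂ => p + ζ • ξ)
      (((ContinuousLinearMap.id ℂ ℂ).smulRight ξ).restrictScalars ℝ) ζ := by
    intro ζ
    have : HasFDerivAt (𝕜 := ℂ) (fun ζ : ℂ => p + ζ • ξ) ((ContinuousLinearMap.id ℂ ℂ).smulRight ξ) ζ :=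
      ((hasFDerivAt_id ζ).smul_const ξ).const_add p
    exact this.restrictScalars ℝ
  have hcd : ContDiffOn ℝ 1 (fun ζ : ℂ => p + ζ • ξ) (Metric.ball 0 r) := by
    apply ContDiff.contDiffOn
    fun_prop
  have hmaps : MapsTo (fun ζ : ℂ => p + ζ • ξ) (Metric.ball 0 r) {z | n1 z < ρ} := by
    intro ζ hζ
    exact n1_slice hξ hp (by simpa using hζ)
  have hsum : ∀ (v : Fin N → ℂ) (B : ℝ), 0 ≤ B → (∀ j, ‖v j‖ ≤ B) →
      ‖∑ j, (starRingEnd ℂ) (ξ j) * v j‖ ≤ B := by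
    intro v B hB hv
    calc ‖∑ j, (starRingEnd ℂ) (ξ j) * v j‖ ≤ ∑ j, ‖(starRingEnd ℂ) (ξ j) * v j‖ := norm_sum_le _ _
      _ ≤ ∑ j, ‖ξ j‖ * B := Finset.sum_le_sum fun j _ => by
          rw [norm_mul, RCLike.norm_conj]
          exact mul_le_mul_of_nonneg_left (hv j) (norm_nonneg _)
      _ = n1 ξ * B := by rw [← Finset.sum_mul]; rfl
      _ ≤ B := mul_le_of_le_one_left hB hξ
  have key := H r (fun ζ => U (p + ζ • ξ)) (fun ζ => ∑ j, (starRingEnd ℂ) (ξ j) * f j (p + ζ • ξ))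
    S A A hr hS hA hA (h.cdU.comp hcd hmaps) ?_ ?_ ?_ hb ?_ y hy
  · simpa using key
  · refine ContDiffOn.sum fun j _ => contDiffOn_const.mul ((h.cdf j).comp hcd hmaps)
  · intro ζ hζ
    have hz : n1 (p + ζ • ξ) < ρ := n1_slice hξ hp hζ
    rw [dbar_comp (u := U) (L := fun ζ : ℂ => p + ζ • ξ) (da_of_cd h.cdU hz) (hL ζ), dbar_eq_sum]
    refine Finset.sum_congr rfl fun j _ => ?_
    rw [h.db _ hz j]
    simp
  · intro ζ hζ
    exact hsum (fun j => f j (p + ζ • ξ)) A hA fun j => h.bd _ (n1_slice hξ hp hζ) j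
  · intro x y hx hy
    rw [← Finset.sum_sub_distrib]
    simp only [← mul_sub]
    refine hsum (fun j => f j (p + x • ξ) - f j (p + y • ξ)) _ (by positivity) fun j => ?_
    refine (h.lip _ _ (n1_slice hξ hp hx) (n1_slice hξ hp hy) j).trans ?_
    have : (p + x • ξ) - (p + y • ξ) = (x - y) • ξ := by rw [sub_smul]; abel
    rw [this, n1_smul]
    exact mul_le_mul_of_nonneg_left (mul_le_of_le_one_right (norm_nonneg _) hξ) hA

lemma nz_add_ee {N : ℕ} (w : Fin N → ℂ) (ζ : ℂ) (i : Fin N) : nz (w + ζ • ee i) ≤ nz w + 1 := by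
  unfold nz
  have : (Finset.univ.filter fun j => (w + ζ • ee i) j ≠ 0) ⊆
      insert i (Finset.univ.filter fun j => w j ≠ 0) := by
    intro j hj
    by_cases hji : j = i
    · simp [hji]
    · simp [hji] at hj ⊢
      exact hj
  exact (Finset.card_le_card this).trans (Finset.card_insert_le _ _)

theorem treeD : ∃ C : ℝ, 1 ≤ C ∧ ∀ (Q : ℝ), 1 ≤ Q → ∀ κ : ℝ, 8 ≤ κ → C * (4 * Q + 2) ≤ κ →
    ∀ (N : ℕ) (ρ A : ℝ) (f : Fin N → (Fin N → ℂ) → ℂ) (U : (Fin N → ℂ) → ℂ), 0 ≤ A → SolD ρ A f U →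
    (∀ z, n1 z < ρ → ‖U z‖ ≤ A * Q ^ nz z) → ∀ (J : Finset (Fin N)) (w y : Fin N → ℂ) (b : ℝ),
    (∀ i ∈ J, w i = 0) → (∀ i ∉ J, y i = 0) → 0 < b → b ≤ 1 → n1 w + b ≤ ρ → κ * n1 y < b →
    ‖U (w + y)‖ ≤ A * Q ^ nz w * (b / (b - κ * n1 y)) := by
  obtain ⟨C, hC, H⟩ := sliceD
  refine ⟨C, hC, fun Q hQ κ hκ8 hκ N ρ A f U hA h hU J => ?_⟩
  induction J using Finset.induction_on with
  | empty =>
    intro w y b _ hy hb _ hwb _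
    have : y = 0 := by ext i; exact hy i (by simp)
    subst this
    have h0 : n1 (0 : Fin N → ℂ) = 0 := by simp [n1]
    rw [h0, mul_zero, sub_zero, div_self hb.ne', mul_one, add_zero]
    exact hU w (by linarith)
  | insert i J hiJ IH =>
    intro w y b hw hy hb hb1 hwb hyb
    set y' : Fin N → ℂ := Function.update y i 0 with hy'
    have hyd : y = y' + y i • ee i := by
      ext j
      by_cases hj : j = i
      · subst hj; simp [hy']
      · simp [hy', hj]
    have hn : n1 y = n1 y' + ‖y i‖ := by
      unfold n1
      rw [← Finset.add_sum_erase _ _ (Finset.mem_univ i),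
        ← Finset.add_sum_erase _ (fun j => ‖y' j‖) (Finset.mem_univ i)]
      have : ∑ j ∈ Finset.univ.erase i, ‖y j‖ = ∑ j ∈ Finset.univ.erase i, ‖y' j‖ :=
        Finset.sum_congr rfl fun j hj => by simp [hy', Finset.ne_of_mem_erase hj]
      rw [this]
      simp [hy']
      ring
    have ht' := n1_nonneg y'
    have hyi := norm_nonneg (y i)
    set t' := n1 y' with ht'd
    set s := ‖y i‖ with hs
    have hκ0 : 0 < κ := by linarith
    set σ := b - κ * t' with hσ
    have hκs : κ * s < σ := by rw [hn, mul_add] at hyb; linarith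
    have hκs0 : 0 ≤ κ * s := by positivity
    have hσ0 : 0 < σ := by linarith
    have hκt0 : 0 ≤ κ * t' := by positivity
    have hσb : σ ≤ b := by linarith
    have hy'J : ∀ j ∉ J, y' j = 0 := by
      intro j hj
      by_cases hji : j = i
      · subst hji; simp [hy']
      · simp [hy', hji]; exact hy j (by simp [hji, hj])
    have hb' : b - κ * t' = σ := rfl
    have h1 := IH w y' b (fun j hj => hw j (Finset.mem_insert_of_mem hj)) hy'J hb hb1 hwb (by linarith)
    rw [← ht'd, hb'] at h1
    have hQ0 : 0 < Q := by linarith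
    have hS : ∀ ζ : ℂ, ‖ζ‖ < σ / 2 → ‖U (w + y' + ζ • ee i)‖ ≤ A * Q ^ (nz w + 1) * (2 * b / σ) := by
      intro ζ hζ
      have h2 := IH (w + ζ • ee i) y' (b - σ / 2) ?_ hy'J (by linarith) (by linarith) ?_ (by linarith)
      · rw [show w + y' + ζ • ee i = w + ζ • ee i + y' by abel]
        refine h2.trans ?_
        have e1 : b - σ / 2 - κ * t' = σ / 2 := by rw [hσ]; ring
        rw [← ht'd, e1]
        have e2 : (b - σ / 2) / (σ / 2) ≤ 2 * b / σ := by
          rw [div_le_div_iff₀ (by positivity) hσ0]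
          nlinarith
        have e3 : Q ^ nz (w + ζ • ee i) ≤ Q ^ (nz w + 1) := pow_le_pow_right₀ hQ (nz_add_ee w ζ i)
        have e4 : 0 ≤ (b - σ / 2) / (σ / 2) := div_nonneg (by linarith) (by linarith)
        exact mul_le_mul (mul_le_mul_of_nonneg_left e3 hA) e2 e4 (by positivity)
      · intro j hj
        have hji : j ≠ i := fun h => hiJ (h ▸ hj)
        simp [hji, hw j (Finset.mem_insert_of_mem hj)]
      · have := n1_add_le w (ζ • ee i)
        rw [n1_smul, n1_ee] at this
        linarith
    have hp : n1 (w + y') + σ / 2 ≤ ρ := by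
      have := n1_add_le w y'
      have : t' ≤ κ * t' := le_mul_of_one_le_left ht' (by linarith)
      have : n1 y' = t' := rfl
      linarith
    have h3 := H N ρ A f U hA h (w + y') (ee i) (σ / 2) (A * Q ^ (nz w + 1) * (2 * b / σ)) (by positivity)
      (by positivity) (n1_ee i).le hp hS (y i) (by
        have : 8 * s ≤ κ * s := mul_le_mul_of_nonneg_right hκ8 hyi
        linarith)
    have hwy : w + y = w + y' + y i • ee i := by rw [add_assoc, ← hyd]
    rw [hwy]
    have h4 : ‖U (w + y' + y i • ee i)‖ ≤ ‖U (w + y')‖ + ‖U (w + y' + y i • ee i) - U (w + y')‖ := by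
      simpa using norm_add_le (U (w + y')) (U (w + y' + y i • ee i) - U (w + y'))
    refine h4.trans ((add_le_add h1 h3).trans ?_)
    have e5 : b - κ * n1 y = σ - κ * s := by rw [hn, hσ]; ring
    rw [e5]
    set q := Q ^ nz w with hq
    have hq1 : 1 ≤ q := one_le_pow₀ hQ
    have e6 : A * Q ^ (nz w + 1) * (2 * b / σ) / (σ / 2) + A + σ / 2 * A ≤
        A * q * (4 * Q + 2) * (b / σ ^ 2) := by
      have a1 : A * Q ^ (nz w + 1) * (2 * b / σ) / (σ / 2) = A * q * (4 * Q) * (b / σ ^ 2) := by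
        rw [pow_succ]; field_simp; ring
      have a2 : 1 ≤ b / σ ^ 2 := by
        rw [le_div_iff₀ (by positivity)]; nlinarith
      have a3 : 1 ≤ q * (b / σ ^ 2) := one_le_mul_of_one_le_of_one_le hq1 a2
      have a4 : A + σ / 2 * A ≤ 2 * A := by nlinarith
      have a5 : 2 * A ≤ 2 * A * (q * (b / σ ^ 2)) := le_mul_of_one_le_right (by positivity) a3
      rw [a1]
      nlinarith
    have e7 : C * s * (A * Q ^ (nz w + 1) * (2 * b / σ) / (σ / 2) + A + σ / 2 * A) ≤
        A * q * (b * (κ * s / σ ^ 2)) := by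
      calc _ ≤ C * s * (A * q * (4 * Q + 2) * (b / σ ^ 2)) :=
            mul_le_mul_of_nonneg_left e6 (by positivity)
        _ = (C * (4 * Q + 2)) * (s * A * q * (b / σ ^ 2)) := by ring
        _ ≤ κ * (s * A * q * (b / σ ^ 2)) := mul_le_mul_of_nonneg_right hκ (by positivity)
        _ = _ := by ring
    refine (add_le_add_right e7 _).trans ?_
    rw [← mul_add]
    refine mul_le_mul_of_nonneg_left ?_ (by positivity)
    set x := κ * s with hx
    have hpos : 0 < σ - x := by linarith
    have e8 : b / σ + b * (x / σ ^ 2) = b * ((σ + x) / σ ^ 2) := by field_simp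
    rw [e8, div_eq_mul_inv b (σ - x)]
    refine mul_le_mul_of_nonneg_left ?_ hb.le
    rw [← one_div, div_le_div_iff₀ (by positivity) hpos]
    have e9 : (σ + x) * (σ - x) = σ ^ 2 - x ^ 2 := by ring
    rw [e9]
    linarith [sq_nonneg x]

theorem treeD2 (Q : ℝ) (hQ : 1 ≤ Q) : ∃ κ : ℝ, 8 ≤ κ ∧
    ∀ (N : ℕ) (ρ A : ℝ) (f : Fin N → (Fin N → ℂ) → ℂ) (U : (Fin N → ℂ) → ℂ), 0 ≤ A → SolD ρ A f U →
    (∀ z, n1 z < ρ → ‖U z‖ ≤ A * Q ^ nz z) → ∀ (v w : Fin N → ℂ) (b : ℝ),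
    0 < b → b ≤ 1 → n1 v + b ≤ ρ → κ * n1 (v - w) ≤ b / 2 →
    ‖U v‖ ≤ 2 * A * Q ^ nz w := by
  obtain ⟨C, hC, H⟩ := treeD
  refine ⟨max 8 (C * (4 * Q + 2)), le_max_left _ _, fun N ρ A f U hA h hU v w b hb hb1 hv hvw => ?_⟩
  set κ := max 8 (C * (4 * Q + 2)) with hκ
  have hκ0 : 0 ≤ κ := le_trans (by norm_num) (le_max_left _ _)
  classical
  set w' : Fin N → ℂ := fun i => if w i = 0 then 0 else v i with hw'
  set y : Fin N → ℂ := fun i => if w i = 0 then v i else 0 with hy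
  have hvd : v = w' + y := by
    ext i
    by_cases hi : w i = 0 <;> simp [hw', hy, hi]
  have h1 : n1 w' ≤ n1 v := Finset.sum_le_sum fun i _ => by
    by_cases hi : w i = 0 <;> simp [hw', hi]
  have h2 : n1 y ≤ n1 (v - w) := Finset.sum_le_sum fun i _ => by
    by_cases hi : w i = 0 <;> simp [hy, hi]
  have h3 : nz w' ≤ nz w := Finset.card_le_card fun i => by
    by_cases hi : w i = 0 <;> simp [hw', hi]
  have h4 : κ * n1 y ≤ b / 2 := (mul_le_mul_of_nonneg_left h2 hκ0).trans hvw
  have h5 := H Q hQ κ (le_max_left _ _) (le_max_right _ _) N ρ A f U hA h hU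
    (Finset.univ.filter fun i => w i = 0) w' y b (fun i hi => by simp at hi; simp [hw', hi])
    (fun i hi => by simp at hi; simp [hy, hi]) hb hb1 (by linarith) (by linarith)
  rw [← hvd] at h5
  refine h5.trans ?_
  have h6 : b / (b - κ * n1 y) ≤ 2 := by
    rw [div_le_iff₀ (by linarith)]; linarith
  have h7 : Q ^ nz w' ≤ Q ^ nz w := pow_le_pow_right₀ hQ h3
  have h8 : 0 ≤ b / (b - κ * n1 y) := div_nonneg hb.le (by linarith)
  calc _ ≤ A * Q ^ nz w * 2 := mul_le_mul (mul_le_mul_of_nonneg_left h7 hA) h6 h8 (by positivity)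
    _ = _ := by ring

open Set
open scoped ENNReal NNReal
noncomputable section
set_option linter.unusedSectionVars false
set_option linter.unusedSimpArgs false
open MeasureTheory Filter Topology

lemma greedy {ι : Type*} [DecidableEq ι] (x : ι → ℝ) (hx : ∀ i, 0 ≤ x i) (τ : ℝ) (hτ : 0 < τ)
    (S : Finset ι) : ∃ (g : ℕ) (col : ι → ℕ) (B : Finset ι), B.card ≤ g ∧
      (∀ j < g, τ ≤ ∑ i ∈ S with col i = j, x i) ∧ ∑ i ∈ S \ B, x i ≤ τ * (g + 1) := by
  induction S using Finset.strongInduction with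
  | H S IH =>
    by_cases hS : ∑ i ∈ S, x i < τ
    · exact ⟨0, fun _ => 0, ∅, by simp, by simp, by simpa using hS.le⟩
    push Not at hS
    obtain ⟨G, hG⟩ := Finset.exists_minimal (s := S.powerset.filter fun G => τ ≤ ∑ i ∈ G, x i)
      ⟨S, by simp [hS]⟩
    have hGm := hG.1
    simp only [Finset.mem_filter, Finset.mem_powerset] at hGm
    obtain ⟨hGS, hGτ⟩ := hGm
    have hne : G.Nonempty := by
      by_contra h
      rw [Finset.not_nonempty_iff_eq_empty] at h
      subst h
      simp at hGτ
      linarith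
    obtain ⟨a, ha⟩ := hne
    have hmin : ∑ i ∈ G.erase a, x i < τ := by
      by_contra h
      push Not at h
      have := hG.2 (y := G.erase a) (by simp [h]; exact (Finset.erase_subset _ _).trans hGS)
        (Finset.erase_subset _ _)
      exact absurd (this ha) (by simp)
    obtain ⟨g, col, B, h1, h2, h3⟩ := IH (S \ G) (Finset.sdiff_ssubset hGS ⟨a, ha⟩)
    refine ⟨g + 1, fun i => if i ∈ G then g else col i, insert a B,
      (Finset.card_insert_le _ _).trans (by omega), ?_, ?_⟩
    · intro j hj
      rcases Nat.lt_succ_iff_lt_or_eq.1 hj with h | h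
      · refine (h2 j h).trans (Finset.sum_le_sum_of_subset_of_nonneg ?_ fun i _ _ => hx i)
        intro i hi
        simp only [Finset.mem_filter, Finset.mem_sdiff] at hi ⊢
        simp [hi]
      · refine hGτ.trans (Finset.sum_le_sum_of_subset_of_nonneg ?_ fun i _ _ => hx i)
        intro i hi
        simp [hi, hGS hi, h]
    · have hsub : S \ insert a B ⊆ G.erase a ∪ ((S \ G) \ B) := by
        intro i hi
        simp only [Finset.mem_sdiff, Finset.mem_insert, Finset.mem_union, Finset.mem_erase] at hi ⊢
        tauto
      calc _ ≤ ∑ i ∈ G.erase a ∪ ((S \ G) \ B), x i :=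
            Finset.sum_le_sum_of_subset_of_nonneg hsub fun i _ _ => hx i
        _ ≤ ∑ i ∈ G.erase a, x i + ∑ i ∈ (S \ G) \ B, x i := by
            rw [← Finset.sum_union_inter]
            exact le_add_of_nonneg_right (Finset.sum_nonneg fun i _ => hx i)
        _ ≤ τ * ((g + 1 : ℕ) + 1) := by push_cast; nlinarith

lemma comb {N : ℕ} (x : Fin N → ℝ) (hx : ∀ i, 0 ≤ x i) (c : ℝ) (hc : 0 < c) :
    ∃ (m : ℕ) (col : Fin N → ℕ) (B : Finset (Fin N)), B.card ≤ m ∧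
      ∑ i ∈ Finset.univ \ B, x i ≤ c ∧ ∀ j < m, c / m ≤ ∑ i with col i = j, x i := by
  classical
  let P : ℕ → Prop := fun m => ∃ col : Fin N → ℕ, ∀ j < m, c / m ≤ ∑ i with col i = j, x i
  have hex : ∃ m, ¬ P (m + 1) := by
    refine ⟨N, fun ⟨col, h⟩ => ?_⟩
    have hsub : Finset.range (N + 1) ⊆ Finset.univ.image col := by
      intro j hj
      have h1 := h j (Finset.mem_range.1 hj)
      by_contra hj2
      have : (Finset.univ.filter fun i => col i = j) = ∅ := by
        ext i
        simp at hj2 ⊢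
        exact hj2 i
      rw [this, Finset.sum_empty] at h1
      have : 0 < c / ((N + 1 : ℕ) : ℝ) := by positivity
      linarith
    have := (Finset.card_le_card hsub).trans Finset.card_image_le
    simp at this
  have hn := Nat.find_spec hex
  have hP : P (Nat.find hex) := by
    rcases Nat.eq_zero_or_pos (Nat.find hex) with h | h
    · rw [h]; exact ⟨fun _ => 0, by simp⟩
    · have := Nat.find_min hex (m := Nat.find hex - 1) (by omega)
      rw [not_not, Nat.sub_add_cancel h] at this
      exact this
  set m := Nat.find hex
  obtain ⟨col, hcol⟩ := hP
  obtain ⟨g, col', B, h1, h2, h3⟩ := greedy x hx (c / ((m + 1 : ℕ) : ℝ)) (by positivity) Finset.univ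
  have hgm : g ≤ m := by
    by_contra h
    exact hn ⟨col', fun j hj => h2 j (by omega)⟩
  refine ⟨m, col, B, h1.trans hgm, h3.trans ?_, hcol⟩
  have : (g : ℝ) + 1 ≤ ((m + 1 : ℕ) : ℝ) := by exact_mod_cast Nat.succ_le_succ hgm
  rw [div_mul_eq_mul_div, div_le_iff₀ (by positivity)]
  exact mul_le_mul_of_nonneg_left this hc.le

lemma prod_am {m : ℕ} (a : ℕ → ℝ) (ha : ∀ j, 0 ≤ a j) (h : ∑ j ∈ Finset.range m, a j ≤ 1) :
    ∏ j ∈ Finset.range m, (m * a j) ≤ 1 := by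
  calc ∏ j ∈ Finset.range m, (m * a j) ≤ ∏ j ∈ Finset.range m, Real.exp (m * a j - 1) := by
        refine Finset.prod_le_prod (fun j _ => mul_nonneg (by positivity) (ha j)) fun j _ => ?_
        linarith [Real.add_one_le_exp (m * a j - 1)]
    _ = Real.exp (m * ∑ j ∈ Finset.range m, a j - m) := by
        rw [← Real.exp_sum]; congr 1
        rw [Finset.sum_sub_distrib, Finset.mul_sum]; simp
    _ ≤ 1 := by
        rw [Real.exp_le_one_iff]
        nlinarith [(Nat.cast_nonneg m : (0:ℝ) ≤ m)]

lemma card_cover {N : ℕ} (z : Fin N → ℂ) (col : Fin N → ℕ) (T : Finset ℕ)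
    (h : ∀ j ∈ T, ∃ i, z i ≠ 0 ∧ col i = j) : T.card ≤ nz z := by
  classical
  have : T ⊆ (Finset.univ.filter fun i => z i ≠ 0).image col := by
    intro j hj
    obtain ⟨i, h1, h2⟩ := h j hj
    exact Finset.mem_image.2 ⟨i, by simp [h1], h2⟩
  exact (Finset.card_le_card this).trans Finset.card_image_le

lemma sum_groups {N : ℕ} (x : Fin N → ℝ) (hx : ∀ i, 0 ≤ x i) (col : Fin N → ℕ) (T : Finset ℕ) :
    ∑ j ∈ T, ∑ i with col i = j, x i ≤ ∑ i, x i := by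
  rw [Finset.sum_fiberwise_eq_sum_filter]
  exact Finset.sum_le_sum_of_subset_of_nonneg (Finset.filter_subset _ _) fun i _ _ => hx i

lemma pExists {N : ℕ} (Z : Fin N → ℂ) (m : ℕ) (col : Fin N → ℕ) (c : ℝ) (hc : 0 < c)
    (h : ∀ j < m, c / m ≤ ∑ i with col i = j, ‖Z i‖) :
    ∃ p : (Fin N → ℂ) → ℂ, ContDiff ℝ 1 p ∧ (∀ z, DifferentiableAt ℂ p z) ∧ p Z = 1 ∧
      (∀ z, n1 z ≤ 1 → ‖p z‖ ≤ (1 / c) ^ m) ∧ ∀ z, nz z < m → p z = 0 := by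
  classical
  have hm : ∀ j < m, (0:ℝ) < m := fun j hj => by exact_mod_cast (by omega : 0 < m)
  have hs : ∀ j < m, 0 < ∑ i with col i = j, ‖Z i‖ := fun j hj =>
    lt_of_lt_of_le (div_pos hc (hm j hj)) (h j hj)
  refine ⟨fun z => ∏ j ∈ Finset.range m, ((∑ i with col i = j, (starRingEnd ℂ (Z i) / ‖Z i‖) * z i) *
    ((∑ i with col i = j, ‖Z i‖ : ℝ) : ℂ)⁻¹), ?_, ?_, ?_, ?_, ?_⟩
  · refine contDiff_prod fun j _ => ContDiff.mul (ContDiff.sum fun i _ => contDiff_const.mul ?_) contDiff_const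
    fun_prop
  · refine ContDiff.differentiable (n := 1) (contDiff_prod fun j _ =>
      ContDiff.mul (ContDiff.sum fun i _ => contDiff_const.mul ?_) contDiff_const) (by norm_num)
    fun_prop
  · refine Finset.prod_eq_one fun j hj => ?_
    have h0 := hs j (Finset.mem_range.1 hj)
    have : ∑ i with col i = j, (starRingEnd ℂ (Z i) / ‖Z i‖) * Z i =
        ((∑ i with col i = j, ‖Z i‖ : ℝ) : ℂ) := by
      push_cast
      refine Finset.sum_congr rfl fun i _ => ?_
      by_cases hi : Z i = 0
      · simp [hi]
      · have : ((‖Z i‖ : ℝ) : ℂ) ≠ 0 := by simpa using hi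
        field_simp
        rw [mul_comm, Complex.mul_conj, Complex.normSq_eq_norm_sq]
        push_cast; ring
    rw [this, mul_inv_cancel₀]
    exact_mod_cast h0.ne'
  · intro z hz
    rw [norm_prod]
    set a : ℕ → ℝ := fun j => ∑ i with col i = j, ‖z i‖ with ha
    have ha0 : ∀ j, 0 ≤ a j := fun j => Finset.sum_nonneg fun _ _ => norm_nonneg _
    have hsum : ∑ j ∈ Finset.range m, a j ≤ 1 :=
      (sum_groups (fun i => ‖z i‖) (fun _ => norm_nonneg _) col _).trans hz
    calc _ ≤ ∏ j ∈ Finset.range m, ((1 / c) * (m * a j)) := by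
          refine Finset.prod_le_prod (fun _ _ => norm_nonneg _) fun j hj => ?_
          have hj' := Finset.mem_range.1 hj
          rw [norm_mul, norm_inv, Complex.norm_real, Real.norm_of_nonneg (hs j hj').le]
          have h1 : ‖∑ i with col i = j, (starRingEnd ℂ (Z i) / ‖Z i‖) * z i‖ ≤ a j := by
            refine (norm_sum_le _ _).trans (Finset.sum_le_sum fun i _ => ?_)
            rw [norm_mul, norm_div, RCLike.norm_conj, Complex.norm_real, norm_norm]
            exact mul_le_of_le_one_left (norm_nonneg _) (div_self_le_one _)
          have h2 : (∑ i with col i = j, ‖Z i‖)⁻¹ ≤ m / c := by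
            rw [← inv_div c]
            exact inv_anti₀ (div_pos hc (hm j hj')) (h j hj')
          calc _ ≤ a j * (m / c) := mul_le_mul h1 h2 (inv_nonneg.2 (hs j hj').le) (ha0 j)
            _ = _ := by ring
      _ = (1 / c) ^ m * ∏ j ∈ Finset.range m, (m * a j) := by
          rw [Finset.prod_mul_distrib]; simp
      _ ≤ (1 / c) ^ m := mul_le_of_le_one_right (by positivity) (prod_am a ha0 hsum)
  · intro z hz
    have : ∃ j ∈ Finset.range m, ∀ i, col i = j → z i = 0 := by
      by_contra hcon
      push Not at hcon
      have := card_cover z col (Finset.range m) fun j hj => by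
        obtain ⟨i, h1, h2⟩ := hcon j hj
        exact ⟨i, h2, h1⟩
      simp at this
      omega
    obtain ⟨j, hj, hz0⟩ := this
    refine Finset.prod_eq_zero hj ?_
    rw [Finset.sum_eq_zero, zero_mul]
    intro i hi
    rw [hz0 i (by simpa using hi), mul_zero]

lemma m_le_two {N : ℕ} (Z z : Fin N → ℂ) (m : ℕ) (col : Fin N → ℕ) (c : ℝ) (hc : 0 < c)
    (h : ∀ j < m, c / m ≤ ∑ i with col i = j, ‖Z i‖) (hd : n1 (z - Z) ≤ c / 2) : m ≤ 2 * nz z := by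
  classical
  rcases Nat.eq_zero_or_pos m with h0 | hm
  · omega
  set K := (Finset.range m).filter fun j => ∃ i, z i ≠ 0 ∧ col i = j with hK
  set T := (Finset.range m).filter fun j => ¬ ∃ i, z i ≠ 0 ∧ col i = j with hT
  have h1 : K.card ≤ nz z := card_cover z col K fun j hj => (Finset.mem_filter.1 hj).2
  have h2 : K.card + T.card = m := by
    rw [hK, hT, Finset.card_filter_add_card_filter_not, Finset.card_range]
  have h3 : (T.card : ℝ) * (c / m) ≤ c / 2 := by
    refine le_trans ?_ hd
    refine le_trans ?_ (sum_groups (fun i => ‖(z - Z) i‖) (fun _ => norm_nonneg _) col T)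
    rw [← nsmul_eq_mul]
    refine Finset.card_nsmul_le_sum _ _ _ fun j hj => ?_
    rw [hT, Finset.mem_filter] at hj
    refine (h j (Finset.mem_range.1 hj.1)).trans (Finset.sum_le_sum fun i hi => ?_)
    have : z i = 0 := by
      by_contra hne
      exact hj.2 ⟨i, hne, by simpa using hi⟩
    simp [this]
  have hm' : (0:ℝ) < m := by exact_mod_cast hm
  have h4 : (2 * T.card : ℝ) ≤ m := by
    have : (T.card : ℝ) * (c / m) = (T.card : ℝ) * c / m := by ring
    rw [this, div_le_iff₀ hm'] at h3
    nlinarith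
  have h5 : 2 * T.card ≤ m := by exact_mod_cast h4
  omega

open Set
open scoped ENNReal NNReal
noncomputable section
set_option linter.unusedSectionVars false
set_option linter.unusedSimpArgs false
open MeasureTheory Filter Topology

lemma SolD.sub_hol {N : ℕ} {ρ A : ℝ} {f : Fin N → (Fin N → ℂ) → ℂ} {U p : (Fin N → ℂ) → ℂ}
    (h : SolD ρ A f U) (hp : ContDiff ℝ 1 p) (hp' : ∀ z, DifferentiableAt ℂ p z) (a : ℂ) :
    SolD ρ A f (fun z => U z - a * p z) where
  cdU := h.cdU.sub (contDiffOn_const.mul hp.contDiffOn)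
  cdf := h.cdf
  db z hz j := by
    have h1 := (hp' z).restrictScalars ℝ
    rw [dbar_sub (da_of_cd h.cdU hz) (h1.const_mul a), dbar_const_mul a h1,
      dbar_zero_of_diff (hp' z), h.db z hz j]
    simp
  bd := h.bd
  lip := h.lip

lemma SolD.mono {N : ℕ} {ρ A A' : ℝ} {f : Fin N → (Fin N → ℂ) → ℂ} {U : (Fin N → ℂ) → ℂ}
    (h : SolD ρ A f U) (hA : A ≤ A') : SolD ρ A' f U where
  cdU := h.cdU
  cdf := h.cdf
  db := h.db
  bd z hz j := (h.bd z hz j).trans hA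
  lip z w hz hw j := (h.lip z w hz hw j).trans (mul_le_mul_of_nonneg_right hA (n1_nonneg _))

theorem thmE1 (ρ : ℝ) (hρ0 : 0 < ρ) (hρ1 : ρ < 1) (Q : ℝ) (hQ : 1 ≤ Q) : ∃ q K : ℝ, 1 ≤ q ∧ 0 ≤ K ∧
    ∀ (N : ℕ) (A : ℝ) (f : Fin N → (Fin N → ℂ) → ℂ) (U : (Fin N → ℂ) → ℂ), 0 ≤ A →
    SolD ((1 + ρ) / 2) A f U → (∀ z, n1 z < (1 + ρ) / 2 → ‖U z‖ ≤ A * Q ^ nz z) →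
    ∀ Z : Fin N → ℂ, n1 Z < ρ → ∃ V : (Fin N → ℂ) → ℂ, SolD ((1 + ρ) / 2) A f V ∧
    ∀ z, n1 z < ρ → ‖V z‖ ≤ n1 (z - Z) * K * q ^ nz z * A := by
  obtain ⟨C, hC, HC⟩ := sliceD
  obtain ⟨κ, hκ, HD⟩ := treeD2 Q hQ
  set δ := (1 - ρ) / 2 with hδ
  have hδ0 : 0 < δ := by rw [hδ]; linarith
  have hδ1 : δ < 1 := by rw [hδ]; linarith
  have hκ0 : 0 < κ := by linarith
  set c := δ / (4 * κ) with hc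
  have hc0 : 0 < c := by positivity
  have hκc : κ * c = δ / 4 := by rw [hc]; field_simp
  have hcδ : 32 * c ≤ δ := by nlinarith
  set ε := c / 10 with hε
  have hε0 : 0 < ε := by positivity
  have hq1 : 1 ≤ 1 / c := by rw [le_div_iff₀ hc0]; linarith
  set q1 := Q * (1 / c) with hq1d
  have hQq : Q ≤ q1 := le_mul_of_one_le_right (by linarith) hq1
  have hq11 : 1 ≤ q1 := hQ.trans hQq
  refine ⟨q1 ^ 2, 3 / ε + C * (1 / ε + 2), one_le_pow₀ hq11, by positivity, ?_⟩
  intro N A f U hA h hU Z hZ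
  obtain ⟨m, col, B, hB, hBs, hcol⟩ := comb (fun i => ‖Z i‖) (fun _ => norm_nonneg _) c hc0
  obtain ⟨p, hp1, hp2, hpZ, hpb, hp0⟩ := pExists Z m col c hc0 hcol
  have hUZ : ‖U Z‖ ≤ 2 * A * Q ^ m := by
    classical
    have hw := HD N _ A f U hA h hU Z (fun i => if i ∈ B then Z i else 0) (δ / 2) (by positivity)
      (by linarith) (by rw [hδ]; linarith) (by
        have : n1 (Z - fun i => if i ∈ B then Z i else 0) ≤ c := by
          refine le_trans (le_of_eq ?_) hBs
          unfold n1
          rw [← Finset.sum_sdiff (Finset.subset_univ B)]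
          have h0 : ∑ i ∈ B, ‖(Z - fun i => if i ∈ B then Z i else 0) i‖ = 0 :=
            Finset.sum_eq_zero fun i hi => by simp [hi]
          rw [h0, add_zero]
          refine Finset.sum_congr rfl fun i hi => ?_
          have : i ∉ B := (Finset.mem_sdiff.1 hi).2
          simp [this]
        have := mul_le_mul_of_nonneg_left this hκ0.le
        linarith)
    refine hw.trans (mul_le_mul_of_nonneg_left (pow_le_pow_right₀ hQ (le_trans ?_ hB)) (by positivity))
    refine Finset.card_le_card fun i hi => ?_
    by_contra hiB
    simp [hiB] at hi
  have hUp : ∀ z, n1 z ≤ 1 → ‖U Z * p z‖ ≤ 2 * A * q1 ^ m := by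
    intro z hz
    rw [norm_mul]
    calc _ ≤ 2 * A * Q ^ m * (1 / c) ^ m := mul_le_mul hUZ (hpb z hz) (norm_nonneg _) (by positivity)
      _ = _ := by rw [hq1d, mul_pow]; ring
  have hV := h.sub_hol hp1 hp2 (U Z)
  refine ⟨_, hV, ?_⟩
  intro z hz
  set n := nz z with hn
  set d := n1 (z - Z) with hd
  have hd0 : 0 ≤ d := n1_nonneg _
  have hqn : q1 ^ n ≤ (q1 ^ 2) ^ n := by
    rw [← pow_mul]; exact pow_le_pow_right₀ hq11 (by omega)
  have hQn : Q ^ n ≤ q1 ^ n := pow_le_pow_left₀ (by linarith) hQq n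
  have hqn1 : 1 ≤ (q1 ^ 2) ^ n := one_le_pow₀ (one_le_pow₀ hq11)
  by_cases hfar : ε ≤ d
  · have h1 := hU z (by linarith)
    have h2 : ‖U Z * p z‖ ≤ 2 * A * q1 ^ n := by
      by_cases hnm : n < m
      · rw [hp0 z hnm]; simp; positivity
      · exact (hUp z (by linarith)).trans (mul_le_mul_of_nonneg_left
          (pow_le_pow_right₀ hq11 (by omega)) (by positivity))
    have h3 : ‖U z - U Z * p z‖ ≤ 3 * A * (q1 ^ 2) ^ n := by
      refine (norm_sub_le _ _).trans ?_
      have : A * Q ^ n ≤ A * q1 ^ n := mul_le_mul_of_nonneg_left hQn hA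
      have : A * q1 ^ n ≤ A * (q1 ^ 2) ^ n := mul_le_mul_of_nonneg_left hqn hA
      linarith
    refine h3.trans ?_
    have h4 : 3 ≤ d * (3 / ε) := by
      rw [mul_div_assoc', le_div_iff₀ hε0]; linarith
    have h5 : 3 ≤ d * (3 / ε + C * (1 / ε + 2)) := by
      have : 0 ≤ d * (C * (1 / ε + 2)) := by positivity
      rw [mul_add]; linarith
    calc 3 * A * (q1 ^ 2) ^ n = 3 * (A * (q1 ^ 2) ^ n) := by ring
      _ ≤ d * (3 / ε + C * (1 / ε + 2)) * (A * (q1 ^ 2) ^ n) :=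
          mul_le_mul_of_nonneg_right h5 (by positivity)
      _ = _ := by ring
  push Not at hfar
  have hm2 : m ≤ 2 * n := m_le_two Z z m col c hc0 hcol (by rw [← hd]; linarith)
  rcases hd0.eq_or_lt with hd00 | hdpos
  · have hzZ : z = Z := by
      ext i
      have := (Finset.sum_eq_zero_iff_of_nonneg (fun i _ => norm_nonneg ((z - Z) i))).1
        (show ∑ i, ‖(z - Z) i‖ = 0 from hd00.symm) i (Finset.mem_univ i)
      simpa [sub_eq_zero] using this
    rw [hzZ, hpZ, mul_one, sub_self, norm_zero]
    positivity
  set ξ : Fin N → ℂ := ((d⁻¹ : ℝ) : ℂ) • (z - Z) with hξ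
  have hξ1 : n1 ξ = 1 := by
    rw [hξ, n1_smul, Complex.norm_real, Real.norm_of_nonneg (by positivity), ← hd,
      inv_mul_cancel₀ hdpos.ne']
  have hzξ : z = Z + (d : ℂ) • ξ := by
    rw [hξ, smul_smul, ← Complex.ofReal_mul, mul_inv_cancel₀ hdpos.ne']
    simp
  have hS : ∀ ζ : ℂ, ‖ζ‖ < 4 * ε → ‖U (Z + ζ • ξ) - U Z * p (Z + ζ • ξ)‖ ≤ 4 * A * (q1 ^ 2) ^ n := by
    intro ζ hζ
    have hv1 : n1 (Z + ζ • ξ) < ρ + 4 * ε := by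
      have := n1_add_le Z (ζ • ξ)
      rw [n1_smul, hξ1] at this
      linarith
    have hv2 : n1 (Z + ζ • ξ - z) ≤ c / 2 := by
      have : Z + ζ • ξ - z = (ζ - d) • ξ := by
        have e0 : (d : ℂ) • ξ = z - Z := by
          rw [eq_sub_iff_add_eq, add_comm]; exact hzξ.symm
        rw [sub_smul, e0]; abel
      rw [this, n1_smul, hξ1, mul_one]
      refine (norm_sub_le _ _).trans ?_
      rw [Complex.norm_real, Real.norm_of_nonneg hd0]
      linarith
    have h1 := HD N _ A f U hA h hU (Z + ζ • ξ) z (δ / 2) (by positivity) (by linarith)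
      (by rw [hδ] at *; linarith) (by
        have := mul_le_mul_of_nonneg_left hv2 hκ0.le
        linarith)
    have h2 := hUp (Z + ζ • ξ) (by rw [hδ] at *; linarith)
    have h3 : q1 ^ m ≤ (q1 ^ 2) ^ n := by
      rw [← pow_mul]; exact pow_le_pow_right₀ hq11 hm2
    refine (norm_sub_le _ _).trans ?_
    have h4 : A * Q ^ n ≤ A * (q1 ^ 2) ^ n := mul_le_mul_of_nonneg_left (hQn.trans hqn) hA
    have h5 : A * q1 ^ m ≤ A * (q1 ^ 2) ^ n := mul_le_mul_of_nonneg_left h3 hA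
    linarith
  have key := HC N _ A f _ hA hV Z ξ (4 * ε) (4 * A * (q1 ^ 2) ^ n) (by positivity) (by positivity)
    hξ1.le (by rw [hδ] at *; linarith) hS (d : ℂ) (by
      rw [Complex.norm_real, Real.norm_of_nonneg hd0]; linarith)
  beta_reduce at key
  rw [← hzξ, hpZ, mul_one, sub_self, sub_zero, Complex.norm_real, Real.norm_of_nonneg hd0] at key
  refine key.trans ?_
  have h1 : 4 * A * (q1 ^ 2) ^ n / (4 * ε) + A + 4 * ε * A ≤ (1 / ε + 2) * (A * (q1 ^ 2) ^ n) := by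
    have e1 : 4 * A * (q1 ^ 2) ^ n / (4 * ε) = 1 / ε * (A * (q1 ^ 2) ^ n) := by field_simp
    have e2 : A ≤ A * (q1 ^ 2) ^ n := le_mul_of_one_le_right hA hqn1
    have e3 : 4 * ε * A ≤ A := mul_le_of_le_one_left hA (by linarith)
    rw [e1, add_mul]; linarith
  calc _ ≤ C * d * ((1 / ε + 2) * (A * (q1 ^ 2) ^ n)) := mul_le_mul_of_nonneg_left h1 (by positivity)
    _ = d * (C * (1 / ε + 2)) * (q1 ^ 2) ^ n * A := by ring
    _ ≤ _ := by
      have : 0 ≤ 3 / ε := by positivity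
      gcongr
      linarith

theorem thmE (ρ : ℝ) (hρ0 : 0 < ρ) (hρ1 : ρ < 1) : ∃ Q : ℝ, 1 < Q ∧
    ∀ (N : ℕ) (A : ℝ) (f : Fin N → (Fin N → ℂ) → ℂ), 0 ≤ A → FormB A f →
    (∀ z w, n1 z < 1 → n1 w < 1 → ∀ j, ‖f j z - f j w‖ ≤ A * n1 (z - w)) →
    ∀ Z : Fin N → ℂ, n1 Z < ρ → ∃ V : (Fin N → ℂ) → ℂ, ContDiffOn ℝ 1 V {z | n1 z < ρ} ∧
    (∀ z, n1 z < ρ → ∀ j, dbar V z (ee j) = f j z) ∧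
    ∀ z, n1 z < ρ → ‖V z‖ ≤ n1 (z - Z) * Q ^ (1 + nz z) * A := by
  obtain ⟨Q, hQ, HQ⟩ := thmC ((1 + ρ) / 2) (by linarith) (by linarith)
  obtain ⟨q, K, hq, hK, HE⟩ := thmE1 ρ hρ0 hρ1 Q hQ
  refine ⟨K * Q + q + 1, by nlinarith, fun N A f hA hf hl Z hZ => ?_⟩
  obtain ⟨U, hU1, hU2, hU3⟩ := HQ N A f hA hf
  have hS : SolD ((1 + ρ) / 2) A f U :=
    { cdU := hU1
      cdf := fun j => (hf.cd j).mono fun z (hz : n1 z < (1 + ρ) / 2) => show n1 z < 1 by linarith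
      db := hU2
      bd := fun z hz => hf.bd z (by linarith)
      lip := fun z w hz hw => hl z w (by linarith) (by linarith) }
  obtain ⟨V, hV1, hV2⟩ := HE N (Q * A) f U (by positivity) (hS.mono (le_mul_of_one_le_left hA hQ))
    (fun z hz => (hU3 z hz).trans (le_of_eq (by rw [pow_add]; ring))) Z hZ
  refine ⟨V, hV1.cdU.mono fun z (hz : n1 z < ρ) => show n1 z < (1 + ρ) / 2 by linarith, fun z hz => hV1.db z (by linarith),
    fun z hz => (hV2 z hz).trans ?_⟩
  have h1 : q ^ nz z ≤ (K * Q + q + 1) ^ nz z := pow_le_pow_left₀ (by linarith) (by nlinarith) _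
  have h2 : K * Q * q ^ nz z ≤ (K * Q + q + 1) ^ (1 + nz z) := by
    rw [pow_add, pow_one]
    exact mul_le_mul (by linarith) h1 (by positivity) (by positivity)
  calc _ = n1 (z - Z) * (K * Q * q ^ nz z) * A := by ring
    _ ≤ _ := mul_le_mul_of_nonneg_right (mul_le_mul_of_nonneg_left h2 (n1_nonneg _)) hA

open Set
open scoped ENNReal NNReal
noncomputable section
set_option linter.unusedSectionVars false
set_option linter.unusedSimpArgs false
open MeasureTheory Filter Topology

def eqv (N : ℕ) : EN N ≃L[ℂ] (Fin N → ℂ) := PiLp.continuousLinearEquiv 1 ℂ (fun _ : Fin N => ℂ)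

lemma eqv_apply {N : ℕ} (z : EN N) (i : Fin N) : eqv N z i = z i := rfl

lemma norm_eqv {N : ℕ} (z : EN N) : n1 (eqv N z) = ‖z‖ := by
  rw [PiLp.norm_eq_of_L1]; rfl

lemma norm_eqv_symm {N : ℕ} (z : Fin N → ℂ) : ‖(eqv N).symm z‖ = n1 z := by
  rw [← norm_eqv, ContinuousLinearEquiv.apply_symm_apply]

lemma sum_eqv {N : ℕ} (ξ : EN N) : ∑ j, ξ j • (eqv N).symm (ee j) = ξ := by
  apply (eqv N).injective
  rw [map_sum]
  ext i
  simp only [map_smul, ContinuousLinearEquiv.apply_symm_apply, Finset.sum_apply, Pi.smul_apply]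
  rw [Finset.sum_eq_single i]
  · simp [eqv_apply]
  · intro b _ hb; simp [hb.symm]
  · simp

lemma nz_ncard {N : ℕ} (z : EN N) (a : ℂ) (ha : a ≠ 0) :
    nz (a • eqv N z) = {i : Fin N | z i ≠ 0}.ncard := by
  classical
  unfold nz
  rw [← Set.ncard_coe_finset]
  congr 1
  ext i
  simp [ha, eqv_apply]

lemma conj_sum {V ι : Type*} [NormedAddCommGroup V] [NormedSpace ℂ V] (g : V → ℂ)
    (h1 : ∀ ξ η, g (ξ + η) = g ξ + g η) (h2 : ∀ (a : ℂ) ξ, g (a • ξ) = (starRingEnd ℂ) a * g ξ)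
    (s : Finset ι) (a : ι → ℂ) (e : ι → V) :
    g (∑ j ∈ s, a j • e j) = ∑ j ∈ s, (starRingEnd ℂ) (a j) * g (e j) := by
  classical
  induction s using Finset.induction_on with
  | empty => simpa using h2 0 0
  | insert i s hi ih => rw [Finset.sum_insert hi, Finset.sum_insert hi, h1, h2, ih]

/-- For every `ρ ∈ (0,1)` there is `Q > 1`, depending only on `ρ`, such that
for every `N ≥ 1`, `0 < R < ∞`, every `Z ∈ B_N(ρR)` and every `∂̄`-closed `(0,1)`-form `f` of
class `C¹` on `B_N(R) ⊆ ℂ^N` (`l¹` norm), Lipschitz continuous on `B_N(R)`, there is a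
continuously differentiable `U` on `B_N(ρR)` with `∂̄U = f` there and
`|U(z)| ≤ ‖z − Z‖·Q^{1+#z}·(|f|₀ + R|f|₁)` for `z ∈ B_N(ρR)`. -/
theorem statement12 (ρ : ℝ) (hρ0 : 0 < ρ) (hρ1 : ρ < 1) :
    ∃ Q : ℝ, 1 < Q ∧
      ∀ (N : ℕ), 0 < N → ∀ (R : ℝ), 0 < R → ∀ Z : EN N, ‖Z‖ < ρ * R →
        ∀ f : EN N → EN N → ℂ,
          IsForm01 1 {z : EN N | ‖z‖ < R} f →
          DbarClosed {z : EN N | ‖z‖ < R} f →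
          LipschitzForm f {z : EN N | ‖z‖ < R} →
          ∃ U : EN N → ℂ,
            ContDiffOn ℝ 1 U {z : EN N | ‖z‖ < ρ * R} ∧
            (∀ z : EN N, ‖z‖ < ρ * R → ∀ ξ : EN N, dbar U z ξ = f z ξ) ∧
            ∀ z : EN N, ‖z‖ < ρ * R →
              ‖U z‖ ≤ ‖z - Z‖ * Q ^ (1 + {i : Fin N | z i ≠ 0}.ncard) *
                (formNorm0 f {z : EN N | ‖z‖ < R} +
                  R * formNorm1 f {z : EN N | ‖z‖ < R}) := by

  obtain ⟨Q, hQ, H⟩ := thmE ρ hρ0 hρ1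
  refine ⟨Q, hQ, fun N _ R hR Z hZ f hf hcl hl => ?_⟩
  obtain ⟨hf1, hf2, hf3⟩ := hf
  set Ω : Set (EN N) := {z : EN N | ‖z‖ < R} with hΩ
  have hRc : (R : ℂ) ≠ 0 := by exact_mod_cast hR.ne'
  have hΩo : IsOpen Ω := isOpen_lt continuous_norm continuous_const
  have hF0 : 0 ≤ formNorm0 f Ω := Real.sSup_nonneg fun x hx => by
    obtain ⟨z, _, ξ, _, rfl⟩ := hx; positivity
  have hF1 : 0 ≤ formNorm1 f Ω := Real.sSup_nonneg fun x hx => by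
    obtain ⟨z, _, w, _, _, ξ, _, rfl⟩ := hx; positivity
  have hb0 : ∀ z ∈ Ω, ∀ ξ : EN N, ‖ξ‖ ≤ 1 → ‖f z ξ‖ ≤ formNorm0 f Ω := fun z hz ξ hξ =>
    le_csSup hl.1 ⟨z, hz, ξ, hξ, rfl⟩
  have hb1 : ∀ z ∈ Ω, ∀ w ∈ Ω, ∀ ξ : EN N, ‖ξ‖ ≤ 1 → ‖f z ξ - f w ξ‖ ≤ formNorm1 f Ω * ‖z - w‖ := by
    intro z hz w hw ξ hξ
    by_cases hzw : z = w
    · subst hzw; simp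
    · have : 0 < ‖z - w‖ := norm_pos_iff.2 (sub_ne_zero.2 hzw)
      rw [← div_le_iff₀ this]
      exact le_csSup hl.2 ⟨z, hz, w, hw, hzw, ξ, hξ, rfl⟩
  set F0 := formNorm0 f Ω with hF0d
  set F1 := formNorm1 f Ω with hF1d
  set E : Fin N → EN N := fun j => (eqv N).symm (ee j) with hE
  have hE1 : ∀ j, ‖E j‖ ≤ 1 := fun j => by rw [hE, norm_eqv_symm, n1_ee]
  set L : (Fin N → ℂ) →L[ℂ] EN N := (R : ℂ) • ((eqv N).symm : (Fin N → ℂ) →L[ℂ] EN N) with hL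
  have hLn : ∀ w, ‖L w‖ = R * n1 w := fun w => by
    have : L w = (R : ℂ) • (eqv N).symm w := rfl
    rw [this, norm_smul, norm_eqv_symm, Complex.norm_real, Real.norm_of_nonneg hR.le]
  have hLE : ∀ j, L (ee j) = (R : ℂ) • E j := fun j => rfl
  set M : EN N →L[ℂ] (Fin N → ℂ) := (R : ℂ)⁻¹ • ((eqv N) : EN N →L[ℂ] (Fin N → ℂ)) with hM
  have hMa : ∀ w, M w = (R : ℂ)⁻¹ • eqv N w := fun w => rfl
  have hMn : ∀ w, n1 (M w) = ‖w‖ / R := fun w => by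
    rw [hMa, n1_smul, norm_eqv, norm_inv, Complex.norm_real, Real.norm_of_nonneg hR.le]
    ring
  have hLM : ∀ w, L (M w) = w := fun w => by
    have : L (M w) = (R : ℂ) • (eqv N).symm ((R : ℂ)⁻¹ • eqv N w) := rfl
    rw [this, map_smul, smul_smul, mul_inv_cancel₀ hRc, one_smul, ContinuousLinearEquiv.symm_apply_apply]
  have hLΩ : ∀ w, n1 w < 1 → L w ∈ Ω := fun w hw => by
    show ‖L w‖ < R
    rw [hLn]; nlinarith
  have hfd : ∀ ξ, ContDiffOn ℝ 1 (fun w => f w ξ) Ω := by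
    intro ξ
    have h1 : ContDiffOn ℝ 1 (fun w : EN N => (w, ξ)) Ω :=
      (contDiff_id.prodMk contDiff_const).contDiffOn
    exact ContDiffOn.comp (t := Ω ×ˢ (univ : Set (EN N))) hf3 h1 fun w hw => ⟨hw, trivial⟩
  have hfda : ∀ ξ, ∀ z ∈ Ω, DifferentiableAt ℝ (fun w => f w ξ) z := fun ξ z hz =>
    ((hfd ξ).differentiableOn (by norm_num)).differentiableAt (hΩo.mem_nhds hz)
  have hLd : ∀ z, HasFDerivAt (fun w => L w) (L.restrictScalars ℝ) z := fun z =>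
    (L.restrictScalars ℝ).hasFDerivAt
  have hMd : ∀ z, HasFDerivAt (fun w => M w) (M.restrictScalars ℝ) z := fun z =>
    (M.restrictScalars ℝ).hasFDerivAt
  have hLc : ∀ s, ContDiffOn ℝ 1 (fun w => L w) s := fun s => (L.restrictScalars ℝ).contDiff.contDiffOn
  have hMc : ∀ s, ContDiffOn ℝ 1 (fun w => M w) s := fun s => (M.restrictScalars ℝ).contDiff.contDiffOn
  have hMR : ∀ z : EN N, ‖z‖ < ρ * R → n1 (M z) < ρ := fun z hz => by
    rw [hMn, div_lt_iff₀ hR]; exact hz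
  have hdL : ∀ z, n1 z < 1 → ∀ i j,
      dbar (fun w => (R : ℂ) * f (L w) (E i)) z (ee j) =
        (R : ℂ) * ((starRingEnd ℂ) (R : ℂ) * dbar (fun w => f w (E i)) (L z) (E j)) := by
    intro z hz i j
    have h1 := hfda (E i) (L z) (hLΩ z hz)
    have h2 : DifferentiableAt ℝ (fun w => f (L w) (E i)) z :=
      DifferentiableAt.comp z (g := fun w => f w (E i)) h1 (hLd z).differentiableAt
    rw [dbar_const_mul (R : ℂ) h2, dbar_comp (u := fun w => f w (E i)) h1 (hLd z), hLE, dbar_smul]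
  have hA : 0 ≤ R * (F0 + R * F1) := by positivity
  obtain ⟨V, hV1, hV2, hV3⟩ := H N (R * (F0 + R * F1)) (fun j w => (R : ℂ) * f (L w) (E j)) hA
    { cd := fun j => contDiffOn_const.mul ((hfd (E j)).comp (hLc _) fun w hw => hLΩ w hw)
      closed := fun z hz i j => by
        rw [hdL z hz i j, hdL z hz j i, hcl (L z) (hLΩ z hz)]
      bd := fun z hz j => by
        rw [norm_mul, Complex.norm_real, Real.norm_of_nonneg hR.le]
        refine mul_le_mul_of_nonneg_left ((hb0 _ (hLΩ z hz) _ (hE1 j)).trans ?_) hR.le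
        have : 0 ≤ R * F1 := by positivity
        linarith }
    (fun z w hz hw j => by
      rw [← mul_sub, norm_mul, Complex.norm_real, Real.norm_of_nonneg hR.le]
      have h1 := hb1 _ (hLΩ z hz) _ (hLΩ w hw) _ (hE1 j)
      rw [← map_sub, hLn] at h1
      have h2 := n1_nonneg (z - w)
      calc _ ≤ R * (F1 * (R * n1 (z - w))) := mul_le_mul_of_nonneg_left h1 hR.le
        _ ≤ R * (F1 * (R * n1 (z - w))) + R * F0 * n1 (z - w) := le_add_of_nonneg_right (by positivity)
        _ = _ := by ring) (M Z) (hMR Z hZ)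
  refine ⟨fun z => V (M z), hV1.comp (hMc _) fun z hz => hMR z hz, ?_, ?_⟩
  · intro z hz ξ
    have hMz := hMR z hz
    have hzΩ : z ∈ Ω := by
      show ‖z‖ < R
      nlinarith
    rw [dbar_comp (u := V) (da_of_cd hV1 hMz) (hMd z), dbar_eq_sum]
    conv_rhs => rw [← sum_eqv ξ]
    rw [conj_sum (f z) (hf1 z hzΩ) (hf2 z hzΩ)]
    refine Finset.sum_congr rfl fun j _ => ?_
    rw [hV2 _ hMz j, hLM, hMa]
    have : ((R : ℂ)⁻¹ • eqv N ξ) j = (R : ℂ)⁻¹ * ξ j := rfl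
    rw [this, map_mul, map_inv₀, Complex.conj_ofReal]
    field_simp
    rfl
  · intro z hz
    refine (hV3 _ (hMR z hz)).trans (le_of_eq ?_)
    rw [← map_sub, hMn, hMa, nz_ncard z _ (inv_ne_zero hRc)]
    field_simp
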